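/- Let L be a global function field of characteristic p > 0 containing a primitive q-th root of unity, where q ≠ p is prime. Let a ∈ L^× be an element whose divisor over L is the q-th power of another L-divisor (i.e. ord_𝔭 a ≡ 0 mod q for every prime 𝔭 of L). Let z ∈ L^× be such that every prime 𝔭_L of L satisfies at least one of: (a) 𝔭_L splits completely in L(a^{1/q})/L; (b) ord_{𝔭_L} z ≡ 0 mod q. Then there exists y ∈ L(a^{1/q}) with N_{L(a^{1/q})/L}(y) = z. -/

import Mathlib

noncomputable section

/-- A normalized (surjective onto `ℤ`) discrete valuation on a field `K`, i.e. a
"prime" of a global function field. -/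
structure FFPrime (K : Type) [Field K] where
  ord : K → WithTop ℤ
  ord_zero : ord 0 = ⊤
  ord_ne_top : ∀ x : K, x ≠ 0 → ord x ≠ ⊤
  ord_one : ord 1 = 0
  ord_mul : ∀ x y : K, ord (x * y) = ord x + ord y
  ord_add : ∀ x y : K, min (ord x) (ord y) ≤ ord (x + y)
  ord_surj : ∀ n : ℤ, ∃ x : K, ord x = (n : WithTop ℤ)

namespace FFPrime

variable {K L : Type} [Field K] [Field L]

/-- `w` lies over `v` along `φ`, with ramification index `e`. -/
def LiesOverWith (w : FFPrime L) (v : FFPrime K) (φ : K →+* L) (e : ℕ) : Prop :=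
  0 < e ∧ ∀ x : K, w.ord (φ x) = ((e : ℤ) : WithTop ℤ) * v.ord x

/-- `w` lies over `v` along `φ`. -/
def LiesOver (w : FFPrime L) (v : FFPrime K) (φ : K →+* L) : Prop :=
  ∃ e : ℕ, w.LiesOverWith v φ e

open Classical in
/-- The ramification index `e(w/v)`. -/
noncomputable def ramIdx (w : FFPrime L) (v : FFPrime K) (φ : K →+* L) : ℕ :=
  if h : ∃ e : ℕ, w.LiesOverWith v φ e then h.choose else 0

/-- The residue field of `v` has exactly `n` elements. -/
def HasResidueCard (v : FFPrime K) (n : ℕ) : Prop :=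
  ∃ s : Finset K, s.card = n ∧ (∀ x ∈ s, 0 ≤ v.ord x) ∧
    (∀ x ∈ s, ∀ y ∈ s, x ≠ y → ¬ 0 < v.ord (x - y)) ∧
    (∀ z : K, 0 ≤ v.ord z → ∃ x ∈ s, 0 < v.ord (z - x))

open Classical in
/-- The residue (relative) degree `f(w/v)`: the unique `f ≥ 1` with
`#κ_w = (#κ_v) ^ f` (residue fields of global function fields are finite). -/
noncomputable def resDeg (w : FFPrime L) (v : FFPrime K) : ℕ :=
  if h : ∃ f : ℕ, 0 < f ∧ ∃ m n : ℕ, 1 < m ∧ v.HasResidueCard m ∧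
      w.HasResidueCard n ∧ n = m ^ f then h.choose else 0

/-- `v` splits completely in the extension given by `φ`: every prime above it has
ramification index and residue degree `1`. -/
def SplitsCompletely (v : FFPrime K) (φ : K →+* L) : Prop :=
  ∀ w : FFPrime L, w.LiesOver v φ → w.ramIdx v φ = 1 ∧ w.resDeg v = 1

/-- `v` is inert in the finite extension `M/K`: there is a unique prime above it, with
ramification index `1` and residue degree `[M : K]`. -/
def IsInert (v : FFPrime K) (M : Type) [Field M] [Algebra K M] : Prop :=
  (∃! w : FFPrime M, w.LiesOver v (algebraMap K M)) ∧
    ∀ w : FFPrime M, w.LiesOver v (algebraMap K M) →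
      w.ramIdx v (algebraMap K M) = 1 ∧ w.resDeg v = Module.finrank K M

/-- `v` ramifies in the extension given by `φ`: some prime above it has ramification
index `> 1`. -/
def Ramifies (v : FFPrime K) (φ : K →+* L) : Prop :=
  ∃ w : FFPrime L, w.LiesOver v φ ∧ 2 ≤ w.ramIdx v φ

/-- `ord_v z ≡ 0 mod q`. -/
def OrdDvd (v : FFPrime K) (q : ℕ) (z : K) : Prop :=
  ∃ n : ℤ, v.ord z = (((q : ℤ) * n : ℤ) : WithTop ℤ)

end FFPrime

/-- A nontrivial (rank one) valuation on a possibly infinite algebraic extension of a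
global function field, with values in `ℚ ∪ {∞}`. -/
structure FFVal (B : Type) [Field B] where
  ord : B → WithTop ℚ
  ord_zero : ord 0 = ⊤
  ord_ne_top : ∀ x : B, x ≠ 0 → ord x ≠ ⊤
  ord_one : ord 1 = 0
  ord_mul : ∀ x y : B, ord (x * y) = ord x + ord y
  ord_add : ∀ x y : B, min (ord x) (ord y) ≤ ord (x + y)
  nontrivial : ∃ x : B, ord x ≠ 0 ∧ ord x ≠ ⊤

/-- The valuation `V` of the big field restricts, up to a normalization factor `c`, to
the (normalized discrete) prime `v` of `K` along `φ`; i.e. `v` is the prime of `K`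
lying below `V`. -/
def FFVal.RestrictsTo {K B : Type} [Field K] [Field B] (V : FFVal B) (v : FFPrime K)
    (φ : K →+* B) : Prop :=
  ∃ c : ℚ, 0 < c ∧
    ∀ x : K, V.ord (φ x) = ((c : ℚ) : WithTop ℚ) * WithTop.map (fun n : ℤ => (n : ℚ)) (v.ord x)

/-- The algebraic extension `B` of the rational function field `F0 = 𝔽_p(t)` is
`q`-bounded: for every valuation of `B`, the `q`-adic valuations of the ramification
indices and residue degrees along every finite subextension are bounded. -/
def IsQBounded (q : ℕ) (F0 B : Type) [Field F0] [Field B] [Algebra F0 B] : Prop :=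
  ∀ V : FFVal B, ∃ C : ℕ,
    ∀ L : IntermediateField F0 B, FiniteDimensional F0 L →
      ∀ v0 : FFPrime F0, ∀ vL : FFPrime L,
        V.RestrictsTo v0 (algebraMap F0 B) →
        V.RestrictsTo vL L.val.toRingHom →
        padicValNat q (vL.ramIdx v0 (algebraMap F0 L)) ≤ C ∧
        padicValNat q (vL.resDeg v0) ≤ C

/-- The prime `v` of `K` has uniformly `q`-bounded ramification in `B`. -/
def UnifQBoundedRam (q : ℕ) {K : Type} [Field K] (B : Type) [Field B] [Algebra K B]
    (v : FFPrime K) : Prop :=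
  ∃ C : ℕ, ∀ F : IntermediateField K B, FiniteDimensional K F →
    ∀ w : FFPrime F, w.LiesOver v (algebraMap K F) →
      padicValNat q (w.ramIdx v (algebraMap K F)) ≤ C

/-- The prime `v` of `K` has uniformly absolutely bounded ramification in `B`. -/
def UnifAbsBoundedRam {K : Type} [Field K] (B : Type) [Field B] [Algebra K B]
    (v : FFPrime K) : Prop :=
  ∃ C : ℕ, ∀ F : IntermediateField K B, FiniteDimensional K F →
    ∀ w : FFPrime F, w.LiesOver v (algebraMap K F) →
      w.ramIdx v (algebraMap K F) ≤ C

/-- The prime `v` of `K` has uniformly `q`-bounded relative (residue) degree in `B`. -/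
def UnifQBoundedRes (q : ℕ) {K : Type} [Field K] (B : Type) [Field B] [Algebra K B]
    (v : FFPrime K) : Prop :=
  ∃ C : ℕ, ∀ F : IntermediateField K B, FiniteDimensional K F →
    ∀ w : FFPrime F, w.LiesOver v (algebraMap K F) →
      padicValNat q (w.resDeg v) ≤ C

/-- The prime `v` of `K` is uniformly `q`-bounded in `B`. -/
def UniformlyQBoundedAt (q : ℕ) {K : Type} [Field K] (B : Type) [Field B] [Algebra K B]
    (v : FFPrime K) : Prop :=
  UnifQBoundedRam q B v ∧ UnifQBoundedRes q B v

/-- The integral closure in `B` of the valuation ring `O_v = {x ∈ K : ord_v x ≥ 0}`. -/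
def valIntegralClosure {K : Type} [Field K] (v : FFPrime K) (B : Type) [Field B]
    [Algebra K B] : Set B :=
  {x : B | ∃ P : Polynomial K, P.Monic ∧ (∀ n : ℕ, 0 ≤ v.ord (P.coeff n)) ∧
    Polynomial.aeval x P = 0}

/-- The integral closure in `B` of the ring `O_{K,S}` of `S`-integers of `K`. -/
def sIntegralClosure {K : Type} [Field K] (S : Set (FFPrime K)) (B : Type) [Field B]
    [Algebra K B] : Set B :=
  {x : B | ∃ P : Polynomial K, P.Monic ∧
    (∀ n : ℕ, ∀ v : FFPrime K, v ∉ S → 0 ≤ v.ord (P.coeff n)) ∧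
    Polynomial.aeval x P = 0}

/-- Elements of `B` that are units at every prime of `B` lying over a prime of `S`. -/
def unitsAtS {K : Type} [Field K] (S : Set (FFPrime K)) (B : Type) [Field B]
    [Algebra K B] : Set B :=
  {x : B | ∀ V : FFVal B, (∃ v ∈ S, V.RestrictsTo v (algebraMap K B)) → V.ord x = 0}

/-- Elements `x` of `B` with `ord (x - 1) > 0` at every prime of `B` lying over a
prime of `S`. -/
def onesAtS {K : Type} [Field K] (S : Set (FFPrime K)) (B : Type) [Field B]
    [Algebra K B] : Set B :=
  {x : B | ∀ V : FFVal B, (∃ v ∈ S, V.RestrictsTo v (algebraMap K B)) → 0 < V.ord (x - 1)}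

/-- A subset of a commutative ring is first-order definable in the language of rings
`{0, 1, +, ·}` with parameters from the ring. -/
def FODefinable {R : Type} [CommRing R] (X : Set R) : Prop :=
  letI : FirstOrder.Ring.CompatibleRing R := FirstOrder.Ring.compatibleRingOfRing R
  Set.Definable₁ (Set.univ : Set R) FirstOrder.Language.ring X

/-- A subset of a commutative ring is existentially (diophantine) definable: it is cut
out by a block of existential quantifiers followed by a system of polynomial equations,
with parameters (coefficients) from the ring. -/
def ExistDefinable {R : Type} [CommRing R] (X : Set R) : Prop :=
  ∃ (k m : ℕ) (P : Fin m → MvPolynomial (Fin (k + 1)) R),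
    ∀ x : R, x ∈ X ↔ ∃ y : Fin k → R, ∀ i : Fin m,
      MvPolynomial.eval (Fin.cons x y) (P i) = 0

/-- Solvability of the norm equation `N(y) = b·x^q + b^q` over (every realization of)
the tower `L₂(a^{1/q})/L₂`, where `L₁ = F((1+(b x^q+b^q)⁻¹)^{1/q})` and
`L₂ = L₁((1+(a+a⁻¹)b⁻¹)^{1/q})`. -/
def NormTower2Solvable (q : ℕ) (F : Type) [Field F] (a b x : F) : Prop :=
  ∀ (M1 : Type) [Field M1] [Algebra F M1] (α1 : M1),
    α1 ^ q = algebraMap F M1 (1 + (b * x ^ q + b ^ q)⁻¹) →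
    IntermediateField.adjoin F {α1} = ⊤ →
    ∀ (M2 : Type) [Field M2] [Algebra M1 M2] (α2 : M2),
      α2 ^ q = algebraMap M1 M2 (algebraMap F M1 (1 + (a + a⁻¹) * b⁻¹)) →
      IntermediateField.adjoin M1 {α2} = ⊤ →
      ∀ (M3 : Type) [Field M3] [Algebra M2 M3] (α3 : M3),
        α3 ^ q = algebraMap M2 M3 (algebraMap M1 M2 (algebraMap F M1 a)) →
        IntermediateField.adjoin M2 {α3} = ⊤ →
        ∃ y : M3, Algebra.norm M2 y = algebraMap M1 M2 (algebraMap F M1 (b * x ^ q + b ^ q))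

/-- Solvability of the norm equation `N(y) = b·x^q + b^q` over (every realization of)
the tower `L₄(a^{1/q})/L₄`, where `L₁ = F((1+(b x^q+b^q)⁻¹)^{1/q})`,
`L₃ = L₁((1+x⁻¹)^{1/q})` and `L₄ = L₃((1+(a+a⁻¹)x⁻¹)^{1/q})`. -/
def NormTower4Solvable (q : ℕ) (F : Type) [Field F] (a b x : F) : Prop :=
  ∀ (M1 : Type) [Field M1] [Algebra F M1] (α1 : M1),
    α1 ^ q = algebraMap F M1 (1 + (b * x ^ q + b ^ q)⁻¹) →
    IntermediateField.adjoin F {α1} = ⊤ →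
    ∀ (M3 : Type) [Field M3] [Algebra M1 M3] (α3 : M3),
      α3 ^ q = algebraMap M1 M3 (algebraMap F M1 (1 + x⁻¹)) →
      IntermediateField.adjoin M1 {α3} = ⊤ →
      ∀ (M4 : Type) [Field M4] [Algebra M3 M4] (α4 : M4),
        α4 ^ q = algebraMap M3 M4 (algebraMap M1 M3 (algebraMap F M1 (1 + (a + a⁻¹) * x⁻¹))) →
        IntermediateField.adjoin M3 {α4} = ⊤ →
        ∀ (M5 : Type) [Field M5] [Algebra M4 M5] (α5 : M5),
          α5 ^ q = algebraMap M4 M5 (algebraMap M3 M4 (algebraMap M1 M3 (algebraMap F M1 a))) →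
          IntermediateField.adjoin M4 {α5} = ⊤ →
          ∃ y : M5, Algebra.norm M4 y =
            algebraMap M3 M4 (algebraMap M1 M3 (algebraMap F M1 (b * x ^ q + b ^ q)))

/-- Unsolvability of the norm equation `N(y) = b·x^q + b^q` over (every realization of)
the tower `L₄(a^{1/q})/L₄` as in `NormTower4Solvable`. -/
def NormTower4Unsolvable (q : ℕ) (F : Type) [Field F] (a b x : F) : Prop :=
  ∀ (M1 : Type) [Field M1] [Algebra F M1] (α1 : M1),
    α1 ^ q = algebraMap F M1 (1 + (b * x ^ q + b ^ q)⁻¹) →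
    IntermediateField.adjoin F {α1} = ⊤ →
    ∀ (M3 : Type) [Field M3] [Algebra M1 M3] (α3 : M3),
      α3 ^ q = algebraMap M1 M3 (algebraMap F M1 (1 + x⁻¹)) →
      IntermediateField.adjoin M1 {α3} = ⊤ →
      ∀ (M4 : Type) [Field M4] [Algebra M3 M4] (α4 : M4),
        α4 ^ q = algebraMap M3 M4 (algebraMap M1 M3 (algebraMap F M1 (1 + (a + a⁻¹) * x⁻¹))) →
        IntermediateField.adjoin M3 {α4} = ⊤ →
        ∀ (M5 : Type) [Field M5] [Algebra M4 M5] (α5 : M5),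
          α5 ^ q = algebraMap M4 M5 (algebraMap M3 M4 (algebraMap M1 M3 (algebraMap F M1 a))) →
          IntermediateField.adjoin M4 {α5} = ⊤ →
          ¬ ∃ y : M5, Algebra.norm M4 y =
            algebraMap M3 M4 (algebraMap M1 M3 (algebraMap F M1 (b * x ^ q + b ^ q)))


section HelperMaterial
set_option linter.all false
open Polynomial

namespace FFPrime

section Basic

variable {K : Type} [Field K]

/-- Integer-valued order, with junk value `0` at `0`. -/
def o (v : FFPrime K) (x : K) : ℤ := (v.ord x).untopD 0

lemma coe_o (v : FFPrime K) {x : K} (hx : x ≠ 0) : v.ord x = ((v.o x : ℤ) : WithTop ℤ) := by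
  have h := v.ord_ne_top x hx
  unfold o
  cases hh : v.ord x with
  | top => exact absurd hh h
  | coe n => simp

@[simp] lemma o_zero (v : FFPrime K) : v.o 0 = 0 := by simp [o, v.ord_zero]

@[simp] lemma o_one (v : FFPrime K) : v.o 1 = 0 := by simp [o, v.ord_one]

lemma o_mul (v : FFPrime K) {x y : K} (hx : x ≠ 0) (hy : y ≠ 0) :
    v.o (x * y) = v.o x + v.o y := by
  have h := v.ord_mul x y
  rw [v.coe_o hx, v.coe_o hy, v.coe_o (mul_ne_zero hx hy)] at h
  exact_mod_cast h

lemma o_inv (v : FFPrime K) (x : K) : v.o x⁻¹ = - v.o x := by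
  by_cases hx : x = 0
  · simp [hx]
  have h := v.o_mul hx (inv_ne_zero hx)
  rw [mul_inv_cancel₀ hx, o_one] at h
  omega

lemma o_div (v : FFPrime K) {x y : K} (hx : x ≠ 0) (hy : y ≠ 0) :
    v.o (x / y) = v.o x - v.o y := by
  rw [div_eq_mul_inv, v.o_mul hx (inv_ne_zero hy), o_inv]; ring

lemma o_pow (v : FFPrime K) (x : K) (n : ℕ) : v.o (x ^ n) = n * v.o x := by
  by_cases hx : x = 0
  · subst hx
    cases n <;> simp
  induction n with
  | zero => simp
  | succ n ih => rw [pow_succ, v.o_mul (pow_ne_zero n hx) hx, ih]; push_cast; ring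

lemma o_eq_zero_of_pow_eq_one (v : FFPrime K) {x : K} {n : ℕ} (hn : n ≠ 0) (h : x ^ n = 1) :
    v.o x = 0 := by
  have h1 := v.o_pow x n
  rw [h, o_one] at h1
  have : (n : ℤ) ≠ 0 := by exact_mod_cast hn
  exact (mul_eq_zero.mp h1.symm).resolve_left this

lemma o_neg (v : FFPrime K) (x : K) : v.o (-x) = v.o x := by
  by_cases hx : x = 0
  · simp [hx]
  have h1 : v.o (-1 : K) = 0 := v.o_eq_zero_of_pow_eq_one (n := 2) (by norm_num) (by norm_num)
  rw [neg_eq_neg_one_mul, v.o_mul (by norm_num) hx, h1, zero_add]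

lemma o_add (v : FFPrime K) {x y : K} (hx : x ≠ 0) (hy : y ≠ 0) (hxy : x + y ≠ 0) :
    min (v.o x) (v.o y) ≤ v.o (x + y) := by
  have h := v.ord_add x y
  rw [v.coe_o hx, v.coe_o hy, v.coe_o hxy] at h
  exact_mod_cast h

lemma o_surj (v : FFPrime K) (n : ℤ) : ∃ x : K, x ≠ 0 ∧ v.o x = n := by
  obtain ⟨x, hx⟩ := v.ord_surj n
  have hx0 : x ≠ 0 := by
    rintro rfl
    rw [v.ord_zero] at hx
    exact absurd hx (by simp)
  refine ⟨x, hx0, ?_⟩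
  rw [v.coe_o hx0] at hx
  exact_mod_cast hx

lemma ext_o {v w : FFPrime K} (h : ∀ x : K, x ≠ 0 → v.o x = w.o x) : v = w := by
  have : v.ord = w.ord := by
    funext x
    by_cases hx : x = 0
    · rw [hx, v.ord_zero, w.ord_zero]
    · rw [v.coe_o hx, w.coe_o hx, h x hx]
  cases v; cases w; simp_all

open Classical in
/-- Constructor from an integer-valued function. -/
def ofO (f : K → ℤ) (hmul : ∀ x y : K, x ≠ 0 → y ≠ 0 → f (x * y) = f x + f y)
    (hadd : ∀ x y : K, x ≠ 0 → y ≠ 0 → x + y ≠ 0 → min (f x) (f y) ≤ f (x + y))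
    (hsurj : ∀ n : ℤ, ∃ x : K, x ≠ 0 ∧ f x = n) : FFPrime K where
  ord x := if x = 0 then ⊤ else (f x : WithTop ℤ)
  ord_zero := by simp
  ord_ne_top x hx := by simp [hx]
  ord_one := by
    have h := hmul 1 1 one_ne_zero one_ne_zero
    rw [one_mul] at h
    have : f 1 = 0 := by omega
    simp [this]
  ord_mul x y := by
    by_cases hx : x = 0
    · simp [hx]
    by_cases hy : y = 0
    · simp [hy]
    simp [hx, hy, hmul x y hx hy]
  ord_add x y := by
    by_cases hx : x = 0
    · simp [hx]
    by_cases hy : y = 0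
    · simp [hy]
    by_cases hxy : x + y = 0
    · simp [hxy]
    have := hadd x y hx hy hxy
    simp only [hx, hy, hxy, if_false]
    exact_mod_cast this
  ord_surj n := by
    obtain ⟨x, hx, h⟩ := hsurj n
    exact ⟨x, by simp [hx, h]⟩

lemma ofO_o (f : K → ℤ) (hmul hadd hsurj) {x : K} (hx : x ≠ 0) :
    (ofO f hmul hadd hsurj).o x = f x := by
  simp [o, ofO, hx]

/-- The fractional ideal of elements of order at least `n`. -/
def V (v : FFPrime K) (n : ℤ) : AddSubgroup K where
  carrier := {x | x = 0 ∨ n ≤ v.o x}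
  zero_mem' := Or.inl rfl
  add_mem' := by
    intro x y hx hy
    by_cases hx0 : x = 0
    · simpa [hx0] using hy
    by_cases hy0 : y = 0
    · simpa [hy0] using hx
    by_cases hxy : x + y = 0
    · exact Or.inl hxy
    have := v.o_add hx0 hy0 hxy
    right
    have h1 := hx.resolve_left hx0
    have h2 := hy.resolve_left hy0
    exact le_trans (le_min h1 h2) this
  neg_mem' := by
    intro x hx
    simpa [o_neg] using hx

lemma mem_V {v : FFPrime K} {n : ℤ} {x : K} : x ∈ v.V n ↔ x = 0 ∨ n ≤ v.o x := Iff.rfl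

lemma mem_V_of_ne {v : FFPrime K} {n : ℤ} {x : K} (hx : x ≠ 0) : x ∈ v.V n ↔ n ≤ v.o x := by
  simp [mem_V, hx]

lemma mem_V_iff_ord {v : FFPrime K} {n : ℤ} {x : K} :
    x ∈ v.V n ↔ ((n : ℤ) : WithTop ℤ) ≤ v.ord x := by
  by_cases hx : x = 0
  · simp [mem_V, hx, v.ord_zero]
  · rw [mem_V_of_ne hx, v.coe_o hx]; exact_mod_cast Iff.rfl

lemma V_anti (v : FFPrime K) {m n : ℤ} (h : m ≤ n) : v.V n ≤ v.V m := by
  intro x hx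
  rcases hx with hx | hx
  · exact Or.inl hx
  · exact Or.inr (h.trans hx)

lemma mul_mem_V {v : FFPrime K} {m n : ℤ} {x y : K} (hx : x ∈ v.V m) (hy : y ∈ v.V n) :
    x * y ∈ v.V (m + n) := by
  by_cases hx0 : x = 0
  · simp [hx0, zero_mem]
  by_cases hy0 : y = 0
  · simp [hy0, zero_mem]
  rw [mem_V_of_ne hx0] at hx
  rw [mem_V_of_ne hy0] at hy
  rw [mem_V_of_ne (mul_ne_zero hx0 hy0), v.o_mul hx0 hy0]
  omega

lemma one_mem_V (v : FFPrime K) : (1 : K) ∈ v.V 0 := by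
  rw [mem_V_of_ne one_ne_zero]; simp

lemma pow_mem_V {v : FFPrime K} {x : K} (hx : x ∈ v.V 0) (n : ℕ) : x ^ n ∈ v.V 0 := by
  induction n with
  | zero => simpa using v.one_mem_V
  | succ n ih => rw [pow_succ]; simpa using mul_mem_V ih hx

lemma o_add_of_lt (v : FFPrime K) {x y : K} (hx : x ≠ 0) (hy : y ≠ 0) (h : v.o x < v.o y) :
    x + y ≠ 0 ∧ v.o (x + y) = v.o x := by
  have hxy : x + y ≠ 0 := by
    intro h0
    have : x = -y := eq_neg_of_add_eq_zero_left h0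
    rw [this, o_neg] at h
    exact lt_irrefl _ h
  refine ⟨hxy, le_antisymm ?_ ?_⟩
  · have h2 := v.o_add hxy (neg_ne_zero.mpr hy) (by simpa using hx)
    rw [o_neg] at h2
    simp only [add_neg_cancel_right] at h2
    rcases min_le_iff.mp h2 with h3 | h3
    · exact h3
    · omega
  · have := v.o_add hx hy hxy
    rwa [min_eq_left h.le] at this

lemma o_add_of_ne (v : FFPrime K) {x y : K} (hx : x ≠ 0) (hy : y ≠ 0) (h : v.o x ≠ v.o y) :
    x + y ≠ 0 ∧ v.o (x + y) = min (v.o x) (v.o y) := by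
  rcases lt_or_gt_of_ne h with h | h
  · rw [min_eq_left h.le]; exact v.o_add_of_lt hx hy h
  · rw [min_eq_right h.le, add_comm]; exact v.o_add_of_lt hy hx h

/-- Norm (residue cardinality) of a place; `0` if infinite. -/
def nrm (v : FFPrime K) : ℕ := (v.V 1).relIndex (v.V 0)

lemma map_mulLeft_V (v : FFPrime K) {x : K} (hx : x ≠ 0) (n : ℤ) :
    (v.V n).map (AddMonoidHom.mulLeft x) = v.V (n + v.o x) := by
  ext y
  constructor
  · rintro ⟨z, hz, rfl⟩
    rw [add_comm]
    exact mul_mem_V (Or.inr le_rfl) hz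
  · intro hy
    refine ⟨x⁻¹ * y, ?_, by simp [hx]⟩
    have := mul_mem_V (v := v) (m := -v.o x) (x := x⁻¹) (Or.inr (by rw [o_inv])) hy
    simpa using this

lemma relIndex_V (v : FFPrime K) (n : ℤ) : (v.V (n + 1)).relIndex (v.V n) = v.nrm := by
  obtain ⟨x, hx, hn⟩ := v.o_surj n
  have h1 := v.map_mulLeft_V hx 1
  have h0 := v.map_mulLeft_V hx 0
  rw [hn, zero_add] at h0
  rw [hn, add_comm] at h1
  rw [← h1, ← h0, AddSubgroup.relIndex_map_map_of_injective]
  · rfl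
  · intro a b hab
    exact mul_left_cancel₀ hx hab

lemma exists_lt_of_ne {v w : FFPrime K} (h : v ≠ w) : ∃ x : K, x ≠ 0 ∧ 0 ≤ v.o x ∧ w.o x < 0 := by
  by_contra hcon
  push Not at hcon
  apply h
  obtain ⟨π, hπ, hπ1⟩ := v.o_surj 1
  have hz : ∀ x : K, x ≠ 0 → v.o x = 0 → w.o x = 0 := by
    intro x hx hx0
    have h1 := hcon x hx (by omega)
    have h2 := hcon x⁻¹ (inv_ne_zero hx) (by rw [o_inv]; omega)
    rw [o_inv] at h2
    omega
  have key : ∀ x : K, x ≠ 0 → w.o x = w.o π * v.o x := by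
    intro x hx
    have hzp : ∀ (u : FFPrime K) (n : ℤ), u.o (π ^ n) = n * u.o π := by
      intro u n
      cases n with
      | ofNat n => simp [o_pow]
      | negSucc n => rw [zpow_negSucc, o_inv, o_pow, Int.negSucc_eq]; push_cast; ring
    have h1 := hz (x / π ^ (v.o x)) (div_ne_zero hx (zpow_ne_zero _ hπ)) (by
      rw [v.o_div hx (zpow_ne_zero _ hπ), hzp, hπ1]; ring)
    rw [w.o_div hx (zpow_ne_zero _ hπ), hzp] at h1
    linarith
  have hpi : w.o π = 1 := by
    obtain ⟨y, hy, hy1⟩ := w.o_surj 1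
    have h1 := key y hy
    rw [hy1] at h1
    have h2 := hcon π hπ (by omega)
    exact Int.eq_one_of_mul_eq_one_right h2 h1.symm
  exact ext_o fun x hx => by rw [key x hx, hpi, one_mul]

lemma approx_two {v w : FFPrime K} (h : v ≠ w) : ∃ u : K, u ≠ 0 ∧ 0 < v.o u ∧ w.o u < 0 := by
  obtain ⟨x, hx, h1, h2⟩ := exists_lt_of_ne h
  obtain ⟨y, hy, h3, h4⟩ := exists_lt_of_ne h.symm
  refine ⟨x / y, div_ne_zero hx hy, ?_, ?_⟩
  · rw [v.o_div hx hy]; omega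
  · rw [w.o_div hx hy]; omega

open Classical in
lemma approx_u (v : FFPrime K) (T : Finset (FFPrime K)) (hv : v ∉ T) :
    ∃ u : K, u ≠ 0 ∧ 0 < v.o u ∧ ∀ w ∈ T, w.o u < 0 := by
  induction T using Finset.induction_on with
  | empty =>
    obtain ⟨x, hx, h⟩ := v.o_surj 1
    exact ⟨x, hx, by omega, by simp⟩
  | insert w T hw ih =>
    rw [Finset.mem_insert, not_or] at hv
    obtain ⟨u, hu, huv, hT⟩ := ih hv.2
    obtain ⟨z, hz, hzv, hzw⟩ := approx_two hv.1
    set s : ℕ := 1 + ∑ i ∈ insert w T, (i.o u).natAbs with hs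
    have hsb : ∀ i ∈ insert w T, (i.o u).natAbs < s := by
      intro i hi
      have := Finset.single_le_sum (f := fun i : FFPrime K => (i.o u).natAbs)
        (fun _ _ => Nat.zero_le _) hi
      omega
    have hs0 : (0 : ℤ) < s := by rw [hs]; positivity
    have hzs : z ^ s ≠ 0 := pow_ne_zero _ hz
    have hneq : ∀ i ∈ insert w T, (i.o u < 0 ∨ i.o z < 0) →
        u + z ^ s ≠ 0 ∧ i.o (u + z ^ s) < 0 := by
      intro i hi hneg
      have hne : i.o u ≠ i.o (z ^ s) := by
        rw [o_pow]
        intro heq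
        by_cases hz0 : i.o z = 0
        · rw [hz0] at heq hneg; simp at heq; omega
        · have h1 : (i.o u).natAbs = s * (i.o z).natAbs := by
            rw [heq, Int.natAbs_mul]; simp
          have h2 : 1 ≤ (i.o z).natAbs := by omega
          have h3 := hsb i hi
          nlinarith
      obtain ⟨h1, h2⟩ := i.o_add_of_ne hu hzs hne
      refine ⟨h1, ?_⟩
      rw [h2, o_pow]
      rcases hneg with h | h
      · exact min_lt_of_left_lt h
      · exact min_lt_of_right_lt (mul_neg_of_pos_of_neg hs0 h)
    have hw' := hneq w (Finset.mem_insert_self _ _) (Or.inr hzw)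
    refine ⟨u + z ^ s, hw'.1, ?_, ?_⟩
    · have h1 := v.o_add hu hzs hw'.1
      rw [o_pow] at h1
      have h2 : 0 < (s : ℤ) * v.o z := mul_pos hs0 hzv
      exact lt_of_lt_of_le (lt_min huv h2) h1
    · intro i hi
      rcases Finset.mem_insert.mp hi with rfl | hi'
      · exact hw'.2
      · exact (hneq i hi (Or.inl (hT i hi'))).2

lemma approx_e (v : FFPrime K) (T : Finset (FFPrime K)) (hv : v ∉ T) (r : ℕ) :
    ∃ e : K, e - 1 ∈ v.V r ∧ ∀ w ∈ T, e ∈ w.V r := by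
  obtain ⟨u, hu, huv, hT⟩ := approx_u v T hv
  have hu' : u ^ (r + 1) ≠ 0 := pow_ne_zero _ hu
  have hv1 : v.o (1 : K) < v.o (u ^ (r + 1)) := by
    rw [o_one, o_pow]; positivity
  obtain ⟨h1, h2⟩ := v.o_add_of_lt one_ne_zero hu' hv1
  refine ⟨(1 + u ^ (r + 1))⁻¹, ?_, ?_⟩
  · have : (1 + u ^ (r + 1))⁻¹ - 1 = -(u ^ (r + 1) / (1 + u ^ (r + 1))) := by
      field_simp; ring
    rw [this, mem_V_of_ne (neg_ne_zero.mpr (div_ne_zero hu' h1)), o_neg, v.o_div hu' h1, h2,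
      o_one, o_pow]
    push_cast
    nlinarith
  · intro w hw
    have hlt : w.o (u ^ (r + 1)) < w.o (1 : K) := by
      rw [o_one, o_pow]
      exact mul_neg_of_pos_of_neg (by positivity) (hT w hw)
    obtain ⟨h3, h4⟩ := w.o_add_of_lt hu' one_ne_zero hlt
    rw [mem_V_of_ne (inv_ne_zero h1), o_inv, add_comm, h4, o_pow]
    have := hT w hw
    push_cast
    nlinarith

open Classical in
lemma approx (T : Finset (FFPrime K)) (x : FFPrime K → K) (r : ℤ) :
    ∃ y : K, ∀ v ∈ T, y - x v ∈ v.V r := by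
  -- a uniform bound
  obtain ⟨N, hN⟩ : ∃ N : ℕ, ∀ v ∈ T, ∀ w ∈ T, r ≤ N + v.o (x w) := by
    refine ⟨(r.natAbs + ∑ v ∈ T, ∑ w ∈ T, (v.o (x w)).natAbs), fun v hv w hw => ?_⟩
    have h1 := Finset.single_le_sum (f := fun i : FFPrime K => (v.o (x i)).natAbs)
        (fun _ _ => Nat.zero_le _) hw
    have h2 := Finset.single_le_sum (f := fun v : FFPrime K => ∑ w ∈ T, (v.o (x w)).natAbs)
        (fun _ _ => Nat.zero_le _) hv
    omega
  choose! e he1 he2 using fun (v : FFPrime K) => approx_e v (T.erase v) (by simp) N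
  have hmul : ∀ v ∈ T, ∀ w ∈ T, ∀ c ∈ v.V N, c * x w ∈ v.V r := by
    intro v hv w hw c hc
    have := mul_mem_V (y := x w) hc (Or.inr le_rfl)
    exact v.V_anti (hN v hv w hw) this
  refine ⟨∑ w ∈ T, e w * x w, fun v hv => ?_⟩
  rw [← Finset.add_sum_erase T _ hv]
  have : e v * x v + ∑ w ∈ T.erase v, e w * x w - x v
      = (e v - 1) * x v + ∑ w ∈ T.erase v, e w * x w := by ring
  rw [this]
  refine add_mem (hmul v hv v hv _ (he1 v)) (sum_mem fun w hw => ?_)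
  have hw' := Finset.mem_erase.mp hw
  exact hmul v hv w hw'.2 _ (he2 w v (Finset.mem_erase.mpr ⟨hw'.1.symm, hv⟩))

end Basic

end FFPrime


/-- `K` is a function field of one variable over `ZMod p`. -/
structure IsFF (p : ℕ) [Fact p.Prime] (K : Type) [Field K] [Algebra (ZMod p) K] : Prop where
  ex : ∃ x : K, Transcendental (ZMod p) x
  fin : ∀ x : K, Transcendental (ZMod p) x →
    FiniteDimensional (IntermediateField.adjoin (ZMod p) {x}) K

/-- Degree of `K` over `F(x)`. -/
def degOver (p : ℕ) [Fact p.Prime] {K : Type} [Field K] [Algebra (ZMod p) K] (x : K) : ℕ :=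
  Module.finrank (IntermediateField.adjoin (ZMod p) {x}) K

/-- Independence over the polynomial ring in `x`. -/
def PIndep (p : ℕ) [Fact p.Prime] {K : Type} [Field K] [Algebra (ZMod p) K] (x : K)
    {ι : Type} [Fintype ι] (u : ι → K) : Prop :=
  ∀ P : ι → (ZMod p)[X], ∑ i, aeval x (P i) * u i = 0 → ∀ i, P i = 0

namespace IsFF

section A

variable {p : ℕ} [Fact p.Prime] {K : Type} [Field K] [Algebra (ZMod p) K]

open scoped IntermediateField.algebraAdjoinAdjoin in
lemma indep_iff (x : K) {ι : Type} [Fintype ι] (u : ι → K) :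
    LinearIndependent (IntermediateField.adjoin (ZMod p) {x}) u ↔
      ∀ P : ι → (ZMod p)[X], ∑ i, aeval x (P i) * u i = 0 → ∀ i, aeval x (P i) = 0 := by
  rw [← LinearIndependent.iff_fractionRing (R := Algebra.adjoin (ZMod p) {x})
    (K := IntermediateField.adjoin (ZMod p) {x}), Fintype.linearIndependent_iff]
  constructor
  · intro h P hP i
    have := h (fun i => ⟨aeval x (P i), by
      rw [Algebra.adjoin_singleton_eq_range_aeval]; exact ⟨_, rfl⟩⟩) hP i
    exact congrArg Subtype.val this
  · intro h g hg i
    have hmem : ∀ i, ∃ P : (ZMod p)[X], aeval x P = (g i : K) := fun i => by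
      have h1 := Algebra.adjoin_singleton_eq_range_aeval (ZMod p) x
      have h2 : (g i : K) ∈ (aeval (R := ZMod p) x).range := h1 ▸ (g i).2
      exact h2
    choose P hP using hmem
    have := h P (by simp only [hP]; exact hg) i
    rw [hP] at this
    exact Subtype.ext this

lemma PIndep_iff {x : K} (hx : Transcendental (ZMod p) x) {ι : Type} [Fintype ι] (u : ι → K) :
    PIndep p x u ↔ LinearIndependent (IntermediateField.adjoin (ZMod p) {x}) u := by
  rw [indep_iff]
  have hinj : ∀ P : (ZMod p)[X], aeval x P = 0 ↔ P = 0 := fun P =>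
    ⟨fun h => (transcendental_iff.mp hx) P h, fun h => by simp [h]⟩
  simp only [PIndep, hinj]

lemma card_le (h : IsFF p K) {x : K} (hx : Transcendental (ZMod p) x) {ι : Type} [Fintype ι]
    {u : ι → K} (hu : PIndep p x u) : Fintype.card ι ≤ degOver p x := by
  haveI := h.fin x hx
  exact ((PIndep_iff hx u).mp hu).fintype_card_le_finrank

lemma exists_basis (h : IsFF p K) {x : K} (hx : Transcendental (ZMod p) x) :
    ∃ u : Fin (degOver p x) → K, PIndep p x u := by
  haveI := h.fin x hx
  exact ⟨_, (PIndep_iff hx _).mpr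
    (Module.finBasis (IntermediateField.adjoin (ZMod p) {x}) K).linearIndependent⟩

lemma exists_rel (h : IsFF p K) {x : K} (hx : Transcendental (ZMod p) x) (y : K) :
    ∃ P : Fin (degOver p x + 1) → (ZMod p)[X],
      ∑ i, aeval x (P i) * y ^ (i : ℕ) = 0 ∧ ∃ i, P i ≠ 0 := by
  by_contra hcon
  push Not at hcon
  have := h.card_le hx (u := fun i : Fin (degOver p x + 1) => y ^ (i : ℕ)) hcon
  simp at this

lemma degOver_inv (x : K) : degOver p x⁻¹ = degOver p x := by
  have : IntermediateField.adjoin (ZMod p) {x⁻¹} = IntermediateField.adjoin (ZMod p) {x} := by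
    apply le_antisymm
    · rw [IntermediateField.adjoin_simple_le_iff]
      exact inv_mem (IntermediateField.mem_adjoin_simple_self _ x)
    · rw [IntermediateField.adjoin_simple_le_iff]
      have := inv_mem (IntermediateField.mem_adjoin_simple_self (ZMod p) x⁻¹)
      rwa [inv_inv] at this
  unfold degOver
  rw [this]

lemma degOver_pos (h : IsFF p K) {x : K} (hx : Transcendental (ZMod p) x) : 0 < degOver p x := by
  haveI := h.fin x hx
  exact Module.finrank_pos

lemma alg_pow {x : K} (hx : IsAlgebraic (ZMod p) x) (h0 : x ≠ 0) : ∃ n : ℕ, n ≠ 0 ∧ x ^ n = 1 := by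
  haveI : FiniteDimensional (ZMod p) (IntermediateField.adjoin (ZMod p) {x}) :=
    IntermediateField.adjoin.finiteDimensional hx.isIntegral
  haveI : Finite (IntermediateField.adjoin (ZMod p) {x}) := Module.finite_of_finite (ZMod p)
  let g : (IntermediateField.adjoin (ZMod p) {x})ˣ :=
    Units.mk0 ⟨x, IntermediateField.mem_adjoin_simple_self _ x⟩ (by
      intro h; exact h0 (congrArg Subtype.val h))
  refine ⟨orderOf g, (orderOf_pos g).ne', ?_⟩
  have := pow_orderOf_eq_one g
  have h2 := congrArg (fun z : (IntermediateField.adjoin (ZMod p) {x})ˣ => ((z : IntermediateField.adjoin (ZMod p) {x}) : K)) this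
  simp only [Units.val_pow_eq_pow_val, IntermediateField.coe_pow] at h2
  exact h2

lemma o_alg (v : FFPrime K) {x : K} (hx : IsAlgebraic (ZMod p) x) : v.o x = 0 := by
  by_cases h0 : x = 0
  · simp [h0]
  obtain ⟨n, hn, h⟩ := alg_pow hx h0
  exact v.o_eq_zero_of_pow_eq_one hn h

lemma transc_of_o (v : FFPrime K) {x : K} (hx : v.o x ≠ 0) : Transcendental (ZMod p) x :=
  fun h => hx (o_alg v h)

lemma transc_inv {x : K} (hx : Transcendental (ZMod p) x) : Transcendental (ZMod p) x⁻¹ := by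
  intro h
  apply hx
  have := h.inv
  rwa [inv_inv] at this

end A

end IsFF


namespace IsFF

section Places

variable {p : ℕ} [Fact p.Prime] {K : Type} [Field K] [Algebra (ZMod p) K]

lemma exists_valuationSubring {x : K} (hx : Transcendental (ZMod p) x) :
    ∃ B : ValuationSubring K, (∀ P : (ZMod p)[X], aeval x P ∈ B) ∧ x ∈ B.nonunits := by
  set A : Subring K := (aeval (R := ZMod p) x).range.toSubring with hA
  let x' : A := ⟨x, ⟨X, by simp⟩⟩
  have hI : Ideal.span {x'} ≠ ⊤ := by
    intro h
    have h1 := (Ideal.eq_top_iff_one _).mp h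
    obtain ⟨y, hy⟩ := Ideal.mem_span_singleton'.mp h1
    obtain ⟨P, hP⟩ := y.2
    have h2 : (y : K) * x = 1 := congrArg Subtype.val hy
    have hP' : aeval x P = (y : K) := hP
    have h3 : aeval x (P * X - 1) = 0 := by simp [hP', h2]
    have h4 := (transcendental_iff.mp hx) _ h3
    have h5 := congrArg (Polynomial.eval 0) h4
    simp at h5
  obtain ⟨B, hB, hIB⟩ := Ideal.image_subset_nonunits_valuationSubring _ hI
  refine ⟨B, fun P => hB ⟨P, rfl⟩, hIB ⟨x', Ideal.mem_span_singleton_self _, rfl⟩⟩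

lemma val_aeval (B : ValuationSubring K) {x : K} (hB : ∀ P : (ZMod p)[X], aeval x P ∈ B)
    (hx : x ∈ B.nonunits) {P : (ZMod p)[X]} (hP : P ≠ 0) :
    ∃ k : ℕ, B.valuation (aeval x P) = B.valuation x ^ k := by
  have hc : ∀ c : ZMod p, c ≠ 0 → B.valuation (algebraMap (ZMod p) K c) = 1 := by
    intro c hc
    have h1 := (B.valuation_le_one_iff _).mpr (hB (C c))
    have h2 := (B.valuation_le_one_iff _).mpr (hB (C c⁻¹))
    simp only [aeval_C, map_inv₀] at h1 h2
    have h3 : B.valuation (algebraMap (ZMod p) K c) ≠ 0 := by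
      simpa using hc
    refine le_antisymm h1 ?_
    exact (inv_le_one₀ (zero_lt_iff.mpr h3)).mp h2
  obtain ⟨k, Q, hQ, hQ0⟩ : ∃ (k : ℕ) (Q : (ZMod p)[X]), P = X ^ k * Q ∧ Q.coeff 0 ≠ 0 := by
    obtain ⟨Q, hQ, hnd⟩ := P.exists_eq_pow_rootMultiplicity_mul_and_not_dvd hP 0
    refine ⟨_, Q, by simpa using hQ, ?_⟩
    intro h
    apply hnd
    simpa [X_dvd_iff] using h
  refine ⟨k, ?_⟩
  rw [hQ]
  simp only [map_mul, map_pow, aeval_X]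
  have hlt : B.valuation x < 1 := hx
  have : B.valuation (aeval x Q) = 1 := by
    rw [← Q.divX_mul_X_add]
    simp only [map_add, map_mul, aeval_X, aeval_C]
    rw [Valuation.map_add_eq_of_lt_right]
    · exact hc _ hQ0
    · rw [hc _ hQ0, map_mul]
      have h1 := (B.valuation_le_one_iff _).mpr (hB Q.divX)
      exact lt_of_le_of_lt (mul_le_of_le_one_left' h1) hlt
  rw [this, mul_one]

lemma val_rel (h : IsFF p K) (B : ValuationSubring K) {x : K} (hx : Transcendental (ZMod p) x)
    (hB : ∀ P : (ZMod p)[X], aeval x P ∈ B) (hxB : x ∈ B.nonunits) {y : K} (hy : y ≠ 0) :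
    ∃ m : ℤ, B.valuation y ^ ((degOver p x).factorial : ℤ) = B.valuation x ^ m := by
  have hx0 : x ≠ 0 := by
    rintro rfl; exact hx isAlgebraic_zero
  have hvx : B.valuation x ≠ 0 := by simpa using hx0
  have hvy : B.valuation y ≠ 0 := by simpa using hy
  obtain ⟨P, hP, hne⟩ := h.exists_rel hx y
  obtain ⟨i, j, hij, hi, hj, heq⟩ : ∃ i j : Fin (degOver p x + 1), i < j ∧ P i ≠ 0 ∧ P j ≠ 0 ∧
      B.valuation (aeval x (P i) * y ^ (i : ℕ)) = B.valuation (aeval x (P j) * y ^ (j : ℕ)) := by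
    by_contra hcon
    push Not at hcon
    set S : Finset (Fin (degOver p x + 1)) := Finset.univ.filter fun i => P i ≠ 0 with hS
    have hSne : S.Nonempty := by
      obtain ⟨i, hi⟩ := hne
      exact ⟨i, by simp [hS, hi]⟩
    obtain ⟨i0, hi0, hmax⟩ := S.exists_max_image
      (fun i => B.valuation (aeval x (P i) * y ^ (i : ℕ))) hSne
    have hi0' : P i0 ≠ 0 := by simpa [hS] using hi0
    have hsum : ∑ i ∈ S, aeval x (P i) * y ^ (i : ℕ) = 0 := by
      rw [← hP]
      apply Finset.sum_subset (Finset.subset_univ _)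
      intro i _ hi
      have : P i = 0 := by simpa [hS] using hi
      simp [this]
    rw [← Finset.add_sum_erase S _ hi0] at hsum
    have hpos : B.valuation (aeval x (P i0) * y ^ (i0 : ℕ)) ≠ 0 := by
      rw [map_mul, map_pow]
      obtain ⟨k, hk⟩ := val_aeval B hB hxB hi0'
      rw [hk]
      exact mul_ne_zero (pow_ne_zero _ hvx) (pow_ne_zero _ hvy)
    have hlt : B.valuation (∑ i ∈ S.erase i0, aeval x (P i) * y ^ (i : ℕ))
        < B.valuation (aeval x (P i0) * y ^ (i0 : ℕ)) := by
      apply Valuation.map_sum_lt _ hpos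
      intro i hi
      have hi' := Finset.mem_erase.mp hi
      have hPi : P i ≠ 0 := by simpa [hS] using hi'.2
      refine lt_of_le_of_ne (hmax i hi'.2) ?_
      intro heq
      rcases lt_or_gt_of_ne hi'.1 with hl | hl
      · exact hcon i i0 hl hPi hi0' heq
      · exact hcon i0 i hl hi0' hPi heq.symm
    have h2 := Valuation.map_add_eq_of_lt_left (v := B.valuation) hlt
    rw [hsum, map_zero] at h2
    rw [add_comm] at hsum
    have h3 := Valuation.map_add_eq_of_lt_left (v := B.valuation) hlt
    exact hpos (by first | exact h2.symm | (rw [hsum, map_zero] at h3; exact h3.symm))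
  obtain ⟨k, hk⟩ := val_aeval B hB hxB hi
  obtain ⟨l, hl⟩ := val_aeval B hB hxB hj
  rw [map_mul, map_mul, map_pow, map_pow, hk, hl] at heq
  have hd : ((j : ℕ) - (i : ℕ)) ∣ (degOver p x).factorial := by
    apply Nat.dvd_factorial
    · have : (i : ℕ) < j := hij
      omega
    · have := j.2
      omega
  obtain ⟨c, hc⟩ := hd
  refine ⟨((k : ℤ) - l) * c, ?_⟩
  have hyy : B.valuation y ^ ((j : ℤ) - (i : ℤ)) = B.valuation x ^ ((k : ℤ) - l) := by
    rw [zpow_sub₀ hvy, zpow_sub₀ hvx, div_eq_div_iff (zpow_ne_zero _ hvy) (zpow_ne_zero _ hvx)]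
    simp only [zpow_natCast]
    rw [mul_comm, ← heq, mul_comm]
  rw [hc, zpow_mul, ← hyy, ← zpow_mul]
  congr 1
  have : (i : ℕ) < j := hij
  push_cast [Nat.cast_sub this.le]
  rfl

theorem exists_place (h : IsFF p K) {x : K} (hx : Transcendental (ZMod p) x) :
    ∃ v : FFPrime K, 0 < v.o x := by
  obtain ⟨B, hB, hxB⟩ := exists_valuationSubring hx
  have hx0 : x ≠ 0 := by
    rintro rfl; exact hx isAlgebraic_zero
  have hvx : 0 < B.valuation x := by simpa [zero_lt_iff] using hx0
  have hlt : B.valuation x < 1 := hxB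
  have hanti := zpow_right_strictAnti₀ hvx hlt
  set E : ℕ := (degOver p x).factorial with hE
  have hE0 : 0 < E := Nat.factorial_pos _
  choose! φ hφ using fun (y : K) (hy : y ≠ 0) => h.val_rel B hx hB hxB hy
  have hmul : ∀ y z : K, y ≠ 0 → z ≠ 0 → φ (y * z) = φ y + φ z := by
    intro y z hy hz
    apply hanti.injective
    show B.valuation x ^ _ = B.valuation x ^ _
    rw [← hφ _ (mul_ne_zero hy hz), map_mul, mul_zpow, hφ y hy, hφ z hz, zpow_add₀ hvx.ne']
  have hadd : ∀ y z : K, y ≠ 0 → z ≠ 0 → y + z ≠ 0 → min (φ y) (φ z) ≤ φ (y + z) := by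
    intro y z hy hz hyz
    by_contra hcon
    push Not at hcon
    have h1 := hφ _ hyz
    have h2 := hanti (lt_min_iff.mp hcon).1
    have h3 := hanti (lt_min_iff.mp hcon).2
    simp only at h2 h3
    rw [← hφ y hy, ← hφ _ hyz] at h2
    rw [← hφ z hz, ← hφ _ hyz] at h3
    rw [zpow_natCast, zpow_natCast] at h2 h3
    have h4 := lt_of_pow_lt_pow_left₀ _ zero_le h2
    have h5 := lt_of_pow_lt_pow_left₀ _ zero_le h3
    exact absurd (B.valuation.map_add y z) (not_le.mpr (max_lt h4 h5))
  have hφx : φ x = E := by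
    apply hanti.injective
    show B.valuation x ^ _ = B.valuation x ^ _
    rw [← hφ x hx0]
  let Φ : Additive Kˣ →+ ℤ :=
    AddMonoidHom.mk' (fun y => φ ((Additive.toMul y : Kˣ) : K))
      (fun a b => by simpa using hmul _ _ (Units.ne_zero _) (Units.ne_zero _))
  obtain ⟨d, hd⟩ := Int.subgroup_cyclic Φ.range
  have hmem : ∀ y : K, y ≠ 0 → d ∣ φ y := by
    intro y hy
    have : φ y ∈ Φ.range := ⟨Additive.ofMul (Units.mk0 y hy), rfl⟩
    rw [hd, AddSubgroup.mem_closure_singleton] at this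
    obtain ⟨n, hn⟩ := this
    exact ⟨n, by rw [← hn]; simp [mul_comm]⟩
  have hd0 : d ≠ 0 := by
    intro h0
    have := hmem x hx0
    rw [h0, zero_dvd_iff, hφx] at this
    omega
  obtain ⟨y0, hy0⟩ : |d| ∈ Φ.range := by
    rw [hd, AddSubgroup.mem_closure_singleton]
    rcases abs_choice d with h | h
    · exact ⟨1, by simp [h]⟩
    · exact ⟨-1, by simp [h]⟩
  have hdp : 0 < |d| := abs_pos.mpr hd0
  have hmem' : ∀ y : K, y ≠ 0 → φ y = |d| * (φ y / |d|) := fun y hy =>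
    (Int.mul_ediv_cancel' ((abs_dvd _ _).mpr (hmem y hy))).symm
  refine ⟨FFPrime.ofO (fun y => φ y / |d|) ?_ ?_ ?_, ?_⟩
  · intro y z hy hz
    apply mul_left_cancel₀ hdp.ne'
    rw [mul_add, ← hmem' _ (mul_ne_zero hy hz), ← hmem' _ hy, ← hmem' _ hz, hmul y z hy hz]
  · intro y z hy hz hyz
    rcases min_le_iff.mp (hadd y z hy hz hyz) with h1 | h1
    · exact min_le_iff.mpr (Or.inl (Int.ediv_le_ediv hdp h1))
    · exact min_le_iff.mpr (Or.inr (Int.ediv_le_ediv hdp h1))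
  · intro n
    have hy0' : φ ((Additive.toMul y0 : Kˣ) : K) = |d| := hy0
    refine ⟨((Additive.toMul (n • y0) : Kˣ) : K), Units.ne_zero _, ?_⟩
    have h1 : Φ (n • y0) = n * |d| := by rw [map_zsmul, hy0]; simp
    have h2 : φ ((Additive.toMul (n • y0) : Kˣ) : K) = n * |d| := h1
    rw [h2, Int.mul_ediv_cancel _ hdp.ne']
  · rw [FFPrime.ofO_o _ _ _ _ hx0]
    have h1 := hmem' x hx0
    by_contra hcon
    push Not at hcon
    have h2 : φ x ≤ 0 := by
      rw [h1]; exact mul_nonpos_of_nonneg_of_nonpos hdp.le hcon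
    omega

end Places

end IsFF


namespace IsFF

section Idx

variable {p : ℕ} [Fact p.Prime] {K : Type} [AddCommGroup K] [Module (ZMod p) K]

lemma relIndex_eq_card (A B : AddSubgroup K) :
    A.relIndex B = Nat.card ((AddSubgroup.toZModSubmodule p B) ⧸
      (AddSubgroup.toZModSubmodule p A).comap (AddSubgroup.toZModSubmodule p B).subtype) := rfl

lemma relIndex_eq_pow (A B : AddSubgroup K) (h : A.relIndex B ≠ 0) :
    ∃ k : ℕ, A.relIndex B = p ^ k := by
  rw [relIndex_eq_card (p := p)] at h ⊢
  have := Nat.finite_of_card_ne_zero h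
  exact ⟨_, by rw [Module.natCard_eq_pow_finrank (K := ZMod p), Nat.card_zmod]⟩

lemma relIndex_le (A B : AddSubgroup K) (n : ℕ)
    (h : ∀ b : Fin (n + 1) → K, (∀ i, b i ∈ B) →
      ∃ c : Fin (n + 1) → ZMod p, c ≠ 0 ∧ ∑ i, c i • b i ∈ A) :
    A.relIndex B ≠ 0 ∧ A.relIndex B ≤ p ^ n := by
  set A' := AddSubgroup.toZModSubmodule p A
  set B' := AddSubgroup.toZModSubmodule p B
  set Q := B' ⧸ A'.comap B'.subtype with hQ
  have hr : Module.rank (ZMod p) Q ≤ n := by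
    apply rank_le
    intro s hs
    by_contra hcon
    push Not at hcon
    obtain ⟨t, hts, htc⟩ := Finset.exists_subset_card_eq hcon
    have e : Fin (n + 1) ≃ t := (Finset.equivFinOfCardEq htc).symm
    have ht : LinearIndependent (ZMod p) (fun i : Fin (n + 1) => ((e i : t) : Q)) := by
      have h1 : LinearIndependent (ZMod p) (fun i : t => (i : Q)) :=
        hs.comp (fun i : t => (⟨i, hts i.2⟩ : s)) (fun a b hab => by
          have := congrArg Subtype.val hab
          exact Subtype.ext this)
      exact h1.comp e e.injective
    choose b hb using fun i => Submodule.Quotient.mk_surjective (A'.comap B'.subtype) ((e i : t) : Q)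
    obtain ⟨c, hc0, hc⟩ := h (fun i => (b i : K)) (fun i => (b i).2)
    apply hc0
    funext i
    rw [Fintype.linearIndependent_iff] at ht
    refine ht c ?_ i
    have : ∑ i, c i • ((e i : t) : Q) = Submodule.Quotient.mk (p := A'.comap B'.subtype)
        (∑ i, c i • b i) := by
      simp only [← hb]
      rw [← Submodule.mkQ_apply, map_sum]
      simp
    rw [this, Submodule.Quotient.mk_eq_zero]
    show ((∑ i, c i • b i : B') : K) ∈ A
    simpa using hc
  have hf : Module.Finite (ZMod p) Q :=
    Module.finite_of_rank_eq_nat (n := (Module.finrank (ZMod p) Q)) (by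
      rw [Module.finrank, Cardinal.cast_toNat_of_lt_aleph0 (lt_of_le_of_lt hr (Cardinal.natCast_lt_aleph0))])
  have : Finite Q := Module.finite_of_finite (ZMod p)
  have hc : A.relIndex B = p ^ Module.finrank (ZMod p) Q := by
    rw [relIndex_eq_card (p := p)]
    rw [Module.natCard_eq_pow_finrank (K := ZMod p), Nat.card_zmod]
  have hle : Module.finrank (ZMod p) Q ≤ n := Module.finrank_le_of_rank_le hr
  have hp : 1 < p := (Fact.out : p.Prime).one_lt
  rw [hc]
  exact ⟨pow_ne_zero _ (by omega), Nat.pow_le_pow_right (by omega) hle⟩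

end Idx

section Zeros

variable {p : ℕ} [Fact p.Prime] {K : Type} [Field K] [Algebra (ZMod p) K]

/-- Elements with prescribed orders at `T`. -/
def Lam (T : Finset (FFPrime K)) (D : FFPrime K → ℤ) : AddSubgroup K := ⨅ v ∈ T, v.V (D v)

lemma mem_Lam {T : Finset (FFPrime K)} {D : FFPrime K → ℤ} {x : K} :
    x ∈ Lam T D ↔ ∀ v ∈ T, x ∈ v.V (D v) := by
  simp [Lam, AddSubgroup.mem_iInf]

open Classical in
lemma Lam_step (T : Finset (FFPrime K)) (D : FFPrime K → ℤ) {v : FFPrime K} (hv : v ∈ T) :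
    (Lam T (D + Pi.single v 1)).relIndex (Lam T D) = v.nrm := by
  have h1 : Lam T (D + Pi.single v 1) = v.V (D v + 1) ⊓ Lam T D := by
    ext x
    rw [AddSubgroup.mem_inf, mem_Lam, mem_Lam]
    constructor
    · intro h
      refine ⟨by simpa using h v hv, fun w hw => ?_⟩
      refine w.V_anti ?_ (h w hw)
      rw [Pi.add_apply]
      by_cases hwv : w = v
      · subst hwv; simp
      · simp [hwv]
    · rintro ⟨h, h'⟩ w hw
      by_cases hwv : w = v
      · subst hwv; simpa using h
      · simpa [hwv] using h' w hw
  have h2 : Lam T D ⊔ v.V (D v + 1) = v.V (D v) := by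
    apply le_antisymm
    · apply sup_le
      · intro x hx; exact mem_Lam.mp hx v hv
      · exact v.V_anti (by omega)
    · intro x hx
      obtain ⟨r, hr⟩ : ∃ r : ℤ, ∀ w ∈ T, D w + 1 ≤ r := by
        refine ⟨∑ w ∈ T, |D w| + 1, fun w hw => ?_⟩
        have := Finset.single_le_sum (f := fun w => |D w|) (fun _ _ => abs_nonneg _) hw
        have h3 := le_abs_self (D w)
        omega
      obtain ⟨y, hy⟩ := FFPrime.approx T (fun w => if w = v then x else 0) r
      have hyv : y - x ∈ v.V (D v + 1) := v.V_anti (hr v hv) (by simpa using hy v hv)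
      rw [AddSubgroup.mem_sup]
      refine ⟨y, ?_, x - y, ?_, by abel⟩
      · rw [mem_Lam]
        intro w hw
        by_cases hwv : w = v
        · subst hwv
          have := add_mem (w.V_anti (by omega) hyv) hx
          simpa using this
        · have := hy w hw
          simp only [hwv, if_false, sub_zero] at this
          exact w.V_anti (by have := hr w hw; omega) this
      · rw [← neg_sub]; exact neg_mem hyv
  rw [h1, AddSubgroup.inf_relIndex_right, ← AddSubgroup.relIndex_sup_right, h2]
  exact v.relIndex_V _

open Classical in
lemma Lam_index (T : Finset (FFPrime K)) (D : FFPrime K → ℕ) (hD : ∀ v ∉ T, D v = 0) :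
    (Lam T (fun v => (D v : ℤ))).relIndex (Lam T 0) = ∏ v ∈ T, v.nrm ^ D v := by
  induction hn : ∑ v ∈ T, D v generalizing D with
  | zero =>
    have h0 : ∀ v ∈ T, D v = 0 := by simpa using hn
    have : (fun v => (D v : ℤ)) = 0 := by
      funext v
      by_cases hv : v ∈ T
      · simp [h0 v hv]
      · simp [hD v hv]
    rw [this, AddSubgroup.relIndex_self, Finset.prod_eq_one]
    intro v hv
    rw [h0 v hv, pow_zero]
  | succ n ih =>
    obtain ⟨v, hv, hv0⟩ : ∃ v ∈ T, D v ≠ 0 := by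
      by_contra hcon
      push Not at hcon
      rw [Finset.sum_eq_zero hcon] at hn
      omega
    set D' : FFPrime K → ℕ := Function.update D v (D v - 1) with hD'
    have hDD : (fun w => (D w : ℤ)) = (fun w => (D' w : ℤ)) + Pi.single v 1 := by
      funext w
      by_cases hw : w = v
      · subst hw
        simp only [hD', Function.update_self, Pi.add_apply, Pi.single_eq_same]
        omega
      · simp [hD', hw]
    have hs : ∑ w ∈ T, D' w = n := by
      rw [← Finset.add_sum_erase T _ hv] at hn ⊢
      have : ∑ w ∈ T.erase v, D' w = ∑ w ∈ T.erase v, D w :=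
        Finset.sum_congr rfl fun w hw => by simp [hD', (Finset.mem_erase.mp hw).1]
      rw [this]
      simp only [hD', Function.update_self]
      omega
    have h1 := ih D' (fun w hw => by
      have : w ≠ v := fun h => hw (h ▸ hv)
      simp [hD', this, hD w hw]) hs
    have h2 := Lam_step T (fun w => (D' w : ℤ)) hv
    rw [← hDD] at h2
    rw [← AddSubgroup.relIndex_mul_relIndex (Lam T fun w => (D w : ℤ)) (Lam T fun w => (D' w : ℤ))
      (Lam T 0), h1, h2]
    · rw [← Finset.mul_prod_erase T _ hv, ← Finset.mul_prod_erase T _ hv]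
      have : ∏ w ∈ T.erase v, w.nrm ^ D' w = ∏ w ∈ T.erase v, w.nrm ^ D w :=
        Finset.prod_congr rfl fun w hw => by simp [hD', (Finset.mem_erase.mp hw).1]
      rw [this, ← mul_assoc, ← pow_succ']
      congr 2
      simp only [hD', Function.update_self]
      omega
    · intro x hx
      rw [mem_Lam] at hx ⊢
      intro w hw
      refine w.V_anti ?_ (hx w hw)
      have := congrFun hDD w
      rw [this, Pi.add_apply]
      have h0 : (0 : ℤ) ≤ (Pi.single v 1 : FFPrime K → ℤ) w := by
        by_cases hw : w = v
        · subst hw; simp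
        · simp [hw]
      omega
    · intro x hx
      rw [mem_Lam] at hx ⊢
      intro w hw
      refine w.V_anti ?_ (hx w hw)
      simp

lemma aeval_mem_V {v : FFPrime K} {x : K} (hx : x ∈ v.V 0) (Q : (ZMod p)[X]) :
    aeval x Q ∈ v.V 0 := by
  rw [aeval_eq_sum_range]
  exact sum_mem fun i _ => ZMod.smul_mem (FFPrime.pow_mem_V hx i) _

lemma rel_normalize {x : K} (hx0 : x ≠ 0) {n : ℕ} (b : Fin n → K) (N : ℕ) :
    ∀ P : Fin n → (ZMod p)[X], ∑ i, aeval x (P i) * b i = 0 →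
      (∃ i, P i ≠ 0 ∧ (P i).natDegree ≤ N) →
      ∃ P' : Fin n → (ZMod p)[X], ∑ i, aeval x (P' i) * b i = 0 ∧ ∃ i, (P' i).coeff 0 ≠ 0 := by
  induction N with
  | zero =>
    rintro P hP ⟨i, hi, hd⟩
    refine ⟨P, hP, i, ?_⟩
    intro h0
    apply hi
    rw [Polynomial.eq_C_of_natDegree_le_zero hd, h0, C_0]
  | succ N ih =>
    rintro P hP ⟨i, hi, hd⟩
    by_cases hall : ∀ i, (P i).coeff 0 = 0
    · have hPX : ∀ i, P i = (P i).divX * X := fun i => by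
        have := (P i).divX_mul_X_add
        rw [hall i, C_0, add_zero] at this
        exact this.symm
      refine ih (fun i => (P i).divX) ?_ ⟨i, ?_, ?_⟩
      · apply mul_left_cancel₀ hx0
        rw [mul_zero, ← hP, Finset.mul_sum]
        refine Finset.sum_congr rfl fun i _ => ?_
        conv_rhs => rw [hPX i]
        simp only [map_mul, aeval_X]
        ring
      · intro h0
        apply hi
        rw [hPX i, h0, zero_mul]
      · rw [natDegree_divX_eq_natDegree_tsub_one]
        omega
    · push Not at hall
      exact ⟨P, hP, hall⟩

open Classical in
theorem zeros_bound (h : IsFF p K) {x : K} (hx : Transcendental (ZMod p) x)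
    (T : Finset (FFPrime K)) (hT : ∀ v ∈ T, 0 < v.o x) :
    (∏ v ∈ T, v.nrm ^ (v.o x).toNat) ≠ 0 ∧
      (∏ v ∈ T, v.nrm ^ (v.o x).toNat) ≤ p ^ degOver p x := by
  have hx0 : x ≠ 0 := by
    rintro rfl; exact hx isAlgebraic_zero
  set D : FFPrime K → ℕ := fun v => if v ∈ T then (v.o x).toNat else 0 with hD
  have h1 := Lam_index T D (fun v hv => by simp [hD, hv])
  have h2 : ∏ v ∈ T, v.nrm ^ D v = ∏ v ∈ T, v.nrm ^ (v.o x).toNat :=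
    Finset.prod_congr rfl fun v hv => by simp [hD, hv]
  rw [← h2, ← h1]
  apply relIndex_le (p := p)
  intro b hb
  have hrel : ∃ P : Fin (degOver p x + 1) → (ZMod p)[X],
      ∑ i, aeval x (P i) * b i = 0 ∧ ∃ i, P i ≠ 0 := by
    by_contra hcon
    push Not at hcon
    have := h.card_le hx (u := b) hcon
    simp at this
  obtain ⟨P0, hP0, i0, hi0⟩ := hrel
  obtain ⟨P, hP, i, hi⟩ := rel_normalize hx0 b _ P0 hP0 ⟨i0, hi0, le_rfl⟩
  refine ⟨fun i => (P i).coeff 0, fun h0 => hi (congrFun h0 i), ?_⟩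
  have hsum : ∑ i, (P i).coeff 0 • b i = -(∑ i, x * (aeval x (P i).divX * b i)) := by
    rw [eq_neg_iff_add_eq_zero, ← hP, ← Finset.sum_add_distrib]
    refine Finset.sum_congr rfl fun i _ => ?_
    conv_rhs => rw [← (P i).divX_mul_X_add]
    simp only [map_mul, map_add, aeval_X, aeval_C, Algebra.smul_def]
    ring
  rw [hsum]
  refine neg_mem (sum_mem fun i _ => ?_)
  rw [mem_Lam]
  intro v hv
  have hb' := mem_Lam.mp (hb i) v hv
  have hxV : x ∈ v.V (v.o x) := Or.inr le_rfl
  have hxV0 : x ∈ v.V 0 := v.V_anti (hT v hv).le hxV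
  have h3 := FFPrime.mul_mem_V hxV (FFPrime.mul_mem_V (aeval_mem_V hxV0 (P i).divX) hb')
  have h4 : ((D v : ℕ) : ℤ) = v.o x := by
    simp only [hD, hv, if_true]
    exact Int.toNat_of_nonneg (hT v hv).le
  rw [h4]
  simpa using h3

lemma nrm_ne_zero (h : IsFF p K) (v : FFPrime K) : v.nrm ≠ 0 := by
  obtain ⟨x, hx, h1⟩ := v.o_surj 1
  have := (h.zeros_bound (x := x) (transc_of_o v (by omega)) {v} (by simp [h1])).1
  simpa [h1] using this

end Zeros

end IsFF


/-- Degree of a place. -/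
def FFPrime.dg (p : ℕ) {K : Type} [Field K] (v : FFPrime K) : ℕ := Nat.log p v.nrm

/-- Divisors. -/
abbrev Dvs (K : Type) [Field K] := FFPrime K →₀ ℤ

/-- Effective divisors. -/
abbrev Eff (K : Type) [Field K] := FFPrime K →₀ ℕ

namespace Dvs

variable {K : Type} [Field K]

/-- Degree of a divisor. -/
def deg (p : ℕ) : Dvs K →+ ℤ := Finsupp.liftAddHom fun v => AddMonoidHom.mulRight (v.dg p : ℤ)

lemma deg_single (p : ℕ) (v : FFPrime K) (n : ℤ) :
    deg p (Finsupp.single v n : Dvs K) = n * v.dg p := by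
  simp [deg]

/-- Effective divisors as divisors. -/
def ofEff : Eff K →+ Dvs K := Finsupp.mapRange.addMonoidHom (Nat.castAddMonoidHom ℤ)

@[simp] lemma ofEff_apply (E : Eff K) (v : FFPrime K) : ofEff E v = (E v : ℤ) := rfl

lemma ofEff_single (v : FFPrime K) (n : ℕ) :
    ofEff (Finsupp.single v n : Eff K) = Finsupp.single v (n : ℤ) := by
  simp [ofEff]

lemma ofEff_injective : Function.Injective (ofEff : Eff K → Dvs K) := by
  intro E F h
  ext v
  have := DFunLike.congr_fun h v
  simpa using this

lemma ofEff_nonneg (E : Eff K) : 0 ≤ ofEff E := fun v => by simp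

lemma exists_ofEff {D : Dvs K} (hD : 0 ≤ D) : ∃ E : Eff K, ofEff E = D := by
  refine ⟨D.mapRange Int.toNat (by simp), ?_⟩
  ext v
  have : 0 ≤ D v := hD v
  simp [this]

lemma exists_add {D D' : Dvs K} (h : D ≤ D') : ∃ E : Eff K, D' = D + ofEff E := by
  obtain ⟨E, hE⟩ := exists_ofEff (sub_nonneg.mpr h)
  exact ⟨E, by rw [hE]; abel⟩

/-- Degree of an effective divisor. -/
def edeg (p : ℕ) : Eff K →+ ℕ := Finsupp.liftAddHom fun v => AddMonoidHom.mulRight (v.dg p)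

lemma edeg_single (p : ℕ) (v : FFPrime K) (n : ℕ) :
    edeg p (Finsupp.single v n : Eff K) = n * v.dg p := by
  simp [edeg]

lemma deg_ofEff (p : ℕ) (E : Eff K) : deg p (ofEff E) = edeg p E := by
  induction E using Finsupp.induction_linear with
  | zero => simp
  | add f g hf hg => rw [map_add, map_add, map_add, hf, hg]; push_cast; rfl
  | single v n => rw [ofEff_single, deg_single, edeg_single]; push_cast; rfl

lemma deg_mono (p : ℕ) {D D' : Dvs K} (h : D ≤ D') : deg p D ≤ deg p D' := by
  obtain ⟨E, rfl⟩ := exists_add h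
  rw [map_add, deg_ofEff]; omega

open Classical in
/-- Principal divisor. -/
def dv (x : K) : Dvs K :=
  if h : {v : FFPrime K | v.o x ≠ 0}.Finite then
    Finsupp.ofSupportFinite (fun v => v.o x) h else 0

/-- Riemann-Roch space. -/
def RR (D : Dvs K) : AddSubgroup K := ⨅ v : FFPrime K, v.V (-D v)

lemma mem_RR {D : Dvs K} {x : K} : x ∈ RR D ↔ ∀ v : FFPrime K, x ∈ v.V (-D v) := by
  simp [RR, AddSubgroup.mem_iInf]

lemma RR_mono {D D' : Dvs K} (h : D ≤ D') : RR D ≤ RR D' := by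
  intro x hx
  rw [mem_RR] at hx ⊢
  intro v
  exact v.V_anti (neg_le_neg (h v)) (hx v)

end Dvs

namespace IsFF

open Dvs

variable {p : ℕ} [Fact p.Prime] {K : Type} [Field K] [Algebra (ZMod p) K]

lemma nrm_eq (h : IsFF p K) (v : FFPrime K) : v.nrm = p ^ v.dg p := by
  obtain ⟨k, hk⟩ := relIndex_eq_pow (p := p) _ _ (h.nrm_ne_zero v)
  have hk' : v.nrm = p ^ k := hk
  have hp : 1 < p := (Fact.out : p.Prime).one_lt
  rw [FFPrime.dg, hk', Nat.log_pow hp]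

lemma dg_pos (h : IsFF p K) (v : FFPrime K) : 0 < v.dg p := by
  by_contra hcon
  have h0 : v.dg p = 0 := by omega
  have h1 := h.nrm_eq v
  rw [h0, pow_zero] at h1
  have h2 := AddSubgroup.relIndex_eq_one.mp h1
  have h3 := h2 v.one_mem_V
  rw [FFPrime.mem_V_of_ne one_ne_zero, FFPrime.o_one] at h3
  omega

lemma zeros_sum (h : IsFF p K) {x : K} (hx : Transcendental (ZMod p) x)
    (T : Finset (FFPrime K)) (hT : ∀ v ∈ T, 0 < v.o x) :
    ∑ v ∈ T, v.o x * v.dg p ≤ degOver p x := by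
  have h1 := (h.zeros_bound hx T hT).2
  have hp : 1 < p := (Fact.out : p.Prime).one_lt
  have h2 : ∏ v ∈ T, v.nrm ^ (v.o x).toNat = p ^ ∑ v ∈ T, v.dg p * (v.o x).toNat := by
    rw [← Finset.prod_pow_eq_pow_sum]
    refine Finset.prod_congr rfl fun v hv => ?_
    rw [h.nrm_eq v, pow_mul]
  rw [h2, Nat.pow_le_pow_iff_right hp] at h1
  have h3 : ∑ v ∈ T, v.o x * v.dg p = ((∑ v ∈ T, v.dg p * (v.o x).toNat : ℕ) : ℤ) := by
    push_cast
    refine Finset.sum_congr rfl fun v hv => ?_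
    rw [Int.toNat_of_nonneg (hT v hv).le, mul_comm]
  rw [h3]
  exact_mod_cast h1

lemma finite_zeros (h : IsFF p K) {x : K} (hx : Transcendental (ZMod p) x) :
    {v : FFPrime K | 0 < v.o x}.Finite := by
  by_contra hinf
  obtain ⟨T, hT, hc⟩ := Set.Infinite.exists_subset_card_eq hinf (degOver p x + 1)
  have h1 := h.zeros_sum hx T (fun v hv => hT hv)
  have h2 : ∑ v ∈ T, (1 : ℤ) ≤ ∑ v ∈ T, v.o x * v.dg p := by
    refine Finset.sum_le_sum fun v hv => ?_
    have h3 : 0 < v.o x := hT hv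
    have h4 : (0 : ℤ) < v.dg p := by exact_mod_cast h.dg_pos v
    nlinarith
  simp [hc] at h2
  omega

lemma finite_supp (h : IsFF p K) (x : K) : {v : FFPrime K | v.o x ≠ 0}.Finite := by
  by_cases hx : Transcendental (ZMod p) x
  · refine ((h.finite_zeros hx).union (h.finite_zeros (transc_inv hx))).subset ?_
    intro v hv
    have hv' : v.o x ≠ 0 := hv
    rcases lt_or_gt_of_ne hv' with h1 | h1
    · right; show 0 < v.o x⁻¹; rw [FFPrime.o_inv]; omega
    · left; exact h1
  · have hx' : IsAlgebraic (ZMod p) x := not_not.mp hx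
    convert Set.finite_empty (α := FFPrime K)
    ext v
    simp [o_alg v hx']

lemma dv_apply (h : IsFF p K) (x : K) (v : FFPrime K) : dv x v = v.o x := by
  rw [dv, dif_pos (h.finite_supp x)]; rfl

lemma dv_mul (h : IsFF p K) {x y : K} (hx : x ≠ 0) (hy : y ≠ 0) :
    dv (x * y) = dv x + dv y := by
  ext v
  rw [Finsupp.add_apply, h.dv_apply, h.dv_apply, h.dv_apply, v.o_mul hx hy]

lemma dv_inv (h : IsFF p K) (x : K) : dv x⁻¹ = - dv x := by
  ext v
  rw [Finsupp.neg_apply, h.dv_apply, h.dv_apply, v.o_inv]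

lemma dv_one (h : IsFF p K) : dv (1 : K) = 0 := by
  ext v
  rw [h.dv_apply, v.o_one]; rfl

lemma mem_RR_iff (h : IsFF p K) {D : Dvs K} {x : K} (hx : x ≠ 0) :
    x ∈ RR D ↔ 0 ≤ dv x + D := by
  rw [mem_RR]
  refine forall_congr' fun v => ?_
  rw [FFPrime.mem_V_of_ne hx, Finsupp.add_apply, h.dv_apply, Finsupp.zero_apply]
  omega

open Classical in
lemma RR_step (h : IsFF p K) (D : Dvs K) (v : FFPrime K) :
    (RR D).relIndex (RR (D + Finsupp.single v 1)) ≠ 0 ∧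
      (RR D).relIndex (RR (D + Finsupp.single v 1)) ≤ p ^ v.dg p := by
  have h1 : RR D = v.V (-D v) ⊓ RR (D + Finsupp.single v 1) := by
    apply le_antisymm
    · refine le_inf (fun x hx => mem_RR.mp hx v) (RR_mono ?_)
      have : (0 : Dvs K) ≤ Finsupp.single v 1 := by simp
      exact le_add_of_nonneg_right this
    · rintro x ⟨hx1, hx2⟩
      rw [mem_RR]
      intro w
      by_cases hw : w = v
      · subst hw; exact hx1
      · have := mem_RR.mp hx2 w
        simpa [Finsupp.single_apply, Ne.symm hw] using this
  have h2 : (RR D).relIndex (RR (D + Finsupp.single v 1))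
      = (v.V (-D v)).relIndex (RR (D + Finsupp.single v 1)) := by
    conv_lhs => rw [h1]
    exact AddSubgroup.inf_relIndex_right _ _
  have h3 : RR (D + Finsupp.single v 1) ≤ v.V (-D v - 1) := by
    intro x hx
    have := mem_RR.mp hx v
    have h4 : -(D + Finsupp.single v 1 : Dvs K) v = -D v - 1 := by simp; ring
    rwa [h4] at this
  have h4 : (v.V (-D v)).relIndex (v.V (-D v - 1)) = p ^ v.dg p := by
    have := v.relIndex_V (-D v - 1)
    rw [sub_add_cancel] at this
    rw [this, h.nrm_eq]
  have h5 : (v.V (-D v)).relIndex (v.V (-D v - 1)) ≠ 0 := by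
    rw [h4, ← h.nrm_eq]; exact h.nrm_ne_zero v
  rw [h2]
  refine ⟨fun h0 => h5 (AddSubgroup.relIndex_eq_zero_of_le_right h3 h0), ?_⟩
  rw [← h4]
  exact AddSubgroup.relIndex_le_of_le_right h3 h5

lemma RR_steps (h : IsFF p K) (E : Eff K) : ∀ D : Dvs K,
    (RR D).relIndex (RR (D + ofEff E)) ≠ 0 ∧
      (RR D).relIndex (RR (D + ofEff E)) ≤ p ^ edeg p E := by
  have trans : ∀ E F : Eff K, (∀ D : Dvs K,
    (RR D).relIndex (RR (D + ofEff E)) ≠ 0 ∧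
      (RR D).relIndex (RR (D + ofEff E)) ≤ p ^ edeg p E) →
      (∀ D : Dvs K,
    (RR D).relIndex (RR (D + ofEff F)) ≠ 0 ∧
      (RR D).relIndex (RR (D + ofEff F)) ≤ p ^ edeg p F) → (∀ D : Dvs K,
    (RR D).relIndex (RR (D + ofEff (E + F))) ≠ 0 ∧
      (RR D).relIndex (RR (D + ofEff (E + F))) ≤ p ^ edeg p (E + F)) := by
    intro E F hE hF D
    have h1 := AddSubgroup.relIndex_mul_relIndex (RR D) (RR (D + ofEff E))
      (RR (D + ofEff (E + F)))
      (RR_mono (le_add_of_nonneg_right (ofEff_nonneg E)))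
      (RR_mono (by rw [map_add, ← add_assoc]; exact (le_add_of_nonneg_right (ofEff_nonneg F))))
    have h2 := hF (D + ofEff E)
    rw [add_assoc, ← map_add] at h2
    rw [← h1, map_add (edeg p), pow_add]
    exact ⟨mul_ne_zero (hE D).1 h2.1, Nat.mul_le_mul (hE D).2 h2.2⟩
  induction E using Finsupp.induction_linear with
  | zero => intro D; simp [AddSubgroup.relIndex_self]
  | add f g hf hg => exact trans f g hf hg
  | single v n =>
    induction n with
    | zero => intro D; simp [AddSubgroup.relIndex_self]
    | succ n ih =>
      rw [Finsupp.single_add]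
      refine trans _ _ ih ?_
      intro D
      rw [ofEff_single, edeg_single, one_mul]
      exact h.RR_step D v

lemma alg_of_RR_zero (h : IsFF p K) {x : K} (hx : x ∈ RR (0 : Dvs K)) : IsAlgebraic (ZMod p) x := by
  by_contra hcon
  obtain ⟨v, hv⟩ := h.exists_place (transc_inv hcon)
  rw [FFPrime.o_inv] at hv
  have := mem_RR.mp hx v
  have hx0 : x ≠ 0 := by rintro rfl; simp at hv
  rw [FFPrime.mem_V_of_ne hx0] at this
  simp at this
  omega

lemma exists_pl (h : IsFF p K) : Nonempty (FFPrime K) := by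
  obtain ⟨x, hx⟩ := h.ex
  obtain ⟨v, -⟩ := h.exists_place hx
  exact ⟨v⟩

lemma finite_RR_zero (h : IsFF p K) : Finite (RR (0 : Dvs K)) := by
  obtain ⟨v⟩ := h.exists_pl
  have h1 : RR (0 : Dvs K) ⊓ v.V 1 = ⊥ := by
    rw [eq_bot_iff]
    rintro x ⟨hx1, hx2⟩
    have h2 := o_alg v (h.alg_of_RR_zero hx1)
    rcases hx2 with h3 | h3
    · exact h3
    · omega
  have h2 : RR (0 : Dvs K) ≤ v.V 0 := fun x hx => by simpa using mem_RR.mp hx v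
  have h3 : (v.V 1).relIndex (RR (0 : Dvs K)) ≠ 0 := fun h0 =>
    h.nrm_ne_zero v (AddSubgroup.relIndex_eq_zero_of_le_right h2 h0)
  rw [← AddSubgroup.inf_relIndex_right, inf_comm, h1, AddSubgroup.relIndex_bot_left] at h3
  exact Nat.finite_of_card_ne_zero h3

lemma finite_RR (h : IsFF p K) (D : Dvs K) : Finite (RR D) := by
  obtain ⟨E, hE⟩ : ∃ E : Eff K, D ≤ ofEff E := by
    refine ⟨D.mapRange Int.toNat (by simp), fun v => ?_⟩
    simp
  have h1 := (h.RR_steps E 0).1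
  rw [zero_add] at h1
  have h2 := AddSubgroup.relIndex_mul_relIndex ⊥ (RR 0) (RR (ofEff E)) bot_le
    (RR_mono (ofEff_nonneg E))
  rw [AddSubgroup.relIndex_bot_left, AddSubgroup.relIndex_bot_left] at h2
  have := h.finite_RR_zero
  have h3 : Nat.card (RR (ofEff E)) ≠ 0 := by
    rw [← h2]; exact mul_ne_zero Nat.card_pos.ne' h1
  have h4 := Nat.finite_of_card_ne_zero h3
  exact Finite.of_injective _ (AddSubgroup.inclusion_injective (RR_mono hE))

end IsFF

/-- Dimension of the Riemann-Roch space. -/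
def Dvs.ell (p : ℕ) {K : Type} [Field K] (D : Dvs K) : ℕ := Nat.log p (Nat.card (Dvs.RR D))

namespace IsFF

open Dvs

variable {p : ℕ} [Fact p.Prime] {K : Type} [Field K] [Algebra (ZMod p) K]

lemma card_RR (h : IsFF p K) (D : Dvs K) : Nat.card (RR D) = p ^ ell p D := by
  have := h.finite_RR D
  have h1 : (⊥ : AddSubgroup K).relIndex (RR D) ≠ 0 := by
    rw [AddSubgroup.relIndex_bot_left]; exact Nat.card_pos.ne'
  obtain ⟨k, hk⟩ := relIndex_eq_pow (p := p) _ _ h1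
  rw [AddSubgroup.relIndex_bot_left] at hk
  rw [ell, hk, Nat.log_pow (Fact.out : p.Prime).one_lt]

lemma ell_mono (h : IsFF p K) {D D' : Dvs K} (hD : D ≤ D') : ell p D ≤ ell p D' := by
  have := h.finite_RR D'
  exact Nat.log_mono_right (Nat.card_le_card_of_injective _
    (AddSubgroup.inclusion_injective (RR_mono hD)))

/-- `deg - ell` is monotone. -/
lemma g_mono (h : IsFF p K) {D D' : Dvs K} (hD : D ≤ D') :
    deg p D - ell p D ≤ deg p D' - ell p D' := by
  obtain ⟨E, rfl⟩ := exists_add hD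
  have h1 := h.RR_steps E D
  have h2 := AddSubgroup.relIndex_mul_relIndex ⊥ (RR D) (RR (D + ofEff E)) bot_le (RR_mono hD)
  rw [AddSubgroup.relIndex_bot_left, AddSubgroup.relIndex_bot_left, h.card_RR, h.card_RR] at h2
  have hp : 1 < p := (Fact.out : p.Prime).one_lt
  have h3 : p ^ ell p (D + ofEff E) ≤ p ^ (ell p D + edeg p E) := by
    rw [← h2, pow_add]
    exact Nat.mul_le_mul_left _ h1.2
  rw [Nat.pow_le_pow_iff_right hp] at h3
  rw [map_add, deg_ofEff]
  omega

end IsFF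


namespace Dvs

variable {K : Type} [Field K]

/-- Zero divisor of an element. -/
def ze (x : K) : Eff K := (dv x).mapRange Int.toNat (by simp)

lemma mul_mem_RR {D D' : Dvs K} {x y : K} (hx : x ∈ RR D) (hy : y ∈ RR D') :
    x * y ∈ RR (D + D') := by
  rw [mem_RR] at *
  intro v
  have := FFPrime.mul_mem_V (hx v) (hy v)
  rwa [← neg_add] at this

lemma one_mem_RR : (1 : K) ∈ RR (0 : Dvs K) := by
  rw [mem_RR]; intro v; simpa using v.one_mem_V

lemma pow_mem_RR {D : Dvs K} {x : K} (hx : x ∈ RR D) (n : ℕ) : x ^ n ∈ RR (n • D) := by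
  induction n with
  | zero => simpa using one_mem_RR
  | succ n ih => rw [pow_succ, succ_nsmul]; exact mul_mem_RR ih hx

end Dvs

namespace IsFF

open Dvs

variable {p : ℕ} [Fact p.Prime] {K : Type} [Field K] [Algebra (ZMod p) K]

lemma ze_apply (h : IsFF p K) (x : K) (v : FFPrime K) : ze x v = (v.o x).toNat := by
  simp [ze, h.dv_apply]

lemma dv_eq (h : IsFF p K) (x : K) : dv x = ofEff (ze x) - ofEff (ze x⁻¹) := by
  ext v
  rw [Finsupp.sub_apply, ofEff_apply, ofEff_apply, h.ze_apply, h.ze_apply, h.dv_apply, v.o_inv]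
  omega

lemma edeg_ze_le (h : IsFF p K) {x : K} (hx : Transcendental (ZMod p) x) :
    edeg p (ze x) ≤ degOver p x := by
  have h1 := h.zeros_sum hx (ze x).support (fun v hv => by
    rw [Finsupp.mem_support_iff, h.ze_apply] at hv
    omega)
  have h2 : ((edeg p (ze x) : ℕ) : ℤ) = ∑ v ∈ (ze x).support, v.o x * v.dg p := by
    rw [edeg, Finsupp.liftAddHom_apply, Finsupp.sum]
    push_cast
    refine Finset.sum_congr rfl fun v hv => ?_
    rw [Finsupp.mem_support_iff, h.ze_apply] at hv
    simp only [AddMonoidHom.coe_mulRight, h.ze_apply]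
    push_cast
    rw [Int.toNat_of_nonneg (by omega)]
  rw [← h2] at h1
  exact_mod_cast h1

lemma mem_RR_ze (h : IsFF p K) (x : K) : x ∈ RR (ofEff (ze x⁻¹)) := by
  rw [mem_RR]
  intro v
  rw [ofEff_apply, h.ze_apply, v.o_inv]
  right
  omega

lemma growth (h : IsFF p K) {x : K} (hx : Transcendental (ZMod p) x) :
    ∃ C : Eff K, ∀ m : ℕ,
      degOver p x * (m + 1) ≤ ell p (m • ofEff (ze x⁻¹) + ofEff C) := by
  obtain ⟨u, hu⟩ := h.exists_basis hx
  refine ⟨∑ i, ze (u i)⁻¹, fun m => ?_⟩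
  set D := m • ofEff (ze x⁻¹) + ofEff (∑ i, ze (u i)⁻¹) with hD
  have huC : ∀ i, u i ∈ RR (ofEff (∑ i, ze (u i)⁻¹)) := by
    intro i
    refine RR_mono ?_ (h.mem_RR_ze (u i))
    intro v
    rw [ofEff_apply, ofEff_apply]
    have : ze (u i)⁻¹ ≤ ∑ i, ze (u i)⁻¹ :=
      Finset.single_le_sum (f := fun i => ze (u i)⁻¹) (fun _ _ => zero_le) (Finset.mem_univ i)
    exact_mod_cast this v
  have hmem : ∀ P : Fin (degOver p x) → degreeLT (ZMod p) (m + 1),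
      ∑ i, aeval x (P i : (ZMod p)[X]) * u i ∈ RR D := by
    intro P
    refine sum_mem fun i _ => ?_
    refine mul_mem_RR ?_ (huC i)
    have hd : ((P i : (ZMod p)[X])).natDegree < m + 1 := by
      by_cases h0 : (P i : (ZMod p)[X]) = 0
      · simp [h0]
      · exact (Polynomial.natDegree_lt_iff_degree_lt h0).mpr (mem_degreeLT.mp (P i).2)
    rw [aeval_eq_sum_range' hd]
    refine sum_mem fun k hk => ZMod.smul_mem ?_ _
    refine RR_mono ?_ (pow_mem_RR (h.mem_RR_ze x) k)
    have hk' : k ≤ m := by have := Finset.mem_range.mp hk; omega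
    exact nsmul_le_nsmul_left (ofEff_nonneg _) hk'
  let f : (Fin (degOver p x) → degreeLT (ZMod p) (m + 1)) → RR D := fun P => ⟨_, hmem P⟩
  have hf : Function.Injective f := by
    intro P Q hPQ
    have h1 : ∑ i, aeval x (P i : (ZMod p)[X]) * u i = ∑ i, aeval x (Q i : (ZMod p)[X]) * u i :=
      congrArg Subtype.val hPQ
    have h2 := hu (fun i => (P i : (ZMod p)[X]) - Q i) (by
      simp only [map_sub, sub_mul, Finset.sum_sub_distrib]
      rw [h1, sub_self])
    funext i
    exact Subtype.ext (sub_eq_zero.mp (h2 i))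
  have := h.finite_RR D
  have hc := Nat.card_le_card_of_injective f hf
  have hcd : Nat.card (degreeLT (ZMod p) (m + 1)) = p ^ (m + 1) := by
    rw [Nat.card_congr (degreeLTEquiv (ZMod p) (m + 1)).toEquiv]
    simp
  rw [Nat.card_fun, hcd, h.card_RR D, Nat.card_fin, ← pow_mul] at hc
  rw [Nat.pow_le_pow_iff_right (Fact.out : p.Prime).one_lt] at hc
  linarith

lemma edeg_poles (h : IsFF p K) {x : K} (hx : Transcendental (ZMod p) x) :
    edeg p (ze x⁻¹) = degOver p x := by
  apply le_antisymm
  · rw [← degOver_inv x]; exact h.edeg_ze_le (transc_inv hx)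
  obtain ⟨C, hC⟩ := h.growth hx
  by_contra hcon
  push Not at hcon
  set b := edeg p (ze x⁻¹)
  set n := degOver p x
  set m := ell p (0 : Dvs K) + edeg p C with hm
  have h1 := hC m
  have h2 := h.g_mono (D := 0) (D' := m • ofEff (ze x⁻¹) + ofEff C)
    (add_nonneg (nsmul_nonneg (ofEff_nonneg _) _) (ofEff_nonneg _))
  rw [map_zero, map_add, map_nsmul, deg_ofEff, deg_ofEff] at h2
  have h3 : (n * (m + 1) : ℤ) ≤ ell p (m • ofEff (ze x⁻¹) + ofEff C) := by exact_mod_cast h1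
  have h4 : ((m : ℕ) : ℤ) = ell p (0 : Dvs K) + edeg p C := by rw [hm]; push_cast; rfl
  have h5 : (b : ℤ) + 1 ≤ n := by exact_mod_cast hcon
  simp only [nsmul_eq_mul] at h2
  have h6 : (0 : ℤ) ≤ m := by positivity
  nlinarith

lemma edeg_zeros (h : IsFF p K) {x : K} (hx : Transcendental (ZMod p) x) :
    edeg p (ze x) = degOver p x := by
  have := h.edeg_poles (transc_inv hx)
  rwa [inv_inv, degOver_inv] at this

theorem deg_dv (h : IsFF p K) (x : K) : deg p (dv x) = 0 := by
  by_cases hx : Transcendental (ZMod p) x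
  · rw [h.dv_eq, map_sub, deg_ofEff, deg_ofEff, h.edeg_poles hx, h.edeg_zeros hx, sub_self]
  · have : dv x = 0 := by
      ext v
      rw [h.dv_apply, o_alg v (not_not.mp hx)]; rfl
    rw [this, map_zero]

lemma ell_add_dv_le (h : IsFF p K) (D : Dvs K) {y : K} (hy : y ≠ 0) :
    ell p (D + dv y) ≤ ell p D := by
  have hmem : ∀ z ∈ RR (D + dv y), y * z ∈ RR D := by
    intro z hz
    by_cases hz0 : z = 0
    · simp [hz0, zero_mem]
    rw [h.mem_RR_iff hz0] at hz
    rw [h.mem_RR_iff (mul_ne_zero hy hz0), h.dv_mul hy hz0]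
    have : dv y + dv z + D = dv z + (D + dv y) := by abel
    rw [this]; exact hz
  have := h.finite_RR D
  refine Nat.log_mono_right (Nat.card_le_card_of_injective
    (fun z : RR (D + dv y) => (⟨y * z, hmem z z.2⟩ : RR D)) ?_)
  intro a b hab
  have h1 : y * (a : K) = y * b := congrArg Subtype.val hab
  exact Subtype.ext (mul_left_cancel₀ hy h1)

lemma ell_add_dv (h : IsFF p K) (D : Dvs K) {y : K} (hy : y ≠ 0) :
    ell p (D + dv y) = ell p D := by
  apply le_antisymm (h.ell_add_dv_le D hy)
  have := h.ell_add_dv_le (D + dv y) (inv_ne_zero hy)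
  rwa [h.dv_inv, add_neg_cancel_right] at this

lemma exists_of_ell_pos (h : IsFF p K) {D : Dvs K} (hD : 0 < ell p D) :
    ∃ y : K, y ≠ 0 ∧ 0 ≤ dv y + D := by
  have h1 : 1 < Nat.card (RR D) := by
    rw [h.card_RR]
    exact Nat.one_lt_pow hD.ne' (Fact.out : p.Prime).one_lt
  have := h.finite_RR D
  have : Nontrivial (RR D) := Finite.one_lt_card_iff_nontrivial.mp h1
  obtain ⟨y, hy⟩ := exists_ne (0 : RR D)
  have hy0 : (y : K) ≠ 0 := fun h0 => hy (Subtype.ext h0)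
  exact ⟨y, hy0, (h.mem_RR_iff hy0).mp y.2⟩

lemma riemann_bound (h : IsFF p K) : ∃ γ : ℤ, ∀ D : Dvs K, deg p D - ell p D ≤ γ := by
  obtain ⟨x, hx⟩ := h.ex
  obtain ⟨C, hC⟩ := h.growth hx
  set n := degOver p x with hn
  have hn0 : 0 < n := h.degOver_pos hx
  set B := ofEff (ze x⁻¹) with hB
  have hdB : deg p B = n := by rw [hB, deg_ofEff, h.edeg_poles hx]
  refine ⟨edeg p C, fun D => ?_⟩
  obtain ⟨E, hE⟩ : ∃ E : Eff K, D ≤ ofEff E := by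
    refine ⟨D.mapRange Int.toNat (by simp), fun v => ?_⟩
    simp
  set m := edeg p E with hm
  have h1 := h.g_mono (D := m • B + ofEff C - ofEff E) (D' := m • B + ofEff C)
    (sub_le_self _ (ofEff_nonneg E))
  have h2 : (n * (m + 1) : ℤ) ≤ ell p (m • B + ofEff C) := by exact_mod_cast hC m
  have h3 : 0 < ell p (m • B + ofEff C - ofEff E) := by
    rw [map_sub, deg_ofEff, ← hm] at h1
    have : (0 : ℤ) < ell p (m • B + ofEff C - ofEff E) := by nlinarith
    exact_mod_cast this
  obtain ⟨y, hy, hy'⟩ := h.exists_of_ell_pos h3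
  have h4 : ofEff E ≤ (m • B + ofEff C) + dv y := by
    rw [← sub_nonneg]
    convert hy' using 1
    abel
  have h5 := h.g_mono (hE.trans h4)
  rw [h.ell_add_dv _ hy, map_add, map_add, map_nsmul, hdB, deg_ofEff, h.deg_dv] at h5
  simp only [nsmul_eq_mul] at h5
  nlinarith

theorem riemann (h : IsFF p K) : ∃ (g : ℤ) (N : ℕ), ∀ D : Dvs K, (N : ℤ) ≤ deg p D →
    (ell p D : ℤ) = deg p D - g := by
  obtain ⟨γ, hγ⟩ := h.riemann_bound
  obtain ⟨g, ⟨D0, hD0⟩, hg⟩ : ∃ g : ℤ, (∃ D : Dvs K, deg p D - ell p D = g) ∧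
      ∀ z : ℤ, (∃ D : Dvs K, deg p D - ell p D = z) → z ≤ g := by
    apply Int.exists_greatest_of_bdd
    · exact ⟨γ, by rintro z ⟨D, rfl⟩; exact hγ D⟩
    · exact ⟨_, 0, rfl⟩
  refine ⟨g, (deg p D0 + γ + 1).toNat, fun D hD => ?_⟩
  have h1 := hγ (D - D0)
  rw [map_sub] at h1
  have h2 : 0 < ell p (D - D0) := by omega
  obtain ⟨y, hy, hy'⟩ := h.exists_of_ell_pos h2
  have h3 : D0 ≤ D + dv y := by
    rw [← sub_nonneg]
    convert hy' using 1
    abel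
  have h4 := h.g_mono h3
  rw [h.ell_add_dv _ hy, map_add, h.deg_dv] at h4
  have h5 := hg _ ⟨D, rfl⟩
  omega

end IsFF


namespace IsFF

open Dvs

variable {p : ℕ} [Fact p.Prime] {K : Type} [Field K] [Algebra (ZMod p) K]

lemma finite_dg_le (h : IsFF p K) (d : ℕ) : {v : FFPrime K | v.dg p ≤ d}.Finite := by
  obtain ⟨x, hx⟩ := h.ex
  have hne : ∀ i j : ℕ, i < j → x ^ i - x ^ j ≠ 0 := by
    intro i j hij h0
    have h1 := (transcendental_iff.mp hx) (X ^ i - X ^ j) (by simpa using h0)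
    have h2 := congrArg (fun P : (ZMod p)[X] => P.coeff i) h1
    simp [coeff_X_pow, hij.ne] at h2
  refine Set.Finite.subset (s := {v : FFPrime K | v.o x ≠ 0} ∪
    ⋃ i ∈ Finset.range (p ^ d + 1), ⋃ j ∈ Finset.range (p ^ d + 1),
      {v : FFPrime K | v.o (x ^ i - x ^ j) ≠ 0}) ?_ ?_
  · refine (h.finite_supp x).union ?_
    refine Set.Finite.biUnion (Finset.finite_toSet _) fun i _ => ?_
    exact Set.Finite.biUnion (Finset.finite_toSet _) fun j _ => h.finite_supp _
  intro v hv
  have hv' : v.dg p ≤ d := hv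
  by_cases hvx : v.o x ≠ 0
  · exact Or.inl hvx
  right
  push Not at hvx
  have hx0 : x ∈ v.V 0 := Or.inr hvx.ge
  have hcard : Nat.card (v.V 0 ⧸ (v.V 1).addSubgroupOf (v.V 0)) = p ^ v.dg p := h.nrm_eq v
  have hfin : Finite (v.V 0 ⧸ (v.V 1).addSubgroupOf (v.V 0)) :=
    Nat.finite_of_card_ne_zero (by rw [hcard]; exact (pow_pos (Fact.out : p.Prime).pos _).ne')
  let f : Fin (p ^ d + 1) → (v.V 0 ⧸ (v.V 1).addSubgroupOf (v.V 0)) :=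
    fun i => QuotientAddGroup.mk ⟨x ^ (i : ℕ), FFPrime.pow_mem_V hx0 _⟩
  have hnf : ¬ Function.Injective f := by
    intro hf
    have h1 := Nat.card_le_card_of_injective f hf
    rw [hcard, Nat.card_fin] at h1
    have := Nat.pow_le_pow_right (Fact.out : p.Prime).pos hv'
    omega
  have key : ∀ i j : Fin (p ^ d + 1), i < j → f i = f j →
      v ∈ ⋃ i ∈ Finset.range (p ^ d + 1), ⋃ j ∈ Finset.range (p ^ d + 1),
      {v : FFPrime K | v.o (x ^ i - x ^ j) ≠ 0} := by
    intro i j hij hf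
    rw [QuotientAddGroup.eq] at hf
    have h1 : - x ^ (i : ℕ) + x ^ (j : ℕ) ∈ v.V 1 := hf
    simp only [Set.mem_iUnion, Finset.mem_range]
    refine ⟨i, i.2, j, j.2, ?_⟩
    have h2 : x ^ (i : ℕ) - x ^ (j : ℕ) ∈ v.V 1 := by
      have := neg_mem h1
      rwa [neg_add, neg_neg, ← sub_eq_add_neg] at this
    rw [FFPrime.mem_V_of_ne (hne _ _ hij)] at h2
    change _ ≠ _
    omega
  simp only [Function.Injective, not_forall] at hnf
  obtain ⟨i, j, hf, hij⟩ := hnf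
  rcases lt_or_gt_of_ne hij with h1 | h1
  · exact key i j h1 hf
  · exact key j i h1 hf.symm

lemma finite_edeg_le (h : IsFF p K) (n : ℕ) : {E : Eff K | edeg p E ≤ n}.Finite := by
  classical
  set S := (h.finite_dg_le n).toFinset
  let B : Eff K := ∑ v ∈ S, Finsupp.single v n
  refine (Set.finite_Icc (0 : Eff K) B).subset ?_
  intro E hE
  refine ⟨zero_le, fun v => ?_⟩
  have hE' : edeg p E ≤ n := hE
  by_cases hv0 : E v = 0
  · rw [hv0]; exact Nat.zero_le _
  have h1 : Finsupp.single v (E v) ≤ E := Finsupp.single_le_iff.mpr le_rfl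
  obtain ⟨F, hF⟩ := exists_add_of_le h1
  have h2 : edeg p E = E v * v.dg p + edeg p F := by
    conv_lhs => rw [hF]
    rw [map_add, edeg_single]
  have h3 := h.dg_pos v
  have h4 : E v ≤ n := by nlinarith
  have h5 : v.dg p ≤ n := by nlinarith [Nat.pos_of_ne_zero hv0]
  have h6 : v ∈ S := by simpa [S] using h5
  have h7 : Finsupp.single v n ≤ B :=
    Finset.single_le_sum (f := fun v => Finsupp.single v n) (fun _ _ => zero_le) h6
  have h8 := h7 v
  rw [Finsupp.single_eq_same] at h8
  exact h4.trans h8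

end IsFF

namespace Dvs

variable {K : Type} [Field K]

/-- The linear system of a divisor. -/
def lin (D : Dvs K) : Set (Eff K) := {E | ∃ y : K, y ≠ 0 ∧ ofEff E = D + dv y}

/-- Number of nonzero constants. -/
def kap (K : Type) [Field K] : ℕ := Nat.card {c : K // c ≠ 0 ∧ c ∈ RR (0 : Dvs K)}

end Dvs

namespace IsFF

open Dvs

variable {p : ℕ} [Fact p.Prime] {K : Type} [Field K] [Algebra (ZMod p) K]

lemma card_ne (h : IsFF p K) (D : Dvs K) :
    Nat.card {y : K // y ≠ 0 ∧ y ∈ RR D} + 1 = p ^ ell p D := by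
  classical
  have := h.finite_RR D
  rw [← h.card_RR D]
  have e : {y : K // y ≠ 0 ∧ y ∈ RR D} ≃ {y : RR D // y ≠ 0} :=
    { toFun := fun y => ⟨⟨y.1, y.2.2⟩, fun h0 => y.2.1 (congrArg Subtype.val h0)⟩
      invFun := fun y => ⟨y.1.1, fun h0 => y.2 (Subtype.ext h0), y.1.2⟩
      left_inv := fun y => rfl
      right_inv := fun y => rfl }
  rw [Nat.card_congr e]
  have := Fintype.ofFinite (RR D)
  rw [Nat.card_eq_fintype_card, Nat.card_eq_fintype_card, Fintype.card_subtype_compl]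
  have : 0 < Fintype.card (RR D) := Fintype.card_pos
  simp
  omega

lemma dv_const (h : IsFF p K) {c : K} (hc : c ∈ RR (0 : Dvs K)) : dv c = 0 := by
  ext v
  rw [h.dv_apply, o_alg v (h.alg_of_RR_zero hc)]; rfl

lemma kap_pos (h : IsFF p K) : 0 < kap K := by
  have := h.finite_RR_zero
  have h1 : Finite {c : K // c ≠ 0 ∧ c ∈ RR (0 : Dvs K)} :=
    Finite.of_injective (fun c => (⟨c.1, c.2.2⟩ : RR (0 : Dvs K))) (fun a b hab =>
      Subtype.ext (congrArg (fun z : RR (0 : Dvs K) => (z : K)) hab))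
  have : Nonempty {c : K // c ≠ 0 ∧ c ∈ RR (0 : Dvs K)} := ⟨⟨1, one_ne_zero, one_mem_RR⟩⟩
  exact Nat.card_pos

lemma card_lin (h : IsFF p K) (D : Dvs K) :
    Nat.card (lin D) * kap K + 1 = p ^ ell p D := by
  rw [← h.card_ne D, kap, ← Nat.card_prod]
  congr 1
  choose Y hY0 hY using fun E : lin D => E.2
  let F : lin D × {c : K // c ≠ 0 ∧ c ∈ RR (0 : Dvs K)} → {y : K // y ≠ 0 ∧ y ∈ RR D} :=
    fun z => ⟨z.2.1 * Y z.1, mul_ne_zero z.2.2.1 (hY0 z.1), by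
      have h1 : Y z.1 ∈ RR D := by
        rw [h.mem_RR_iff (hY0 z.1), add_comm, ← hY z.1]; exact ofEff_nonneg _
      have := mul_mem_RR z.2.2.2 h1
      rwa [zero_add] at this⟩
  refine Nat.card_congr (Equiv.ofBijective F ⟨?_, ?_⟩)
  · rintro ⟨E, c⟩ ⟨E', c'⟩ hEE
    have h1 : c.1 * Y E = c'.1 * Y E' := congrArg Subtype.val hEE
    have h2 := congrArg dv h1
    rw [h.dv_mul c.2.1 (hY0 E), h.dv_mul c'.2.1 (hY0 E'), h.dv_const c.2.2, h.dv_const c'.2.2,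
      zero_add, zero_add] at h2
    have h3 : E = E' := by
      apply Subtype.ext
      apply ofEff_injective
      rw [hY E, hY E', h2]
    subst h3
    have h4 : c = c' := Subtype.ext (mul_right_cancel₀ (hY0 E) h1)
    rw [h4]
  · rintro ⟨y, hy0, hy⟩
    rw [h.mem_RR_iff hy0] at hy
    obtain ⟨E, hE⟩ := exists_ofEff hy
    have hE' : E ∈ lin D := ⟨y, hy0, by rw [hE, add_comm]⟩
    have h1 : dv (Y ⟨E, hE'⟩) = dv y := by
      have h2 := hY ⟨E, hE'⟩
      change ofEff E = _ at h2
      rw [hE, add_comm] at h2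
      exact (add_left_cancel h2).symm
    have hc0 : y * (Y ⟨E, hE'⟩)⁻¹ ≠ 0 := mul_ne_zero hy0 (inv_ne_zero (hY0 _))
    have hc : y * (Y ⟨E, hE'⟩)⁻¹ ∈ RR (0 : Dvs K) := by
      rw [h.mem_RR_iff hc0, h.dv_mul hy0 (inv_ne_zero (hY0 _)), h.dv_inv, h1]
      simp
    refine ⟨(⟨E, hE'⟩, ⟨_, hc0, hc⟩), Subtype.ext ?_⟩
    change y * (Y ⟨E, hE'⟩)⁻¹ * Y ⟨E, hE'⟩ = y
    rw [inv_mul_cancel_right₀ (hY0 _)]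

/-- Effective divisors of degree `n`. -/
def effs (h : IsFF p K) (n : ℕ) : Finset (Eff K) :=
  (Set.Finite.subset (h.finite_edeg_le n) (t := {E : Eff K | edeg p E = n})
    (fun _ hE => le_of_eq hE)).toFinset

lemma mem_effs (h : IsFF p K) {n : ℕ} {E : Eff K} : E ∈ h.effs n ↔ edeg p E = n := by
  simp [effs]

lemma edeg_of_lin (h : IsFF p K) {D : Dvs K} {E : Eff K} (hE : E ∈ lin D) :
    (edeg p E : ℤ) = deg p D := by
  obtain ⟨y, hy, h1⟩ := hE
  rw [← deg_ofEff, h1, map_add, h.deg_dv, add_zero]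

lemma lin_symm (h : IsFF p K) {A : Dvs K} {E E' : Eff K} :
    E' ∈ lin (ofEff E + A) ↔ E ∈ lin (ofEff E' - A) := by
  constructor
  · rintro ⟨y, hy, h1⟩
    exact ⟨y⁻¹, inv_ne_zero hy, by rw [h.dv_inv, h1]; abel⟩
  · rintro ⟨y, hy, h1⟩
    exact ⟨y⁻¹, inv_ne_zero hy, by rw [h.dv_inv, h1]; abel⟩

open Classical in
lemma double_count (h : IsFF p K) (χ : Eff K → ℂ) (ω : ℂ) (A : Dvs K) (d : ℕ) (hA : deg p A = d)
    (hχ : ∀ E E' : Eff K, E' ∈ lin (ofEff E + A) → χ E' = ω * χ E)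
    (g : ℤ) (N : ℕ) (hg : ∀ D : Dvs K, (N : ℤ) ≤ deg p D → (ell p D : ℤ) = deg p D - g)
    (n : ℕ) (hn : N ≤ n) :
    ((p : ℂ) ^ ((n : ℤ) - g) - 1) * ∑ E ∈ h.effs (n + d), χ E =
      ω * ((p : ℂ) ^ ((n : ℤ) + d - g) - 1) * ∑ E ∈ h.effs n, χ E := by
  have hp0 : (p : ℂ) ≠ 0 := by exact_mod_cast (Fact.out : p.Prime).ne_zero
  have hcnt : ∀ D : Dvs K, (N : ℤ) ≤ deg p D →
      (Nat.card (lin D) : ℂ) * kap K = (p : ℂ) ^ (deg p D - g) - 1 := by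
    intro D hD
    have h1 := h.card_lin D
    have h2 : ((Nat.card (lin D) * kap K + 1 : ℕ) : ℂ) = ((p ^ ell p D : ℕ) : ℂ) := by rw [h1]
    push_cast at h2
    rw [← hg D hD, zpow_natCast, ← h2]; ring
  have hfilt : ∀ (D : Dvs K) (m : ℕ), deg p D = m →
      (((h.effs m).filter (fun E => E ∈ lin D)).card : ℂ) = Nat.card (lin D) := by
    intro D m hD
    have h1 : lin D = (((h.effs m).filter (fun E => E ∈ lin D) : Finset (Eff K)) : Set (Eff K)) := by
      ext E
      simp only [Finset.coe_filter, Set.mem_setOf_eq, h.mem_effs]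
      refine ⟨fun hE => ⟨?_, hE⟩, fun hE => hE.2⟩
      have := h.edeg_of_lin hE
      rw [hD] at this
      exact_mod_cast this
    rw [Nat.card_coe_set_eq]
    conv_rhs => rw [h1]
    rw [Set.ncard_coe_finset]
  have e1 : (∑ E ∈ h.effs n, ∑ E' ∈ h.effs (n + d),
      if E' ∈ lin (ofEff E + A) then χ E' else 0) * kap K =
      ω * ((p : ℂ) ^ ((n : ℤ) + d - g) - 1) * ∑ E ∈ h.effs n, χ E := by
    rw [Finset.sum_mul, Finset.mul_sum]
    refine Finset.sum_congr rfl fun E hE => ?_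
    rw [h.mem_effs] at hE
    have hd : deg p (ofEff E + A) = ((n + d : ℕ) : ℤ) := by
      rw [map_add, deg_ofEff, hA, hE]; push_cast; rfl
    rw [← Finset.sum_filter, Finset.sum_congr rfl (g := fun _ => ω * χ E) (fun E' hE' =>
      hχ E E' (Finset.mem_filter.mp hE').2), Finset.sum_const, nsmul_eq_mul, hfilt _ _ hd]
    have h2 := hcnt (ofEff E + A) (by rw [hd]; push_cast; omega)
    rw [hd] at h2
    push_cast at h2
    rw [← h2]; ring
  have e2 : (∑ E ∈ h.effs n, ∑ E' ∈ h.effs (n + d),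
      if E' ∈ lin (ofEff E + A) then χ E' else 0) * kap K =
      ((p : ℂ) ^ ((n : ℤ) - g) - 1) * ∑ E ∈ h.effs (n + d), χ E := by
    rw [Finset.sum_comm, Finset.sum_mul, Finset.mul_sum]
    refine Finset.sum_congr rfl fun E' hE' => ?_
    rw [h.mem_effs] at hE'
    have hd : deg p (ofEff E' - A) = (n : ℤ) := by
      rw [map_sub, deg_ofEff, hA, hE']; push_cast; ring
    simp only [h.lin_symm]
    rw [← Finset.sum_filter, Finset.sum_const, nsmul_eq_mul, hfilt _ _ hd]
    have h2 := hcnt (ofEff E' - A) (by rw [hd]; omega)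
    rw [hd] at h2
    rw [← h2]; ring
  rw [← e1, ← e2]

end IsFF


namespace IsFF

open Dvs

variable {p : ℕ} [Fact p.Prime] {K : Type} [Field K] [Algebra (ZMod p) K]

lemma double_count_one (h : IsFF p K) (A : Dvs K) (d : ℕ) (hA : deg p A = d)
    (g : ℤ) (N : ℕ) (hg : ∀ D : Dvs K, (N : ℤ) ≤ deg p D → (ell p D : ℤ) = deg p D - g)
    (n : ℕ) (hn : N ≤ n) :
    ((p : ℝ) ^ ((n : ℤ) - g) - 1) * (h.effs (n + d)).card =
      ((p : ℝ) ^ ((n : ℤ) + d - g) - 1) * (h.effs n).card := by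
  have := h.double_count (fun _ => 1) 1 A d hA (fun _ _ _ => by simp) g N hg n hn
  simp only [Finset.sum_const, nsmul_eq_mul, mul_one, one_mul] at this
  apply Complex.ofReal_injective
  push_cast
  exact this

lemma card_bound (h : IsFF p K)
    (g : ℤ) (N : ℕ) (hg : ∀ D : Dvs K, (N : ℤ) ≤ deg p D → (ell p D : ℤ) = deg p D - g) :
    ∃ (S : ℝ) (N1 : ℕ), 0 ≤ S ∧ N ≤ N1 ∧ (∀ n : ℕ, N1 ≤ n → 1 ≤ (p : ℝ) ^ ((n : ℤ) - g) - 1) ∧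
      (∀ n : ℕ, N1 ≤ n → ((h.effs n).card : ℝ) ≤ S * ((p : ℝ) ^ ((n : ℤ) - g) - 1)) ∧
      (∀ n : ℕ, n < N1 → ((h.effs n).card : ℝ) ≤ S) := by
  obtain ⟨v⟩ := h.exists_pl
  have hd := h.dg_pos v
  set d := v.dg p with hd_def
  have hA : deg p (Finsupp.single v 1 : Dvs K) = d := by rw [deg_single, one_mul]
  set N1 := max N (g + 1).toNat with hN1
  have hp : (2 : ℝ) ≤ p := by exact_mod_cast (Fact.out : p.Prime).two_le
  have hr : ∀ n : ℕ, N1 ≤ n → 1 ≤ (p : ℝ) ^ ((n : ℤ) - g) - 1 := by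
    intro n hn
    have h1 : (g + 1).toNat ≤ n := (le_max_right _ _).trans hn
    have h2 : (1 : ℤ) ≤ (n : ℤ) - g := by omega
    have h3 : (p : ℝ) ^ (1 : ℤ) ≤ (p : ℝ) ^ ((n : ℤ) - g) := zpow_le_zpow_right₀ (by linarith) h2
    rw [zpow_one] at h3
    linarith
  set S : ℝ := ∑ i ∈ Finset.range (N1 + d), ((h.effs i).card : ℝ) with hS
  have hS0 : 0 ≤ S := Finset.sum_nonneg fun _ _ => by positivity
  have hle : ∀ n, n < N1 + d → ((h.effs n).card : ℝ) ≤ S := fun n hn =>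
    Finset.single_le_sum (f := fun i => ((h.effs i).card : ℝ)) (fun _ _ => by positivity)
      (Finset.mem_range.mpr hn)
  refine ⟨S, N1, hS0, le_max_left _ _, hr, ?_, fun n hn => hle n (by omega)⟩
  intro n
  induction n using Nat.strong_induction_on with
  | _ n ih =>
    intro hn
    by_cases hlt : n < N1 + d
    · have := hle n hlt
      nlinarith [hr n hn]
    · obtain ⟨m, rfl⟩ : ∃ m, n = m + d := ⟨n - d, by omega⟩
      have h1 := ih m (by omega) (by omega)
      have h2 := h.double_count_one _ d hA g N hg m ((le_max_left _ _).trans (by omega : N1 ≤ m))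
      have h3 := hr m (by omega)
      have h4 := hr (m + d) (by omega)
      push_cast at h4 ⊢
      set r := (p : ℝ) ^ ((m : ℤ) - g) - 1
      set r' := (p : ℝ) ^ ((m : ℤ) + d - g) - 1
      have h5 : r * (h.effs (m + d)).card ≤ r * (S * r') := by
        rw [h2]
        calc r' * (h.effs m).card ≤ r' * (S * r) := by gcongr
          _ = _ := by ring
      exact le_of_mul_le_mul_left h5 (by linarith)

lemma card_bound' (h : IsFF p K) : ∃ C : ℝ, 0 < C ∧ ∀ n : ℕ, ((h.effs n).card : ℝ) ≤ C * p ^ n := by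
  obtain ⟨g, N, hg⟩ := h.riemann
  obtain ⟨S, N1, hS, -, h1, h2, h3⟩ := h.card_bound g N hg
  have hp : (2 : ℝ) ≤ p := by exact_mod_cast (Fact.out : p.Prime).two_le
  have hp0 : (p : ℝ) ≠ 0 := by linarith
  have hgp : 0 < (p : ℝ) ^ (-g) := zpow_pos (by linarith) _
  refine ⟨S * (1 + (p : ℝ) ^ (-g)) + 1, by positivity, fun n => ?_⟩
  have hpn : (1 : ℝ) ≤ p ^ n := one_le_pow₀ (by linarith)
  by_cases hn : N1 ≤ n
  · have := h2 n hn
    rw [sub_eq_add_neg (n : ℤ) g, zpow_add₀ hp0, zpow_natCast] at this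
    have h4 : 0 ≤ S * p ^ n := by positivity
    nlinarith
  · have := h3 n (by omega)
    have h4 : 0 ≤ S * (p : ℝ) ^ (-g) := by positivity
    have : S ≤ S * p ^ n := by nlinarith
    nlinarith

lemma card_lower (h : IsFF p K) : ∃ (c : ℝ) (n0 d : ℕ), 0 < c ∧ 0 < d ∧
    ∀ k : ℕ, c * p ^ (d * k) ≤ ((h.effs (n0 + d * k)).card : ℝ) := by
  obtain ⟨g, N, hg⟩ := h.riemann
  obtain ⟨S, N1, hS, hN, h1, h2, h3⟩ := h.card_bound g N hg
  obtain ⟨v⟩ := h.exists_pl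
  have hd := h.dg_pos v
  set d := v.dg p with hd_def
  have hp : (2 : ℝ) ≤ p := by exact_mod_cast (Fact.out : p.Prime).two_le
  have hp0 : (p : ℝ) ≠ 0 := by linarith
  set n0 := N1 * d with hn0
  have hn0N : N1 ≤ n0 := by nlinarith
  have hr0 := h1 n0 hn0N
  set r0 := (p : ℝ) ^ ((n0 : ℤ) - g) - 1 with hr0d
  have hc0 : 1 ≤ ((h.effs n0).card : ℝ) := by
    have : 0 < (h.effs n0).card := Finset.card_pos.mpr ⟨Finsupp.single v N1, by
      rw [h.mem_effs, edeg_single]⟩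
    exact_mod_cast this
  refine ⟨1, n0, d, by norm_num, hd, fun k => ?_⟩
  have hA : deg p (Finsupp.single v (k : ℤ) : Dvs K) = ((d * k : ℕ) : ℤ) := by
    rw [deg_single]; push_cast; ring
  have h4 := h.double_count_one _ (d * k) hA g N hg n0 (hN.trans hn0N)
  have h5 : (p : ℝ) ^ (d * k) * r0 ≤ (p : ℝ) ^ ((n0 : ℤ) + (d * k : ℕ) - g) - 1 := by
    have : (n0 : ℤ) + (d * k : ℕ) - g = (n0 - g) + (d * k : ℕ) := by ring
    rw [this, zpow_add₀ hp0, zpow_natCast, hr0d]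
    have : (1 : ℝ) ≤ p ^ (d * k) := one_le_pow₀ (by linarith)
    nlinarith
  rw [one_mul]
  have h6 : r0 * p ^ (d * k) ≤ r0 * (h.effs (n0 + d * k)).card := by
    rw [h4]
    have : 0 ≤ (p : ℝ) ^ (d * k) * r0 := by positivity
    nlinarith
  exact le_of_mul_le_mul_left h6 (by linarith)

/-- Coefficients of the L-series. -/
def cf (h : IsFF p K) (χ : AddChar (Dvs K) ℂ) (n : ℕ) : ℂ := ∑ E ∈ h.effs n, χ (ofEff E)

/-- The L-series. -/
def Ls (p : ℕ) (χ : AddChar (Dvs K) ℂ) (t : ℝ) : ℂ := ∑' E : Eff K, χ (ofEff E) * (t : ℂ) ^ edeg p E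

lemma norm_cf_le (h : IsFF p K) {χ : AddChar (Dvs K) ℂ} (hχ : ∀ D, ‖χ D‖ = 1) (n : ℕ) :
    ‖h.cf χ n‖ ≤ (h.effs n).card := by
  refine (norm_sum_le _ _).trans ?_
  simp [hχ]

lemma rec_bound (h : IsFF p K) {χ : AddChar (Dvs K) ℂ} (hχ : ∀ D, ‖χ D‖ = 1)
    (hpr : ∀ y : K, y ≠ 0 → χ (dv y) = 1) (A : Dvs K) (d : ℕ) (hA : deg p A = d) :
    ∃ C : ℝ, 0 ≤ C ∧ ∀ n, ‖h.cf χ (n + d) - χ A * (p : ℂ) ^ d * h.cf χ n‖ ≤ C := by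
  obtain ⟨g, N, hg⟩ := h.riemann
  obtain ⟨S, N1, hS, hN, h1, h2, h3⟩ := h.card_bound g N hg
  have hp : (2 : ℝ) ≤ p := by exact_mod_cast (Fact.out : p.Prime).two_le
  have hp0 : (p : ℂ) ≠ 0 := by exact_mod_cast (Fact.out : p.Prime).ne_zero
  have hpd : (1 : ℝ) ≤ p ^ d := one_le_pow₀ (by linarith)
  set F : ℕ → ℝ := fun n => ‖h.cf χ (n + d) - χ A * (p : ℂ) ^ d * h.cf χ n‖ with hF
  have hS' : 0 ≤ ∑ n ∈ Finset.range N1, F n := Finset.sum_nonneg fun _ _ => norm_nonneg _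
  refine ⟨S * (p ^ d - 1) + ∑ n ∈ Finset.range N1, F n, by nlinarith, fun n => ?_⟩
  by_cases hn : N1 ≤ n
  · have h4 := h.double_count (fun E => χ (ofEff E)) (χ A) A d hA (by
      rintro E E' ⟨y, hy, h5⟩
      change χ (ofEff E') = χ A * χ (ofEff E)
      rw [h5, AddChar.map_add_eq_mul, AddChar.map_add_eq_mul, hpr y hy, mul_one, mul_comm])
      g N hg n (hN.trans hn)
    change _ * h.cf χ (n + d) = _ * h.cf χ n at h4
    have hr := h1 n hn
    set r := (p : ℝ) ^ ((n : ℤ) - g) - 1 with hrd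
    have h5 : (p : ℂ) ^ ((n : ℤ) - g) - 1 = (r : ℂ) := by rw [hrd]; push_cast; rfl
    have h6 : (p : ℂ) ^ ((n : ℤ) + d - g) - 1 = (p : ℂ) ^ d * (r : ℂ) + ((p : ℂ) ^ d - 1) := by
      have : (n : ℤ) + d - g = (n - g) + (d : ℕ) := by ring
      rw [this, zpow_add₀ hp0, zpow_natCast, ← h5]; ring
    rw [h5, h6] at h4
    have h7 : (r : ℂ) * (h.cf χ (n + d) - χ A * (p : ℂ) ^ d * h.cf χ n) =
        χ A * ((p : ℂ) ^ d - 1) * h.cf χ n := by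
      linear_combination h4
    have h8 := congrArg norm h7
    rw [norm_mul, norm_mul, norm_mul, hχ, one_mul, Complex.norm_real, Real.norm_eq_abs,
      abs_of_nonneg (by linarith)] at h8
    have h9 : ‖(p : ℂ) ^ d - 1‖ = (p : ℝ) ^ d - 1 := by
      have : (p : ℂ) ^ d - 1 = (((p : ℝ) ^ d - 1 : ℝ) : ℂ) := by push_cast; rfl
      rw [this, Complex.norm_real, Real.norm_eq_abs, abs_of_nonneg (by linarith)]
    rw [h9] at h8
    have h10 : r * F n ≤ r * (S * (p ^ d - 1)) := by
      rw [hF]; simp only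
      rw [h8]
      have h11 := (h.norm_cf_le hχ n).trans (h2 n hn)
      calc ((p : ℝ) ^ d - 1) * ‖h.cf χ n‖ ≤ ((p : ℝ) ^ d - 1) * (S * r) :=
            mul_le_mul_of_nonneg_left h11 (by linarith)
        _ = _ := by ring
    have := le_of_mul_le_mul_left h10 (by linarith)
    change F n ≤ _
    linarith
  · have : F n ≤ ∑ n ∈ Finset.range N1, F n :=
      Finset.single_le_sum (f := F) (fun _ _ => norm_nonneg _) (Finset.mem_range.mpr (by omega))
    change F n ≤ _
    nlinarith

lemma summable_card (h : IsFF p K) {t : ℝ} (ht : 0 ≤ t) (ht1 : p * t < 1) :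
    Summable fun n : ℕ => ((h.effs n).card : ℝ) * t ^ n := by
  obtain ⟨C, hC, hb⟩ := h.card_bound'
  refine Summable.of_nonneg_of_le (fun n => by positivity) (fun n => ?_)
    ((summable_geometric_of_lt_one (by positivity : 0 ≤ p * t) ht1).mul_left C)
  rw [mul_pow, ← mul_assoc]
  exact mul_le_mul_of_nonneg_right (hb n) (by positivity)

lemma summable_eff (h : IsFF p K) {t : ℝ} (ht : 0 ≤ t) (ht1 : p * t < 1) :
    Summable fun E : Eff K => t ^ edeg p E := by
  classical
  refine summable_of_sum_le (c := ∑' n, ((h.effs n).card : ℝ) * t ^ n)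
    (fun E => by positivity) fun u => ?_
  have hsub : ∀ E ∈ u, edeg p E ∈ u.image (edeg p) := fun E hE => Finset.mem_image_of_mem _ hE
  rw [← Finset.sum_fiberwise_of_maps_to hsub]
  refine le_trans (Finset.sum_le_sum fun n _ => ?_)
    ((h.summable_card ht ht1).sum_le_tsum (u.image (edeg p)) (fun n _ => by positivity))
  rw [Finset.sum_congr rfl (g := fun _ => t ^ n) (fun E hE => by
    rw [(Finset.mem_filter.mp hE).2]), Finset.sum_const, nsmul_eq_mul]
  gcongr
  intro E hE
  rw [h.mem_effs]; exact (Finset.mem_filter.mp hE).2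

lemma summable_term (h : IsFF p K) {χ : AddChar (Dvs K) ℂ} (hχ : ∀ D, ‖χ D‖ = 1)
    {t : ℝ} (ht : 0 ≤ t) (ht1 : p * t < 1) :
    Summable fun E : Eff K => χ (ofEff E) * (t : ℂ) ^ edeg p E := by
  refine Summable.of_norm ?_
  convert h.summable_eff ht ht1 using 2 with E
  rw [norm_mul, hχ, one_mul, norm_pow, Complex.norm_real, Real.norm_eq_abs, abs_of_nonneg ht]

lemma tsum_fiber (h : IsFF p K) (f : Eff K → ℂ) (n : ℕ) :
    ∑' E : (edeg p ⁻¹' {n} : Set (Eff K)), f E = ∑ E ∈ h.effs n, f E := by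
  have : (edeg p ⁻¹' {n} : Set (Eff K)) = (h.effs n : Set (Eff K)) := by
    ext E; simp [h.mem_effs]
  rw [this]
  exact Finset.tsum_subtype (h.effs n) f

lemma Ls_hasSum (h : IsFF p K) {χ : AddChar (Dvs K) ℂ} (hχ : ∀ D, ‖χ D‖ = 1)
    {t : ℝ} (ht : 0 ≤ t) (ht1 : p * t < 1) :
    HasSum (fun n : ℕ => h.cf χ n * (t : ℂ) ^ n) (Ls p χ t) := by
  have h1 := (h.summable_term hχ ht ht1).hasSum.tsum_fiberwise (edeg p)
  have h2 : (fun n : ℕ => h.cf χ n * (t : ℂ) ^ n) = fun n : ℕ =>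
      ∑' E : (edeg p ⁻¹' {n} : Set (Eff K)), χ (ofEff E) * (t : ℂ) ^ edeg p (E : Eff K) := by
    funext n
    rw [h.tsum_fiber (fun E => χ (ofEff E) * (t : ℂ) ^ edeg p E), cf, Finset.sum_mul]
    exact Finset.sum_congr rfl fun E hE => by rw [h.mem_effs.mp hE]
  rw [h2]
  exact h1

lemma Ls_bound (h : IsFF p K) {χ : AddChar (Dvs K) ℂ} (hχ : ∀ D, ‖χ D‖ = 1)
    (hpr : ∀ y : K, y ≠ 0 → χ (dv y) = 1) (A : Dvs K) (d : ℕ) (hA : deg p A = d) :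
    ∃ C : ℝ, 0 ≤ C ∧ ∀ t : ℝ, 0 ≤ t → p * t < 1 →
      ‖(1 - χ A * ((p * t : ℝ) : ℂ) ^ d) * Ls p χ t‖ ≤ C := by
  obtain ⟨C, hC, hb⟩ := h.rec_bound hχ hpr A d hA
  have hp : (2 : ℝ) ≤ p := by exact_mod_cast (Fact.out : p.Prime).two_le
  have hS' : 0 ≤ ∑ n ∈ Finset.range d, ‖h.cf χ n‖ := Finset.sum_nonneg fun _ _ => norm_nonneg _
  refine ⟨∑ n ∈ Finset.range d, ‖h.cf χ n‖ + C * 2, by positivity, fun t ht ht1 => ?_⟩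
  have ht2 : t ≤ 1 / 2 := by nlinarith
  have hs := h.Ls_hasSum hχ ht ht1
  have hs1 := (hasSum_nat_add_iff' d).mpr hs
  have hs2 := hs.mul_left (χ A * (p : ℂ) ^ d * (t : ℂ) ^ d)
  have hs3 := hs1.sub hs2
  have e1 : (1 - χ A * ((p * t : ℝ) : ℂ) ^ d) * Ls p χ t =
      ∑ n ∈ Finset.range d, h.cf χ n * (t : ℂ) ^ n +
        (Ls p χ t - ∑ n ∈ Finset.range d, h.cf χ n * (t : ℂ) ^ n -
          χ A * (p : ℂ) ^ d * (t : ℂ) ^ d * Ls p χ t) := by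
    push_cast; rw [mul_pow]; ring
  rw [e1]
  have htn : ‖(t : ℂ)‖ = t := by rw [Complex.norm_real, Real.norm_eq_abs, abs_of_nonneg ht]
  refine (norm_add_le _ _).trans (add_le_add ?_ ?_)
  · refine (norm_sum_le _ _).trans (Finset.sum_le_sum fun n _ => ?_)
    rw [norm_mul, norm_pow, htn]
    exact mul_le_of_le_one_right (norm_nonneg _) (pow_le_one₀ ht (by linarith))
  · rw [← hs3.tsum_eq]
    have hgeo : HasSum (fun n : ℕ => C * (1 / 2 : ℝ) ^ n) (C * 2) := hasSum_geometric_two.mul_left C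
    refine tsum_of_norm_bounded hgeo fun n => ?_
    have : h.cf χ (n + d) * (t : ℂ) ^ (n + d) - χ A * (p : ℂ) ^ d * (t : ℂ) ^ d * (h.cf χ n * (t : ℂ) ^ n)
        = (h.cf χ (n + d) - χ A * (p : ℂ) ^ d * h.cf χ n) * (t : ℂ) ^ (n + d) := by
      rw [pow_add]; ring
    rw [this, norm_mul, norm_pow, htn]
    have h3 : t ^ (n + d) ≤ (1 / 2 : ℝ) ^ n := by
      calc t ^ (n + d) ≤ t ^ n := pow_le_pow_of_le_one ht (by linarith) (by omega)
        _ ≤ _ := by gcongr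
    exact mul_le_mul (hb n) h3 (by positivity) hC

/-- Nontrivial characters: bounded L-series. -/
lemma Ls_bound_nontriv (h : IsFF p K) {χ : AddChar (Dvs K) ℂ} (hχ : ∀ D, ‖χ D‖ = 1)
    (hpr : ∀ y : K, y ≠ 0 → χ (dv y) = 1) {A : Dvs K} {d : ℕ} (hA : deg p A = d)
    (hA1 : χ A ≠ 1) :
    ∃ C : ℝ, 0 < C ∧ ∀ t : ℝ, 0 ≤ t → p * t < 1 → ‖Ls p χ t‖ ≤ C := by
  obtain ⟨C, hC, hb⟩ := h.Ls_bound hχ hpr A d hA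
  have hpos : 0 < ‖1 - χ A‖ := norm_pos_iff.mpr (sub_ne_zero.mpr hA1.symm)
  refine ⟨C / (‖1 - χ A‖ / 2) + 1, by positivity, fun t ht ht1 => ?_⟩
  have h1 := hb t ht ht1
  set x : ℝ := (p * t) ^ d with hx
  have hx0 : 0 ≤ x := by positivity
  have hx1 : x ≤ 1 := pow_le_one₀ (by positivity) ht1.le
  have e : ((p * t : ℝ) : ℂ) ^ d = (x : ℂ) := by rw [hx]; push_cast; rfl
  rw [e, norm_mul] at h1
  have hn1 : ‖χ A * (x : ℂ)‖ = x := by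
    rw [norm_mul, hχ, one_mul, Complex.norm_real, Real.norm_eq_abs, abs_of_nonneg hx0]
  have h2 : 1 - x ≤ ‖1 - χ A * (x : ℂ)‖ := by
    have := norm_sub_norm_le (1 : ℂ) (χ A * (x : ℂ))
    rwa [norm_one, hn1] at this
  have h3 : ‖1 - χ A‖ ≤ ‖1 - χ A * (x : ℂ)‖ + (1 - x) := by
    have e2 : 1 - χ A = (1 - χ A * (x : ℂ)) + χ A * ((x - 1 : ℝ) : ℂ) := by push_cast; ring
    calc ‖1 - χ A‖ ≤ ‖1 - χ A * (x : ℂ)‖ + ‖χ A * ((x - 1 : ℝ) : ℂ)‖ := by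
          conv_lhs => rw [e2]
          exact norm_add_le _ _
      _ = _ := by
          rw [norm_mul, hχ, one_mul, Complex.norm_real, Real.norm_eq_abs, abs_of_nonpos (by linarith)]
          ring
  have h4 : ‖1 - χ A‖ / 2 ≤ ‖1 - χ A * (x : ℂ)‖ := by linarith
  have h5 : ‖Ls p χ t‖ ≤ C / (‖1 - χ A‖ / 2) := by
    rw [le_div_iff₀ (by positivity), mul_comm]
    exact (mul_le_mul_of_nonneg_right h4 (norm_nonneg _)).trans h1
  linarith

/-- The zeta function. -/
def Zt (p : ℕ) (K : Type) [Field K] (t : ℝ) : ℝ := ∑' E : Eff K, t ^ edeg p E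

lemma Zt_hasSum (h : IsFF p K) {t : ℝ} (ht : 0 ≤ t) (ht1 : p * t < 1) :
    HasSum (fun n : ℕ => ((h.effs n).card : ℝ) * t ^ n) (Zt p K t) := by
  have h1 := (h.summable_eff ht ht1).hasSum.tsum_fiberwise (edeg p)
  have h2 : (fun n : ℕ => ((h.effs n).card : ℝ) * t ^ n) = fun n : ℕ =>
      ∑' E : (edeg p ⁻¹' {n} : Set (Eff K)), t ^ edeg p (E : Eff K) := by
    funext n
    have : (edeg p ⁻¹' {n} : Set (Eff K)) = (h.effs n : Set (Eff K)) := by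
      ext E; simp [h.mem_effs]
    rw [this]
    refine Eq.trans ?_ (Finset.tsum_subtype (h.effs n) (fun E => t ^ edeg p E)).symm
    rw [Finset.sum_congr rfl (g := fun _ => t ^ n) (fun E hE => by rw [h.mem_effs.mp hE]),
      Finset.sum_const, nsmul_eq_mul]
  rw [h2]
  exact h1

/-- Trivial character: simple pole. -/
lemma Zt_upper (h : IsFF p K) :
    ∃ C : ℝ, 0 < C ∧ ∀ t : ℝ, 0 ≤ t → p * t < 1 → Zt p K t ≤ C / (1 - p * t) := by
  obtain ⟨C, hC, hb⟩ := h.card_bound'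
  refine ⟨C, hC, fun t ht ht1 => ?_⟩
  rw [div_eq_mul_inv]
  refine hasSum_le (fun n => ?_) (h.Zt_hasSum ht ht1)
    ((hasSum_geometric_of_lt_one (by positivity : 0 ≤ p * t) ht1).mul_left C)
  rw [mul_pow, ← mul_assoc]
  exact mul_le_mul_of_nonneg_right (hb n) (by positivity)

lemma Zt_lower (h : IsFF p K) :
    ∃ c : ℝ, 0 < c ∧ ∀ t : ℝ, 1 / (2 * p) ≤ t → p * t < 1 → c / (1 - p * t) ≤ Zt p K t := by
  obtain ⟨c, n0, d, hc, hd, hb⟩ := h.card_lower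
  have hp : (2 : ℝ) ≤ p := by exact_mod_cast (Fact.out : p.Prime).two_le
  refine ⟨c * (1 / (2 * p)) ^ n0 / d, by positivity, fun t ht ht1 => ?_⟩
  have ht0 : 0 < t := lt_of_lt_of_le (by positivity) ht
  set u := p * t with hu
  have hu0 : 0 ≤ u := by positivity
  have hud : u ^ d < 1 := pow_lt_one₀ hu0 ht1 hd.ne'
  have hS := h.Zt_hasSum ht0.le ht1
  have hinj : Function.Injective fun k : ℕ => n0 + d * k := by
    intro a b hab
    simpa [hd.ne'] using hab
  have h1 : HasSum (fun k : ℕ => c * t ^ n0 * (u ^ d) ^ k) (c * t ^ n0 * (1 - u ^ d)⁻¹) :=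
    (hasSum_geometric_of_lt_one (by positivity) hud).mul_left _
  have h2 : c * t ^ n0 * (1 - u ^ d)⁻¹ ≤ Zt p K t := by
    refine hasSum_le_inj (fun k : ℕ => n0 + d * k) hinj (fun n _ => by positivity) (fun k => ?_) h1 hS
    have : c * t ^ n0 * (u ^ d) ^ k = (c * p ^ (d * k)) * t ^ (n0 + d * k) := by
      rw [hu, ← pow_mul, mul_pow, pow_add]; ring
    rw [this]
    exact mul_le_mul_of_nonneg_right (hb k) (by positivity)
  refine le_trans ?_ h2
  have h3 : 1 - u ^ d ≤ d * (1 - u) := by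
    have := one_add_mul_le_pow (a := u - 1) (by linarith) d
    have e : 1 + (u - 1) = u := by ring
    rw [e] at this
    nlinarith
  have h4 : (d * (1 - u))⁻¹ ≤ (1 - u ^ d)⁻¹ := inv_anti₀ (by linarith) h3
  have h5 : (1 / (2 * (p : ℝ))) ^ n0 ≤ t ^ n0 := by gcongr
  calc c * (1 / (2 * p)) ^ n0 / d / (1 - u) = c * (1 / (2 * p)) ^ n0 * (d * (1 - u))⁻¹ := by
        rw [mul_inv]; field_simp
    _ ≤ c * t ^ n0 * (1 - u ^ d)⁻¹ := by
        have : 0 ≤ (d * (1 - u))⁻¹ := inv_nonneg.mpr (by have : (0:ℝ) < d := by exact_mod_cast hd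
                                                         nlinarith)
        gcongr

lemma Zt_sq (h : IsFF p K) : ∃ C : ℝ, 0 < C ∧ ∀ t : ℝ, 0 ≤ t → p * t < 1 → Zt p K (t ^ 2) ≤ C := by
  obtain ⟨C, hC, hb⟩ := h.Zt_upper
  have hp : (2 : ℝ) ≤ p := by exact_mod_cast (Fact.out : p.Prime).two_le
  refine ⟨2 * C, by positivity, fun t ht ht1 => ?_⟩
  have h1 : p * t ^ 2 ≤ 1 / 2 := by nlinarith
  refine (hb (t ^ 2) (by positivity) (by linarith)).trans ?_
  rw [div_le_iff₀ (by linarith)]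
  nlinarith

end IsFF


section Euler

variable {ι : Type} {R : Type} [NormedField R] [CompleteSpace R]

open Classical in
/-- Partial Euler remainder. -/
def eulerRem (f : (ι →₀ ℕ) → R) (T : Finset ι) : R := ∑' E, if ∀ v ∈ T, E v = 0 then f E else 0

open Classical in
lemma euler_summable {f : (ι →₀ ℕ) → R} (hs : Summable fun E => ‖f E‖) (T : Finset ι) :
    Summable fun E : ι →₀ ℕ => if ∀ v ∈ T, E v = 0 then f E else 0 := by
  refine Summable.of_norm_bounded hs fun E => ?_
  split_ifs <;> simp

lemma euler_eq {f : (ι →₀ ℕ) → R} (hadd : ∀ E F, f (E + F) = f E * f F)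
    (hs : Summable fun E => ‖f E‖) (T : Finset ι) :
    (∑' E, f E) * ∏ v ∈ T, (1 - f (Finsupp.single v 1)) = eulerRem f T := by
  classical
  induction T using Finset.induction_on with
  | empty => simp [eulerRem]
  | insert w T hw ih =>
    rw [Finset.prod_insert hw, mul_comm (1 - _), ← mul_assoc, ih, eulerRem, eulerRem, mul_sub, mul_one,
      sub_eq_iff_eq_add, ← sub_eq_iff_eq_add', mul_comm, ← tsum_mul_left,
      ← (euler_summable hs T).tsum_sub (euler_summable hs (insert w T))]
    have hinj : Function.Injective fun E : ι →₀ ℕ => E + Finsupp.single w 1 :=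
      add_left_injective _
    rw [← hinj.tsum_eq]
    · refine tsum_congr fun E => ?_
      have h1 : (∀ v ∈ T, (E + Finsupp.single w 1 : ι →₀ ℕ) v = 0) ↔ ∀ v ∈ T, E v = 0 := by
        refine forall₂_congr fun v hv => ?_
        have : w ≠ v := fun h => hw (h ▸ hv)
        rw [Finsupp.add_apply, Finsupp.single_eq_of_ne this.symm, add_zero]
      have h2 : ¬ ∀ v ∈ insert w T, (E + Finsupp.single w 1 : ι →₀ ℕ) v = 0 := by
        intro h
        have := h w (Finset.mem_insert_self _ _)
        simp at this
      simp only [h1, if_neg h2, sub_zero]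
      split_ifs
      · rw [hadd, mul_comm]
      · simp
    · intro E hE
      rw [Function.mem_support] at hE
      by_cases hEw : E w = 0
      · exfalso
        apply hE
        have : (∀ v ∈ insert w T, E v = 0) ↔ ∀ v ∈ T, E v = 0 := by
          simp [Finset.forall_mem_insert, hEw]
        simp only [this, sub_self]
      · have : Finsupp.single w 1 ≤ E := Finsupp.single_le_iff.mpr (by omega)
        exact ⟨E - Finsupp.single w 1, tsub_add_cancel_of_le this⟩

lemma euler_tendsto {f : (ι →₀ ℕ) → R} (h0 : f 0 = 1)
    (hs : Summable fun E => ‖f E‖) :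
    Filter.Tendsto (eulerRem f) Filter.atTop (nhds 1) := by
  classical
  have h1 : (1 : R) = ∑' E : ι →₀ ℕ, if E = 0 then f E else 0 := by
    rw [tsum_eq_single 0 (fun E hE => by simp [hE])]
    simp [h0]
  rw [h1]
  refine tendsto_tsum_of_dominated_convergence hs (fun E => ?_) (Filter.Eventually.of_forall fun T E => ?_)
  · by_cases hE : E = 0
    · simp [hE]
    · simp only [if_neg hE]
      obtain ⟨v, hv⟩ : ∃ v, E v ≠ 0 := by
        by_contra hcon
        push Not at hcon
        exact hE (Finsupp.ext hcon)
      refine tendsto_const_nhds.congr' ?_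
      filter_upwards [Filter.eventually_ge_atTop ({v} : Finset ι)] with T hT
      rw [if_neg]
      intro h
      exact hv (h v (hT (Finset.mem_singleton_self v)))
  · split_ifs <;> simp

lemma euler_one_le {f : (ι →₀ ℕ) → ℝ} (h0 : f 0 = 1) (hnn : ∀ E, 0 ≤ f E)
    (hs : Summable f) (T : Finset ι) : 1 ≤ eulerRem f T := by
  classical
  have hs' : Summable fun E => ‖f E‖ := hs.norm
  have := (euler_summable hs' T).le_tsum 0 (fun E _ => by split_ifs; exacts [hnn E, le_rfl])
  rw [eulerRem]
  simpa [h0] using this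

end Euler

namespace IsFF

open Dvs

variable {p : ℕ} [Fact p.Prime] {K : Type} [Field K] [Algebra (ZMod p) K]

lemma Ls_euler (h : IsFF p K) {χ : AddChar (Dvs K) ℂ} (hχ : ∀ D, ‖χ D‖ = 1)
    {t : ℝ} (ht : 0 ≤ t) (ht1 : p * t < 1) :
    Filter.Tendsto (fun T : Finset (FFPrime K) => Ls p χ t *
      ∏ v ∈ T, (1 - χ (Finsupp.single v 1) * (t : ℂ) ^ v.dg p)) Filter.atTop (nhds 1) := by
  set f : Eff K → ℂ := fun E => χ (ofEff E) * (t : ℂ) ^ edeg p E with hf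
  have hs : Summable fun E => ‖f E‖ := (h.summable_term hχ ht ht1).norm
  have hadd : ∀ E F, f (E + F) = f E * f F := by
    intro E F
    simp only [hf, map_add, AddChar.map_add_eq_mul, pow_add]; ring
  have := euler_tendsto (f := f) (by simp [hf]) hs
  refine this.congr fun T => ?_
  rw [← euler_eq hadd hs T]
  congr 1
  refine Finset.prod_congr rfl fun v _ => ?_
  simp only [hf, ofEff_single, edeg_single, one_mul, Nat.cast_one]

lemma Zt_euler (h : IsFF p K) {t : ℝ} (ht : 0 ≤ t) (ht1 : p * t < 1) :
    Filter.Tendsto (fun T : Finset (FFPrime K) => Zt p K t *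
      ∏ v ∈ T, (1 - t ^ v.dg p)) Filter.atTop (nhds 1) ∧
    ∀ T : Finset (FFPrime K), 1 ≤ Zt p K t * ∏ v ∈ T, (1 - t ^ v.dg p) := by
  set f : Eff K → ℝ := fun E => t ^ edeg p E with hf
  have hs : Summable f := h.summable_eff ht ht1
  have hadd : ∀ E F, f (E + F) = f E * f F := by
    intro E F
    simp only [hf, map_add, pow_add]
  have hT : ∀ T : Finset (FFPrime K), eulerRem f T = Zt p K t * ∏ v ∈ T, (1 - t ^ v.dg p) := by
    intro T
    rw [← euler_eq hadd hs.norm T]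
    congr 1
    refine Finset.prod_congr rfl fun v _ => ?_
    simp only [hf, edeg_single, one_mul]
  refine ⟨(euler_tendsto (f := f) (by simp [hf]) hs.norm).congr hT, fun T => ?_⟩
  rw [← hT]
  exact euler_one_le (by simp [hf]) (fun E => by simp only [hf]; positivity) hs T

end IsFF


section Local

variable {q : ℕ}

lemma loc_one [NeZero q] (x : ℂ) :
    ∏ k : ZMod q, (1 - ZMod.stdAddChar k * x) = 1 - x ^ q := by
  classical
  have hprim : IsPrimitiveRoot (ZMod.stdAddChar (1 : ZMod q) : ℂ) q := by
    refine ⟨?_, fun l hl => ?_⟩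
    · rw [← AddChar.map_nsmul_eq_pow]
      simp
    · rw [← AddChar.map_nsmul_eq_pow, ← AddChar.map_zero_eq_one (ZMod.stdAddChar (N := q))] at hl
      have := ZMod.injective_stdAddChar hl
      rw [nsmul_one] at this
      exact (ZMod.natCast_eq_zero_iff l q).mp this
  have h1 := hprim.pow_sub_pow_eq_prod_sub_mul (x := (1 : ℂ)) (y := x) (NeZero.pos q)
  rw [one_pow] at h1
  rw [h1]
  refine Finset.prod_bij (fun k _ => (ZMod.stdAddChar k : ℂ)) ?_ ?_ ?_ ?_
  · intro k _
    rw [Polynomial.mem_nthRootsFinset (NeZero.pos q), ← AddChar.map_nsmul_eq_pow]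
    simp
  · intro a _ b _ hab
    exact ZMod.injective_stdAddChar hab
  · intro b hb
    rw [Polynomial.mem_nthRootsFinset (NeZero.pos q)] at hb
    obtain ⟨i, -, hi⟩ := hprim.eq_pow_of_pow_eq_one hb
    refine ⟨(i : ZMod q), Finset.mem_univ _, ?_⟩
    rw [← hi, ← AddChar.map_nsmul_eq_pow]
    simp
  · intro k _; rfl

lemma norm_char [NeZero q] (k : ZMod q) : ‖(ZMod.stdAddChar k : ℂ)‖ = 1 := by
  refine Complex.norm_eq_one_of_pow_eq_one (n := q) ?_ (NeZero.ne q)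
  rw [← AddChar.map_nsmul_eq_pow]
  simp

lemma loc_two [Fact q.Prime] {b c : ZMod q} (hbc : (b, c) ≠ 0) {x : ℝ} (hx0 : 0 ≤ x) (hx1 : x ≤ 1) :
    ‖∏ ij : ZMod q × ZMod q, (1 - (ZMod.stdAddChar (ij.1 * b + ij.2 * c) : ℂ) * x)‖ ≤ 1 := by
  have hone : ‖(1 - (x : ℂ) ^ q)‖ ≤ 1 := by
    have : (1 - (x : ℂ) ^ q) = ((1 - x ^ q : ℝ) : ℂ) := by push_cast; rfl
    rw [this, Complex.norm_real, Real.norm_eq_abs, abs_le]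
    have h1 : 0 ≤ x ^ q := by positivity
    have h2 : x ^ q ≤ 1 := pow_le_one₀ hx0 hx1
    constructor <;> linarith
  by_cases hb : b = 0
  · have hc : c ≠ 0 := fun hc => hbc (by rw [hb, hc]; rfl)
    rw [Fintype.prod_prod_type]
    have : ∀ i : ZMod q, ∏ j : ZMod q, (1 - (ZMod.stdAddChar (i * b + j * c) : ℂ) * x) =
        1 - (x : ℂ) ^ q := by
      intro i
      rw [← loc_one]
      exact Fintype.prod_equiv ((Equiv.mulRight₀ c hc).trans (Equiv.addLeft (i * b))) _ _
        (fun j => rfl)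
    simp only [this, Finset.prod_const, norm_pow]
    exact pow_le_one₀ (norm_nonneg _) hone
  · rw [Fintype.prod_prod_type_right]
    have : ∀ j : ZMod q, ∏ i : ZMod q, (1 - (ZMod.stdAddChar (i * b + j * c) : ℂ) * x) =
        1 - (x : ℂ) ^ q := by
      intro j
      rw [← loc_one]
      exact Fintype.prod_equiv ((Equiv.mulRight₀ b hb).trans (Equiv.addRight (j * c))) _ _
        (fun i => rfl)
    simp only [this, Finset.prod_const, norm_pow]
    exact pow_le_one₀ (norm_nonneg _) hone

end Local

namespace IsFF

open Dvs

variable {p : ℕ} [Fact p.Prime] {L : Type} [Field L] [Algebra (ZMod p) L]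
  {M : Type} [Field M] [Algebra (ZMod p) M]

/-- The characters. -/
def chr {q : ℕ} [NeZero q] (φ : Dvs L →+ ZMod q × ZMod q) (ij : ZMod q × ZMod q) :
    AddChar (Dvs L) ℂ :=
  (ZMod.stdAddChar (N := q)).compAddMonoidHom
    ((AddMonoidHom.mulLeft ij.1).comp ((AddMonoidHom.fst _ _).comp φ) +
      (AddMonoidHom.mulLeft ij.2).comp ((AddMonoidHom.snd _ _).comp φ))

lemma chr_apply {q : ℕ} [NeZero q] (φ : Dvs L →+ ZMod q × ZMod q) (ij : ZMod q × ZMod q) (D : Dvs L) :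
    chr φ ij D = ZMod.stdAddChar (ij.1 * (φ D).1 + ij.2 * (φ D).2) := rfl

lemma norm_Ls_le (h : IsFF p L) {χ : AddChar (Dvs L) ℂ} (hχ : ∀ D, ‖χ D‖ = 1)
    {t : ℝ} (ht : 0 ≤ t) (ht1 : p * t < 1) : ‖Ls p χ t‖ ≤ Zt p L t := by
  refine tsum_of_norm_bounded (h.summable_eff ht ht1).hasSum fun E => ?_
  rw [norm_mul, hχ, one_mul, norm_pow, Complex.norm_real, Real.norm_eq_abs, abs_of_nonneg ht]

lemma prod_Ls_le (h : IsFF p L) {q : ℕ} [Fact q.Prime] (φ : Dvs L →+ ZMod q × ZMod q)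
    (hsurj : Function.Surjective φ) (hpr : ∀ y : L, y ≠ 0 → φ (dv y) = 0) :
    ∃ C : ℝ, 0 < C ∧ ∀ t : ℝ, 0 ≤ t → p * t < 1 →
      ∏ ij : ZMod q × ZMod q, ‖Ls p (chr φ ij) t‖ ≤ C / (1 - p * t) := by
  classical
  have hχ : ∀ ij D, ‖chr φ ij D‖ = 1 := fun ij D => norm_char _
  have hpr' : ∀ ij, ∀ y : L, y ≠ 0 → chr φ ij (dv y) = 1 := by
    intro ij y hy
    rw [chr_apply, hpr y hy]; simp
  have hb : ∀ ij : ZMod q × ZMod q, ∃ C : ℝ, 0 < C ∧ (ij ≠ 0 → ∀ t : ℝ, 0 ≤ t → p * t < 1 →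
      ‖Ls p (chr φ ij) t‖ ≤ C) := by
    intro ij
    by_cases hij : ij = 0
    · exact ⟨1, one_pos, fun h => absurd hij h⟩
    obtain ⟨k, hk⟩ : ∃ k : ZMod q × ZMod q, ij.1 * k.1 + ij.2 * k.2 ≠ 0 := by
      by_cases h1 : ij.1 = 0
      · refine ⟨(0, 1), ?_⟩
        simpa using fun h2 => hij (Prod.ext h1 h2)
      · exact ⟨(1, 0), by simpa using h1⟩
    obtain ⟨D, hD⟩ := hsurj k
    obtain ⟨v⟩ := h.exists_pl
    have hdv := h.dg_pos v
    set A : Dvs L := D + q • Finsupp.single v ((deg p D).natAbs : ℤ) with hA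
    have hφA : φ A = k := by
      have h0 : ∀ y : ZMod q × ZMod q, q • y = 0 := fun y => by ext <;> simp
      rw [hA, map_add, map_nsmul, hD, h0, add_zero]
    have hdA : 0 ≤ deg p A := by
      rw [hA, map_add, map_nsmul, deg_single, nsmul_eq_mul]
      have h1 : 1 ≤ (q : ℤ) := by exact_mod_cast (Fact.out : q.Prime).one_lt.le
      have h2 : 1 ≤ (v.dg p : ℤ) := by exact_mod_cast hdv
      have h3 : -(((deg p D).natAbs : ℕ) : ℤ) ≤ deg p D := by omega
      have h4 : (0 : ℤ) ≤ ((deg p D).natAbs : ℕ) := by positivity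
      have h5 : (((deg p D).natAbs : ℕ) : ℤ) ≤ ((deg p D).natAbs : ℕ) * v.dg p := by nlinarith
      nlinarith
    obtain ⟨d, hd⟩ := Int.eq_ofNat_of_zero_le hdA
    obtain ⟨C, hC, hb⟩ := h.Ls_bound_nontriv (hχ ij) (hpr' ij) (A := A) (d := d) hd (by
      rw [chr_apply, hφA, ← AddChar.map_zero_eq_one (ZMod.stdAddChar (N := q))]
      exact fun h => hk (ZMod.injective_stdAddChar h))
    exact ⟨C, hC, fun _ => hb⟩
  choose C hC hCb using hb
  obtain ⟨C0, hC0, hb0⟩ := h.Zt_upper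
  refine ⟨C0 * ∏ ij ∈ Finset.univ.erase (0 : ZMod q × ZMod q), C ij,
    mul_pos hC0 (Finset.prod_pos fun ij _ => hC ij), fun t ht ht1 => ?_⟩
  rw [← Finset.mul_prod_erase _ _ (Finset.mem_univ (0 : ZMod q × ZMod q)), mul_div_right_comm]
  have h1 : ‖Ls p (chr φ 0) t‖ ≤ C0 / (1 - p * t) := (h.norm_Ls_le (hχ 0) ht ht1).trans (hb0 t ht ht1)
  refine mul_le_mul h1 (Finset.prod_le_prod (fun _ _ => norm_nonneg _) fun ij hij =>
    hCb ij (Finset.ne_of_mem_erase hij) t ht ht1) (Finset.prod_nonneg fun _ _ => norm_nonneg _) ?_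
  exact (norm_nonneg _).trans h1

theorem second_ineq (hL : IsFF p L) (hM : IsFF p M) {q : ℕ} [hq : Fact q.Prime]
    (fib : FFPrime L → Finset (FFPrime M)) (hcov : ∀ w, ∃ v, w ∈ fib v)
    (hdisj : ∀ v v', v ≠ v' → Disjoint (fib v) (fib v'))
    (φ : Dvs L →+ ZMod q × ZMod q) (hsurj : Function.Surjective φ)
    (hpr : ∀ y : L, y ≠ 0 → φ (dv y) = 0)
    (hfib : ∀ v, (φ (Finsupp.single v 1) = 0 ∧ (fib v).card = q ∧ ∀ w ∈ fib v, w.dg p = v.dg p) ∨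
      (∃ w, fib v = {w} ∧ w.dg p = q * v.dg p)) : False := by
  classical
  have hp : (2 : ℝ) ≤ p := by exact_mod_cast (Fact.out : p.Prime).two_le
  have hq2 : 2 ≤ q := (Fact.out : q.Prime).two_le
  obtain ⟨C1, hC1, hb1⟩ := hL.prod_Ls_le φ hsurj hpr
  obtain ⟨C2, hC2, hb2⟩ := hL.Zt_sq
  obtain ⟨c, hc, hbc⟩ := hM.Zt_lower
  -- main estimate
  have main : ∀ s : ℝ, 0 < s → s ≤ 1 / 2 → (c / s) ^ q * (s / (2 * C1)) ≤ (2 * C2) ^ q := by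
    intro s hs hs2
    set t : ℝ := (1 - s) / p with ht_def
    have hpt : p * t = 1 - s := by rw [ht_def]; field_simp
    have ht1 : p * t < 1 := by rw [hpt]; linarith
    have htl : 1 / (2 * p) ≤ t := by
      rw [ht_def, div_le_div_iff₀ (by positivity) (by positivity)]; nlinarith
    have ht0 : 0 < t := lt_of_lt_of_le (by positivity) htl
    have htlt : t < 1 := by nlinarith
    set x : FFPrime L → ℝ := fun v => t ^ v.dg p with hx
    have hx0 : ∀ v, 0 ≤ x v := fun v => by simp only [hx]; positivity
    have hx1 : ∀ v, x v < 1 := fun v => pow_lt_one₀ ht0.le htlt (hL.dg_pos v).ne'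
    have hχ : ∀ ij D, ‖chr φ ij D‖ = 1 := fun ij D => norm_char _
    have ev1 : ∀ᶠ T : Finset (FFPrime L) in Filter.atTop, (1 / 2 : ℝ) <
        ∏ ij : ZMod q × ZMod q, ‖Ls p (chr φ ij) t *
          ∏ v ∈ T, (1 - chr φ ij (Finsupp.single v 1) * (t : ℂ) ^ v.dg p)‖ := by
      have := tendsto_finset_prod (Finset.univ : Finset (ZMod q × ZMod q))
        (fun ij _ => (hL.Ls_euler (hχ ij) ht0.le ht1).norm)
      simp only [norm_one, Finset.prod_const_one] at this
      exact this.eventually (lt_mem_nhds (by norm_num))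
    have hbi : Filter.Tendsto (fun T : Finset (FFPrime L) => T.biUnion fib) Filter.atTop
        Filter.atTop := by
      rw [Filter.tendsto_atTop]
      intro U
      choose bel hbel using hcov
      filter_upwards [Filter.eventually_ge_atTop (U.image bel)] with T hT
      intro w hw
      exact Finset.mem_biUnion.mpr ⟨bel w, hT (Finset.mem_image_of_mem _ hw), hbel w⟩
    have ev2 : ∀ᶠ T : Finset (FFPrime L) in Filter.atTop,
        Zt p M t * ∏ w ∈ T.biUnion fib, (1 - t ^ w.dg p) < 2 :=
      hbi.eventually ((hM.Zt_euler ht0.le ht1).1.eventually (gt_mem_nhds (by norm_num)))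
    obtain ⟨T, hT1, hT2⟩ := (ev1.and ev2).exists
    set G : ℝ := ∏ v ∈ T, if φ (Finsupp.single v 1) = 0 then 1 - x v else 1 with hG
    have hG0 : 0 < G := Finset.prod_pos fun v _ => by
      split_ifs
      · linarith [hx1 v]
      · norm_num
    -- first estimate
    have e1 : 1 / 2 < C1 / s * G ^ (q * q) := by
      refine hT1.trans_le ?_
      simp only [norm_mul, Finset.prod_mul_distrib]
      have h1 := hb1 t ht0.le ht1
      rw [hpt, sub_sub_cancel] at h1
      refine mul_le_mul h1 ?_ (Finset.prod_nonneg fun _ _ => norm_nonneg _) (by positivity)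
      simp only [norm_prod]
      rw [Finset.prod_comm, hG, ← Finset.prod_pow]
      refine Finset.prod_le_prod (fun v _ => Finset.prod_nonneg fun _ _ => norm_nonneg _) fun v _ => ?_
      have e : ((t : ℂ) ^ v.dg p) = ((x v : ℝ) : ℂ) := by simp [hx]
      simp only [e, chr_apply]
      split_ifs with hv
      · simp only [hv, Prod.fst_zero, Prod.snd_zero, mul_zero, add_zero, AddChar.map_zero_eq_one,
          one_mul, Finset.prod_const, Finset.card_univ, Fintype.card_prod, ZMod.card]
        have : (1 - ((x v : ℝ) : ℂ)) = ((1 - x v : ℝ) : ℂ) := by push_cast; rfl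
        rw [this, Complex.norm_real, Real.norm_eq_abs, abs_of_nonneg (by linarith [hx1 v])]
      · rw [one_pow, ← norm_prod]
        exact loc_two (b := (φ (Finsupp.single v 1)).1) (c := (φ (Finsupp.single v 1)).2) hv
          (hx0 v) (hx1 v).le
    -- second estimate
    have e2 : c / s * G ^ q ≤ 2 * C2 := by
      have hZ := hbc t htl ht1
      rw [hpt, sub_sub_cancel] at hZ
      have hsq := hb2 t ht0.le ht1
      set Q : ℝ := ∏ v ∈ T, (1 - (t ^ 2) ^ v.dg p) with hQ
      have hQ1 : 1 ≤ Zt p L (t ^ 2) * Q := (hL.Zt_euler (t := t ^ 2) (by positivity) (by nlinarith)).2 T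
      have hxx : ∀ v : FFPrime L, (t ^ 2) ^ v.dg p = x v ^ 2 := fun v => by
        simp only [hx]; rw [← pow_mul, ← pow_mul, mul_comm]
      have hQ0 : 0 < Q := Finset.prod_pos fun v _ => by
        rw [hxx]; nlinarith [hx0 v, hx1 v]
      have hGQ : G ^ q * Q ≤ ∏ w ∈ T.biUnion fib, (1 - t ^ w.dg p) := by
        rw [Finset.prod_biUnion (fun v _ v' _ hvv => hdisj v v' hvv), hG, ← Finset.prod_pow, hQ,
          ← Finset.prod_mul_distrib]
        refine Finset.prod_le_prod (fun v _ => ?_) fun v _ => ?_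
        · refine mul_nonneg (pow_nonneg ?_ _) ?_
          · split_ifs
            · linarith [hx1 v]
            · norm_num
          · rw [hxx]; nlinarith [hx0 v, hx1 v]
        · rw [hxx]
          have hsq0 : 0 ≤ 1 - x v ^ 2 := by nlinarith [hx0 v, hx1 v]
          rcases hfib v with ⟨h1, h2, h3⟩ | ⟨w, hw, hwd⟩
          · rw [if_pos h1, Finset.prod_congr rfl (g := fun _ => 1 - x v) (fun w hw => by rw [h3 w hw]),
              Finset.prod_const, h2]
            have : 0 ≤ (1 - x v) ^ q := pow_nonneg (by linarith [hx1 v]) _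
            nlinarith [sq_nonneg (x v)]
          · rw [hw, Finset.prod_singleton, hwd]
            have h4 : t ^ (q * v.dg p) = x v ^ q := by simp only [hx]; rw [← pow_mul, mul_comm]
            rw [h4]
            have h5 : x v ^ q ≤ x v ^ 2 := pow_le_pow_of_le_one (hx0 v) (hx1 v).le hq2
            have h6 : (if φ (Finsupp.single v 1) = 0 then 1 - x v else 1) ^ q ≤ 1 := by
              apply pow_le_one₀
              · split_ifs
                · linarith [hx1 v]
                · norm_num
              · split_ifs
                · linarith [hx0 v]
                · norm_num
            nlinarith
      have hGq : 0 < G ^ q := by positivity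
      have hcs : 0 < c / s := by positivity
      have h7 : c / s * (G ^ q * Q) ≤ 2 := by
        refine le_trans ?_ hT2.le
        exact mul_le_mul hZ hGQ (by positivity) (hcs.le.trans hZ)
      have h8 : 1 ≤ C2 * Q := hQ1.trans (mul_le_mul_of_nonneg_right hsq hQ0.le)
      have h9 : (c / s * G ^ q) * Q ≤ (2 * C2) * Q := by nlinarith
      exact le_of_mul_le_mul_right h9 hQ0
    have e3 : (c / s) ^ q * G ^ (q * q) ≤ (2 * C2) ^ q := by
      rw [pow_mul, ← mul_pow]
      exact pow_le_pow_left₀ (by positivity) e2 q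
    refine le_trans ?_ e3
    refine mul_le_mul_of_nonneg_left ?_ (by positivity)
    rw [div_le_iff₀ (by positivity)]
    have : C1 / s * G ^ (q * q) * s = C1 * G ^ (q * q) := by field_simp
    nlinarith
  set B : ℝ := (2 * C2) ^ q * (2 * C1) / c ^ q with hB
  have hB0 : 0 < B := by positivity
  have hs0 : 0 < 1 / (B + 3) := by positivity
  have hs2 : 1 / (B + 3) ≤ 1 / 2 := by
    rw [div_le_div_iff₀ (by positivity) (by norm_num)]; linarith
  have h1 := main (1 / (B + 3)) hs0 hs2
  obtain ⟨s, hs⟩ : ∃ s, s = 1 / (B + 3) := ⟨_, rfl⟩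
  rw [← hs] at h1 hs0 hs2
  have h2 : (1 / s) ^ q * s ≤ B := by
    rw [hB, le_div_iff₀ (by positivity)]
    have : (1 / s) ^ q * s * c ^ q = (c / s) ^ q * (s / (2 * C1)) * (2 * C1) := by
      rw [div_pow, div_pow, one_pow]; field_simp
    rw [this]
    exact mul_le_mul_of_nonneg_right h1 (by positivity)
  have h3 : 1 / s = B + 3 := by rw [hs, one_div_one_div]
  have h4 : (1 / s) ^ 2 ≤ (1 / s) ^ q := pow_le_pow_right₀ (by rw [h3]; linarith) hq2
  have h5 : (1 / s) ^ 2 * s = 1 / s := by field_simp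
  have h6 : (1 / s) ^ 2 * s ≤ (1 / s) ^ q * s := mul_le_mul_of_nonneg_right h4 hs0.le
  linarith

end IsFF


section Herbrand

open AddSubgroup

lemma herbrand_fin {A : Type*} [AddCommGroup A] (d n : A →+ A) (hdn : ∀ a, d (n a) = 0)
    (hnd : ∀ a, n (d a) = 0) (F K : AddSubgroup A) (hFK : F ≤ K) (hfin : F.relIndex K ≠ 0)
    (hdK : K.map d ≤ K) (hnK : K.map n ≤ K) (hdF : F.map d ≤ F) (hnF : F.map n ≤ F) :
    (F ⊔ K.map n).relIndex (K ⊓ F.comap d) = (F ⊔ K.map d).relIndex (K ⊓ F.comap n) := by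
  have key : ∀ (d n : A →+ A), (∀ a, d (n a) = 0) → K.map d ≤ K → K.map n ≤ K → F.map d ≤ F →
      F.map n ≤ F →
      F.relIndex (F ⊔ K.map n) * (F ⊔ K.map n).relIndex (K ⊓ F.comap d) *
        F.relIndex (F ⊔ K.map d) = F.relIndex K := by
    intro d n hdn hdK hnK hdF hnF
    have h1 : F ⊔ K.map n ≤ K ⊓ F.comap d := by
      refine le_inf (sup_le hFK hnK) (sup_le (map_le_iff_le_comap.1 hdF) ?_)
      rintro _ ⟨x, hx, rfl⟩
      simp [hdn]
    rw [relIndex_mul_relIndex _ _ _ le_sup_left h1]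
    have h2 : F.relIndex (F ⊔ K.map d) = (K ⊓ F.comap d).relIndex K := by
      rw [inf_relIndex_left, relIndex_comap, sup_comm, relIndex_sup_right]
    rw [h2, relIndex_mul_relIndex _ _ _ (le_sup_left.trans h1) inf_le_left]
  have e1 := key d n hdn hdK hnK hdF hnF
  have e2 := key n d hnd hnK hdK hnF hdF
  have n1 : F.relIndex (F ⊔ K.map n) ≠ 0 := by
    intro h; rw [h] at e1; simp at e1; exact hfin e1.symm
  have n2 : F.relIndex (F ⊔ K.map d) ≠ 0 := by
    intro h; rw [h] at e1; simp at e1; exact hfin e1.symm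
  rw [← e2] at e1
  have : (F.relIndex (F ⊔ K.map n) * F.relIndex (F ⊔ K.map d)) *
      (F ⊔ K.map n).relIndex (K ⊓ F.comap d) =
      (F.relIndex (F ⊔ K.map n) * F.relIndex (F ⊔ K.map d)) *
      (F ⊔ K.map d).relIndex (K ⊓ F.comap n) := by linarith
  exact Nat.eq_of_mul_eq_mul_left (Nat.pos_of_ne_zero (mul_ne_zero n1 n2)) this

lemma relIndex_congr_on {B : Type*} [AddCommGroup B] (S S' T : AddSubgroup B)
    (h : ∀ t ∈ T, t ∈ S ↔ t ∈ S') : S.relIndex T = S'.relIndex T := by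
  rw [← inf_relIndex_right S, ← inf_relIndex_right S']
  congr 1
  ext t
  simp only [mem_inf]
  constructor
  · rintro ⟨h1, h2⟩; exact ⟨(h t h2).1 h1, h2⟩
  · rintro ⟨h1, h2⟩; exact ⟨(h t h2).2 h1, h2⟩

theorem herbrand_main {A D : Type*} [AddCommGroup A] [AddCommGroup D] (f : A →+ D)
    (dA nA : A →+ A) (dD nD : D →+ D)
    (hfd : ∀ a, f (dA a) = dD (f a)) (hfn : ∀ a, f (nA a) = nD (f a))
    (hdnA : ∀ a, dA (nA a) = 0) (hndA : ∀ a, nA (dA a) = 0)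
    (hdnD : ∀ a, dD (nD a) = 0) (hndD : ∀ a, nD (dD a) = 0)
    (hK : Finite f.ker) (hC : f.range.index ≠ 0)
    (hA : ∀ a, nA a = 0 → ∃ b, dA b = a)
    (hD0 : ∀ d, dD d = 0 → ∃ a e, dA a = 0 ∧ d = f a + nD e)
    (x : A) (hx : dA x = 0) (e : D) (hxe : f x = nD e) : ∃ y, nA y = x := by
  have HC := herbrand_fin dD nD hdnD hndD f.range ⊤ le_top (by simpa using hC) le_top le_top
    (by rintro _ ⟨_, ⟨a, rfl⟩, rfl⟩; exact ⟨dA a, hfd a⟩)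
    (by rintro _ ⟨_, ⟨a, rfl⟩, rfl⟩; exact ⟨nA a, hfn a⟩)
  have HK := herbrand_fin dA nA hdnA hndA ⊥ f.ker bot_le
    (by rw [relIndex_bot_left]; exact Nat.card_pos.ne')
    (by rintro _ ⟨a, ha, rfl⟩
        have ha' : f a = 0 := ha
        show f _ = 0
        rw [hfd, ha', map_zero])
    (by rintro _ ⟨a, ha, rfl⟩
        have ha' : f a = 0 := ha
        show f _ = 0
        rw [hfn, ha', map_zero]) (by simp) (by simp)
  simp only [bot_sup_eq, top_inf_eq] at HC HK
  -- P
  let P : AddSubgroup A := dD.range.comap f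
  let Q : AddSubgroup A := nD.range.comap f
  have hfinK : ∀ S : AddSubgroup A, S.relIndex f.ker ≠ 0 := fun S h => by
    have := relIndex_dvd_card S f.ker
    rw [h] at this
    exact Nat.card_pos.ne' (Nat.eq_zero_of_zero_dvd this)
  -- step i
  have i1 : (f.range ⊔ (⊤ : AddSubgroup D).map nD).relIndex (f.range.comap dD) =
      (f.ker.map nA).relIndex (P.map nA) := by
    have b1 : (f.range ⊔ (⊤ : AddSubgroup D).map nD).relIndex (f.range.comap dD) =
        ((dA.range.map f).comap dD).relIndex (f.range.comap dD) := by
      apply relIndex_congr_on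
      intro t ht
      constructor
      · intro h
        obtain ⟨_, ⟨a, rfl⟩, _, ⟨b, -, rfl⟩, rfl⟩ := mem_sup.1 h
        exact ⟨dA a, ⟨a, rfl⟩, by rw [map_add, hdnD, add_zero, hfd]⟩
      · rintro ⟨_, ⟨b, rfl⟩, hb⟩
        obtain ⟨a, c, ha, hc⟩ := hD0 (t - f b) (by rw [map_sub, ← hfd, hb, sub_self])
        refine mem_sup.2 ⟨f (a + b), ⟨_, rfl⟩, nD c, ⟨c, trivial, rfl⟩, ?_⟩
        rw [map_add, sub_eq_iff_eq_add.1 hc]; abel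
    have b2 : (f.range.comap dD).map dD = P.map f := by
      ext t
      constructor
      · rintro ⟨d, ⟨a, ha⟩, rfl⟩
        exact ⟨a, ⟨d, ha.symm⟩, ha⟩
      · rintro ⟨a, ⟨d, hd⟩, rfl⟩
        exact ⟨d, ⟨a, hd.symm⟩, hd⟩
    have b3 : ((dA.range.map f).comap f).relIndex P = ((f.ker.map nA).comap nA).relIndex P := by
      apply relIndex_congr_on
      intro t ht
      constructor
      · rintro ⟨_, ⟨b, rfl⟩, hb⟩
        refine ⟨t - dA b, ?_, ?_⟩
        · show f _ = 0
          rw [map_sub, hb, sub_self]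
        · rw [map_sub, hndA, sub_zero]
      · rintro ⟨k, hk, hkt⟩
        obtain ⟨b, hb⟩ := hA (t - k) (by rw [map_sub, hkt, sub_self])
        refine ⟨dA b, ⟨b, rfl⟩, ?_⟩
        have hk' : f k = 0 := hk
        rw [hb, map_sub, hk', sub_zero]
    rw [b1, relIndex_comap, b2, ← relIndex_comap, b3, relIndex_comap]
  have NP : P.map nA ≤ f.ker ⊓ comap dA ⊥ := by
    rintro _ ⟨a, ⟨d, hd⟩, rfl⟩
    refine ⟨?_, by simp [hdnA]⟩
    show f _ = 0
    rw [hfn, ← hd, hndD]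
  have KP : f.ker.map nA ≤ P.map nA := by
    refine map_mono ?_
    intro k hk
    exact ⟨0, by rw [map_zero]; exact hk.symm⟩
  have i2 := relIndex_mul_relIndex _ _ _ KP NP
  -- step ii
  have j1 : (f.ker.map dA).relIndex (f.ker ⊓ comap nA ⊥) =
      (((dA.ker).map f).comap nD).relIndex (f.range.comap nD) := by
    have c1 : f.ker ⊓ comap nA ⊥ = Q.map dA := by
      ext k
      constructor
      · rintro ⟨hk, hk2⟩
        obtain ⟨a, rfl⟩ := hA k hk2
        obtain ⟨a', c, ha', hc⟩ := hD0 (f a) (by rw [← hfd]; exact hk)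
        refine ⟨a - a', ⟨c, ?_⟩, ?_⟩
        · rw [map_sub, hc]; abel
        · rw [map_sub, ha', sub_zero]
      · rintro ⟨a, ⟨c, hc⟩, rfl⟩
        refine ⟨?_, by simp [hndA]⟩
        show f _ = 0
        rw [hfd, ← hc, hdnD]
    have c2 : (f.range.comap nD).map nD = Q.map f := by
      ext t
      constructor
      · rintro ⟨d, ⟨a, ha⟩, rfl⟩
        exact ⟨a, ⟨d, ha.symm⟩, ha⟩
      · rintro ⟨a, ⟨d, hd⟩, rfl⟩
        exact ⟨d, ⟨a, hd.symm⟩, hd⟩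
    have c3 : (f.ker.map dA).comap dA = (dA.ker.map f).comap f := by
      ext t
      constructor
      · rintro ⟨k, hk, hkt⟩
        refine ⟨t - k, ?_, ?_⟩
        · show dA _ = 0
          rw [map_sub, hkt, sub_self]
        · have hk' : f k = 0 := hk
          rw [map_sub, hk', sub_zero]
      · rintro ⟨k, hk, hkt⟩
        refine ⟨t - k, ?_, ?_⟩
        · show f _ = 0
          rw [map_sub, hkt, sub_self]
        · have hk' : dA k = 0 := hk
          rw [map_sub, hk', sub_zero]
    rw [c1, ← relIndex_comap, c3, relIndex_comap, ← c2, relIndex_comap]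
  have hW : f.range ⊔ (⊤ : AddSubgroup D).map dD ≤
      ((dA.ker).map f).comap nD ⊓ (f.range.comap nD) := by
    apply sup_le
    · rintro _ ⟨a, rfl⟩
      exact ⟨⟨nA a, hdnA a, hfn a⟩, ⟨nA a, hfn a⟩⟩
    · rintro _ ⟨d, -, rfl⟩
      refine ⟨⟨0, map_zero _, ?_⟩, ⟨0, ?_⟩⟩ <;> rw [map_zero, hndD]
  have j2 := relIndex_mul_relIndex _ _ _ hW inf_le_right
  rw [inf_relIndex_right] at j2
  rw [← j1] at j2
  rw [i1] at HC
  -- now compare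
  have hne : ∀ S T : AddSubgroup A, T ≤ f.ker → S.relIndex T ≠ 0 := fun S T hT h =>
    hfinK S (relIndex_eq_zero_of_le_right hT h)
  have hs : (f.ker.map nA).relIndex (P.map nA) ≠ 0 := hne _ _ (NP.trans inf_le_left)
  rw [← HK, ← HC, ← i2] at j2
  have j3 : (f.ker.map nA).relIndex (P.map nA) *
      ((f.range ⊔ AddSubgroup.map dD ⊤).relIndex
        (comap nD (AddSubgroup.map f dA.ker) ⊓ comap nD f.range) *
      (AddSubgroup.map nA P).relIndex (f.ker ⊓ comap dA ⊥)) =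
      (f.ker.map nA).relIndex (P.map nA) * 1 := by linarith
  have j4 := Nat.eq_of_mul_eq_mul_left (Nat.pos_of_ne_zero hs) j3
  have k1 := relIndex_eq_one.1 (Nat.eq_one_of_mul_eq_one_right j4)
  have k2 := relIndex_eq_one.1 (Nat.eq_one_of_mul_eq_one_left j4)
  obtain ⟨_, ⟨a, rfl⟩, _, ⟨d', -, rfl⟩, hd⟩ := mem_sup.1
    (k1 (⟨⟨x, hx, hxe⟩, ⟨x, hxe⟩⟩ : e ∈ comap nD (AddSubgroup.map f dA.ker) ⊓ comap nD f.range))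
  obtain ⟨b, -, hb⟩ := k2 (show x - nA a ∈ f.ker ⊓ comap dA ⊥ from ⟨by
    show f _ = 0
    rw [map_sub, hfn, hxe, ← hd, map_add, hndD, add_zero, sub_self], by
    show dA _ = 0
    rw [map_sub, hx, hdnA, sub_zero]⟩)
  exact ⟨a + b, by rw [map_add, hb]; abel⟩

end Herbrand


section IsFFConstr

variable {p : ℕ} [Fact p.Prime]

open IntermediateField in
lemma IsFF.of_trdeg {K : Type} [Field K] [Algebra (ZMod p) K] [Algebra.EssFiniteType (ZMod p) K]
    (h : Algebra.trdeg (ZMod p) K = 1) : IsFF p K where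
  ex := by
    have h1 : ¬ Algebra.IsAlgebraic (ZMod p) K := by
      intro h2
      rw [trdeg_eq_zero_iff.2 h2] at h
      exact zero_ne_one h
    by_contra! h2
    exact h1 ⟨fun x => by_contra fun hx => h2 x hx⟩
  fin := by
    intro y hy
    have hi : AlgebraicIndependent (ZMod p) (fun _ : Unit => y) :=
      (algebraicIndependent_unique_type_iff).2 hy
    have hb := hi.isTranscendenceBasis_of_trdeg_le_of_finite (by rw [h]; simp)
    have halg := hb.isAlgebraic_field
    rw [Set.range_const] at halg
    haveI : Algebra.EssFiniteType (adjoin (ZMod p) {y}) K :=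
      Algebra.EssFiniteType.of_comp (ZMod p) _ _
    obtain ⟨S, hS⟩ := fg_top (adjoin (ZMod p) {y}) K
    have := finiteDimensional_adjoin (K := adjoin (ZMod p) {y}) (S := (S : Set K))
      (fun x _ => (Algebra.IsAlgebraic.isAlgebraic x).isIntegral)
    rw [hS] at this
    exact Module.Finite.equiv (IntermediateField.topEquiv.toLinearEquiv)

lemma trdeg_step {F L M : Type} [Field F] [Field L] [Field M] [Algebra F L] [Algebra F M]
    [Algebra L M] [IsScalarTower F L M] [FiniteDimensional L M]
    (h : Algebra.trdeg F L = 1) : Algebra.trdeg F M = 1 := by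
  rw [← trdeg_add_eq F L, h, trdeg_eq_zero_iff.2 inferInstance, add_zero]

lemma trdeg_ratFunc : Algebra.trdeg (ZMod p) (RatFunc (ZMod p)) = 1 := by
  have h : Algebra.trdeg (ZMod p)[X] (RatFunc (ZMod p)) = 0 :=
    trdeg_eq_zero_iff.2 (IsLocalization.isAlgebraic _ (nonZeroDivisors _))
  rw [← trdeg_add_eq (ZMod p) (ZMod p)[X], h, add_zero]
  simp

lemma ess_ratFunc : Algebra.EssFiniteType (ZMod p) (RatFunc (ZMod p)) :=
  haveI : Algebra.EssFiniteType (ZMod p)[X] (RatFunc (ZMod p)) :=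
    Algebra.EssFiniteType.of_isLocalization _ (nonZeroDivisors _)
  Algebra.EssFiniteType.comp (ZMod p) (ZMod p)[X] (RatFunc (ZMod p))

lemma isFF_tower (L M : Type) [Field L] [Field M] [Algebra (RatFunc (ZMod p)) L]
    [FiniteDimensional (RatFunc (ZMod p)) L] [Algebra L M] [FiniteDimensional L M]
    [Algebra (ZMod p) L] [Algebra (ZMod p) M] [IsScalarTower (ZMod p) (RatFunc (ZMod p)) L] 
    [IsScalarTower (ZMod p) L M] : IsFF p L ∧ IsFF p M := by
  have h1 := trdeg_step (F := ZMod p) (M := L) (trdeg_ratFunc (p := p))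
  have h2 := trdeg_step (F := ZMod p) (M := M) h1
  haveI := ess_ratFunc (p := p)
  haveI : Algebra.EssFiniteType (ZMod p) L := .comp (ZMod p) (RatFunc (ZMod p)) L
  haveI : Algebra.EssFiniteType (ZMod p) M := .comp (ZMod p) L M
  exact ⟨IsFF.of_trdeg h1, IsFF.of_trdeg h2⟩

/-- degrees multiply. -/
lemma degOver_algebraMap (L M : Type) [Field L] [Field M] [Algebra L M] 
    [Algebra (ZMod p) L] [Algebra (ZMod p) M] [IsScalarTower (ZMod p) L M] (x : L) :
    degOver p (algebraMap L M x) = degOver p x * Module.finrank L M := by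
  unfold degOver
  have key : Module.finrank (IntermediateField.adjoin (ZMod p) {algebraMap L M x}) M =
      Module.finrank (IntermediateField.adjoin (ZMod p) {x}) M := by
    let e1 : IntermediateField.adjoin (ZMod p) {x} ≃ₐ[ZMod p] 
        (IntermediateField.adjoin (ZMod p) {x}).map (IsScalarTower.toAlgHom (ZMod p) L M) :=
      IntermediateField.equivMap _ _
    have e2 : (IntermediateField.adjoin (ZMod p) {x}).map (IsScalarTower.toAlgHom (ZMod p) L M)
      = IntermediateField.adjoin (ZMod p) {algebraMap L M x} := by
      rw [IntermediateField.adjoin_map]; simp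
    let e := e1.trans (IntermediateField.equivOfEq e2)
    exact (Algebra.finrank_eq_of_equiv_equiv e.toRingEquiv (RingEquiv.refl M) (by
      ext t; rfl)).symm
  rw [key, Module.finrank_mul_finrank]

end IsFFConstr


section Below

variable {L M : Type} [Field L] [Field M] [Algebra L M]

/-- `w` lies over `v` with index `e`. -/
def Ovr (w : FFPrime M) (v : FFPrime L) (e : ℕ) : Prop :=
  0 < e ∧ ∀ x : L, w.o (algebraMap L M x) = e * v.o x

lemma Ovr.unique {w : FFPrime M} {v v' : FFPrime L} {e e' : ℕ} (h : Ovr w v e)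
    (h' : Ovr w v' e') : v = v' ∧ e = e' := by
  obtain ⟨x, hx, hx1⟩ := v.o_surj 1
  obtain ⟨y, hy, hy1⟩ := v'.o_surj 1
  have e1 := h.2 x
  have e2 := h'.2 x
  have e3 := h.2 y
  have e4 := h'.2 y
  rw [e1, hx1, mul_one] at e2
  rw [e3, hy1, mul_one] at e4
  have d1 : (e' : ℤ) ∣ e := ⟨_, e2⟩
  have d2 : (e : ℤ) ∣ e' := ⟨_, e4.symm⟩
  have he : e = e' := Nat.dvd_antisymm (Int.natCast_dvd_natCast.1 d2) (Int.natCast_dvd_natCast.1 d1)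
  subst he
  refine ⟨FFPrime.ext_o fun t _ => ?_, rfl⟩
  have := (h.2 t).symm.trans (h'.2 t)
  exact mul_left_cancel₀ (by have := h.1; positivity) this

lemma exists_ovr [FiniteDimensional L M] (w : FFPrime M) : ∃ (v : FFPrime L) (e : ℕ), Ovr w v e := by
  let H : AddSubgroup ℤ :=
    { carrier := {n | ∃ x : L, x ≠ 0 ∧ w.o (algebraMap L M x) = n}
      zero_mem' := ⟨1, one_ne_zero, by simp [FFPrime.o_one]⟩
      add_mem' := by
        rintro a b ⟨x, hx, rfl⟩ ⟨y, hy, rfl⟩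
        exact ⟨x * y, mul_ne_zero hx hy, by rw [map_mul, FFPrime.o_mul _ (by simpa) (by simpa)]⟩
      neg_mem' := by
        rintro a ⟨x, hx, rfl⟩
        exact ⟨x⁻¹, inv_ne_zero hx, by rw [map_inv₀, FFPrime.o_inv]⟩ }
  obtain ⟨c, hc⟩ := Int.subgroup_cyclic H
  have hmem : ∀ n : ℤ, n ∈ H ↔ ∃ k : ℤ, n = k * c := by
    intro n
    rw [hc, AddSubgroup.mem_closure_singleton]
    simp [eq_comm]
  have hc0 : c ≠ 0 := by
    rintro rfl
    have hz : ∀ x : L, w.o (algebraMap L M x) = 0 := by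
      intro x
      by_cases hx : x = 0
      · simp [hx, FFPrime.o_zero]
      · obtain ⟨k, hk⟩ := (hmem _).1 (⟨x, hx, rfl⟩ : w.o (algebraMap L M x) ∈ H)
        simpa using hk
    obtain ⟨y, hy, hy1⟩ := w.o_surj (-1)
    have hintg : IsIntegral L y := Algebra.IsIntegral.isIntegral y
    have hm := minpoly.monic hintg
    have h0 := minpoly.aeval L y
    obtain ⟨n, hn⟩ : ∃ n, n = (minpoly L y).natDegree := ⟨_, rfl⟩
    have hnpos : 0 < n := hn ▸ minpoly.natDegree_pos hintg
    rw [Polynomial.aeval_eq_sum_range, Finset.sum_range_succ, ← hn] at h0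
    have hlead : (minpoly L y).coeff n = 1 := by rw [hn]; exact hm
    rw [hlead, one_smul, add_comm] at h0
    have h1 : y ^ n = - ∑ x ∈ Finset.range n, (minpoly L y).coeff x • y ^ x :=
      eq_neg_of_add_eq_zero_left h0
    have h2 : y ^ n ∈ w.V (-(n - 1 : ℤ)) := by
      rw [h1]
      refine neg_mem (sum_mem fun i hi => ?_)
      rw [Algebra.smul_def]
      have := Finset.mem_range.1 hi
      have a1 : algebraMap L M ((minpoly L y).coeff i) ∈ w.V 0 := by
        rw [FFPrime.mem_V]; right; rw [hz]
      have a2 : y ^ i ∈ w.V (-(n - 1 : ℤ)) := by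
        rw [FFPrime.mem_V]; right; rw [FFPrime.o_pow, hy1]; omega
      simpa using FFPrime.mul_mem_V a1 a2
    rw [FFPrime.mem_V_of_ne (pow_ne_zero _ hy), FFPrime.o_pow, hy1] at h2
    omega
  have hdvd : ∀ x : L, ∃ k : ℤ, w.o (algebraMap L M x) = k * (c.natAbs : ℤ) := by
    intro x
    by_cases hx : x = 0
    · exact ⟨0, by simp [hx, FFPrime.o_zero]⟩
    · obtain ⟨k, hk⟩ := (hmem _).1 (⟨x, hx, rfl⟩ : w.o (algebraMap L M x) ∈ H)
      have : (c.natAbs : ℤ) ∣ w.o (algebraMap L M x) := by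
        rw [Int.natAbs_dvd, hk]; exact ⟨k, mul_comm _ _⟩
      obtain ⟨k', hk'⟩ := this
      exact ⟨k', by rw [hk', mul_comm]⟩
  choose f hf using hdvd
  have hcpos : (0 : ℤ) < (c.natAbs : ℤ) := by positivity
  refine ⟨FFPrime.ofO f ?_ ?_ ?_, c.natAbs, by positivity, ?_⟩
  · intro x y hx hy
    have := w.o_mul (x := algebraMap L M x) (y := algebraMap L M y) (by simpa) (by simpa)
    rw [← map_mul, hf, hf, hf, ← add_mul] at this
    exact mul_right_cancel₀ hcpos.ne' this
  · intro x y hx hy hxy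
    have := w.o_add (x := algebraMap L M x) (y := algebraMap L M y) (by simpa) (by simpa)
      (by rw [← map_add]; exact (_root_.map_ne_zero _).2 hxy)
    rw [← map_add, hf, hf, hf, ← min_mul_of_nonneg _ _ hcpos.le] at this
    exact le_of_mul_le_mul_right this hcpos
  · intro n
    have : n * (c.natAbs : ℤ) ∈ H := by
      rw [hmem]
      rcases Int.natAbs_eq c with h | h
      · exact ⟨n, by rw [← h]⟩
      · exact ⟨-n, by rw [neg_mul, ← mul_neg]; congr 1; omega⟩
    obtain ⟨x, hx, hx'⟩ := this
    exact ⟨x, hx, mul_right_cancel₀ hcpos.ne' ((hf x).symm.trans hx')⟩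
  · intro x
    by_cases hx : x = 0
    · simp [hx, FFPrime.o_zero]
    · rw [FFPrime.ofO_o _ _ _ _ hx, hf, mul_comm]

lemma Ovr.nrm_le {p : ℕ} [Fact p.Prime] [Algebra (ZMod p) M] (hM : IsFF p M)
    {w : FFPrime M} {v : FFPrime L} {e : ℕ} (h : Ovr w v e) :
    v.nrm ≤ w.nrm := by
  have h1 : (w.V 1).comap (algebraMap L M).toAddMonoidHom = v.V 1 := by
    ext x
    by_cases hx : x = 0
    · simp [hx]
    · have he := h.1
      show algebraMap L M x ∈ w.V 1 ↔ _
      rw [FFPrime.mem_V_of_ne hx, FFPrime.mem_V_of_ne (by simpa), h.2]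
      constructor
      · intro h1; by_contra h2
        nlinarith [show v.o x ≤ 0 by omega]
      · intro h1; nlinarith
  have h0 : (v.V 0).map (algebraMap L M).toAddMonoidHom ≤ w.V 0 := by
    rintro _ ⟨x, hx, rfl⟩
    rcases hx with hx | hx
    · left; simp [hx]
    · right
      show _ ≤ w.o (algebraMap L M x)
      rw [h.2]; positivity
  unfold FFPrime.nrm
  rw [← h1, AddSubgroup.relIndex_comap]
  refine AddSubgroup.relIndex_le_of_le_right h0 ?_
  have := hM.nrm_eq w
  have hp := (Fact.out : p.Prime).pos
  unfold FFPrime.nrm at this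
  rw [this]
  positivity

lemma Ovr.dg_le {p : ℕ} [Fact p.Prime] [Algebra (ZMod p) M] (hM : IsFF p M)
    {w : FFPrime M} {v : FFPrime L} {e : ℕ} (h : Ovr w v e) :
    v.dg p ≤ w.dg p := Nat.log_mono_right (h.nrm_le hM)

variable (L) in
/-- The place below. -/
def blw [FiniteDimensional L M] (w : FFPrime M) : FFPrime L := (exists_ovr w).choose

variable (L) in
/-- The ramification index. -/
def eix [FiniteDimensional L M] (w : FFPrime M) : ℕ := (exists_ovr (L := L) w).choose_spec.choose

variable (L) in
lemma ovr_blw [FiniteDimensional L M] (w : FFPrime M) : Ovr w (blw L w) (eix L w) :=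
  (exists_ovr (L := L) w).choose_spec.choose_spec

/-- An element with a zero only at `v`. -/
lemma IsFF.exists_zero_only {p : ℕ} [Fact p.Prime] [Algebra (ZMod p) L] (hL : IsFF p L)
    (v : FFPrime L) : ∃ x : L, x ≠ 0 ∧ 0 < v.o x ∧ ∀ v' : FFPrime L, v' ≠ v → v'.o x ≤ 0 := by
  obtain ⟨g, N, hg⟩ := hL.riemann
  obtain ⟨m, hm⟩ : ∃ m : ℕ, m = N + (g.natAbs + Dvs.ell p (0 : Dvs L) + 1) := ⟨_, rfl⟩
  have hv := hL.dg_pos v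
  have hdeg : Dvs.deg p (Finsupp.single v (m : ℤ) : Dvs L) = m * v.dg p := Dvs.deg_single _ _ _
  have h1 : (m : ℤ) ≤ m * v.dg p := by
    have : (1 : ℤ) ≤ v.dg p := by exact_mod_cast hv
    nlinarith
  have h2 := hg (Finsupp.single v (m : ℤ)) (by rw [hdeg]; omega)
  have h3 : Dvs.ell p (0 : Dvs L) < Dvs.ell p (Finsupp.single v (m : ℤ) : Dvs L) := by
    rw [hdeg] at h2; omega
  have h4 : ∃ u ∈ Dvs.RR (Finsupp.single v (m : ℤ) : Dvs L), u ∉ Dvs.RR (0 : Dvs L) := by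
    by_contra! h5
    have h6 : Dvs.RR (Finsupp.single v (m : ℤ) : Dvs L) ≤ Dvs.RR (0 : Dvs L) := h5
    haveI := hL.finite_RR_zero
    have h7 : Nat.card (Dvs.RR (Finsupp.single v (m : ℤ) : Dvs L)) ≤
      Nat.card (Dvs.RR (0 : Dvs L)) := Nat.card_le_card_of_injective _ (AddSubgroup.inclusion_injective h6)
    rw [hL.card_RR, hL.card_RR] at h7
    exact absurd ((Nat.pow_le_pow_iff_right (Fact.out : p.Prime).one_lt).1 h7) (by omega)
  obtain ⟨u, hu, hu0⟩ := h4
  have hune : u ≠ 0 := by rintro rfl; exact hu0 (zero_mem _)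
  rw [Dvs.mem_RR] at hu hu0
  have h8 : ∀ v' : FFPrime L, v' ≠ v → 0 ≤ v'.o u := by
    intro v' hv'
    have := hu v'
    rwa [FFPrime.mem_V_of_ne hune, Finsupp.single_eq_of_ne hv', neg_zero] at this
  refine ⟨u⁻¹, inv_ne_zero hune, ?_, ?_⟩
  · rw [FFPrime.o_inv]
    by_contra h9
    refine hu0 fun v' => ?_
    rw [FFPrime.mem_V_of_ne hune]
    by_cases hv' : v' = v
    · subst hv'; simp; omega
    · simpa using h8 v' hv'
  · intro v' hv'
    rw [FFPrime.o_inv]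
    have := h8 v' hv'
    omega

theorem fund_eq {p : ℕ} [Fact p.Prime] [Algebra (ZMod p) L] [Algebra (ZMod p) M]
    [IsScalarTower (ZMod p) L M] [FiniteDimensional L M] (hL : IsFF p L) (hM : IsFF p M)
    (v : FFPrime L) : ∃ F : Finset (FFPrime M), (∀ w, w ∈ F ↔ blw L w = v) ∧
      ∑ w ∈ F, eix L w * w.dg p = Module.finrank L M * v.dg p := by
  obtain ⟨x, hx, hx1, hx2⟩ := hL.exists_zero_only v
  have ht : Transcendental (ZMod p) x := IsFF.transc_of_o v hx1.ne'
  have ht' : Transcendental (ZMod p) (algebraMap L M x) :=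
    (transcendental_algebraMap_iff (FaithfulSMul.algebraMap_injective L M)).2 ht
  have e1 := hL.edeg_zeros ht
  have e2 := hM.edeg_zeros ht'
  rw [degOver_algebraMap, ← e1] at e2
  have z1 : Dvs.ze x = Finsupp.single v (v.o x).toNat := by
    ext v'
    rw [hL.ze_apply]
    by_cases hv' : v' = v
    · subst hv'; simp
    · rw [Finsupp.single_eq_of_ne hv']
      have := hx2 v' hv'
      omega
  have z2 : ∀ w : FFPrime M, blw L w = v → Dvs.ze (algebraMap L M x) w = eix L w * (v.o x).toNat := by
    intro w hw
    rw [hM.ze_apply, (ovr_blw L w).2, hw]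
    rw [Int.toNat_mul (by positivity) hx1.le]; simp
  have z3 : ∀ w : FFPrime M, blw L w ≠ v → Dvs.ze (algebraMap L M x) w = 0 := by
    intro w hw
    rw [hM.ze_apply, (ovr_blw L w).2]
    have := hx2 _ hw
    have : (eix L w : ℤ) * (blw L w).o x ≤ 0 := mul_nonpos_of_nonneg_of_nonpos (by positivity) this
    omega
  have hn : 0 < (v.o x).toNat := by omega
  refine ⟨(Dvs.ze (algebraMap L M x)).support, ?_, ?_⟩
  · intro w
    rw [Finsupp.mem_support_iff]
    constructor
    · intro h; by_contra h'; exact h (z3 w h')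
    · intro h
      rw [z2 w h]
      have := (ovr_blw L w).1
      positivity
  · have e3 : Dvs.edeg p (Dvs.ze (algebraMap L M x)) =
        (∑ w ∈ (Dvs.ze (algebraMap L M x)).support, eix L w * w.dg p) * (v.o x).toNat := by
      rw [Dvs.edeg, Finsupp.liftAddHom_apply, Finsupp.sum, Finset.sum_mul]
      refine Finset.sum_congr rfl fun w hw => ?_
      have : blw L w = v := by
        by_contra h'
        exact (Finsupp.mem_support_iff.1 hw) (z3 w h')
      rw [z2 w this]
      simp; ring
    rw [e3, z1, Dvs.edeg_single] at e2
    have : (∑ w ∈ (Dvs.ze (algebraMap L M x)).support, eix L w * w.dg p) * (v.o x).toNat =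
      (Module.finrank L M * v.dg p) * (v.o x).toNat := by rw [e2]; ring
    exact Nat.eq_of_mul_eq_mul_right hn this

end Below


section Twist

variable {L M : Type} [Field L] [Field M] [Algebra L M]

namespace FFPrime

/-- Twist of a place by an automorphism. -/
def tw (τ : M ≃ₐ[L] M) (w : FFPrime M) : FFPrime M where
  ord x := w.ord (τ x)
  ord_zero := by simp [w.ord_zero]
  ord_ne_top x hx := w.ord_ne_top _ (by simpa)
  ord_one := by simp [w.ord_one]
  ord_mul x y := by simp [w.ord_mul]
  ord_add x y := by simp only [map_add]; exact w.ord_add _ _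
  ord_surj n := by
    obtain ⟨x, hx⟩ := w.ord_surj n
    exact ⟨τ.symm x, by simpa using hx⟩

@[simp] lemma tw_o (τ : M ≃ₐ[L] M) (w : FFPrime M) (x : M) : (tw τ w).o x = w.o (τ x) := rfl

lemma mem_V_tw (τ : M ≃ₐ[L] M) (w : FFPrime M) (n : ℤ) (x : M) :
    x ∈ (tw τ w).V n ↔ τ x ∈ w.V n := by
  simp [mem_V]

lemma tw_nrm (τ : M ≃ₐ[L] M) (w : FFPrime M) : (tw τ w).nrm = w.nrm := by
  have h : ∀ n, ((tw τ w).V n).map (τ : M →+* M).toAddMonoidHom = w.V n := by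
    intro n
    ext x
    constructor
    · rintro ⟨y, hy, rfl⟩
      exact (mem_V_tw τ w n y).1 hy
    · intro hx
      exact ⟨τ.symm x, (mem_V_tw τ w n _).2 (by simpa), by simp⟩
  unfold nrm
  rw [← h 0, ← h 1, AddSubgroup.relIndex_map_map_of_injective]
  exact τ.injective

lemma tw_dg (p : ℕ) (τ : M ≃ₐ[L] M) (w : FFPrime M) : (tw τ w).dg p = w.dg p := by
  unfold dg; rw [tw_nrm]

lemma tw_iter_o (τ : M ≃ₐ[L] M) (n : ℕ) (w : FFPrime M) (x : M) :
    ((tw τ)^[n] w).o x = w.o (τ^[n] x) := by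
  induction n generalizing w x with
  | zero => rfl
  | succ n ih =>
    rw [Function.iterate_succ_apply, Function.iterate_succ_apply', ih, tw_o]

lemma tw_iter_dg (p : ℕ) (τ : M ≃ₐ[L] M) (n : ℕ) (w : FFPrime M) : ((tw τ)^[n] w).dg p = w.dg p := by
  induction n generalizing w with
  | zero => rfl
  | succ n ih => rw [Function.iterate_succ_apply, ih, tw_dg]

end FFPrime

lemma Ovr.tw {w : FFPrime M} {v : FFPrime L} {e : ℕ} (h : Ovr w v e) (τ : M ≃ₐ[L] M) :
    Ovr (w.tw τ) v e := ⟨h.1, fun x => by simp [h.2]⟩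

lemma Ovr.tw_iter {w : FFPrime M} {v : FFPrime L} {e : ℕ} (h : Ovr w v e) (τ : M ≃ₐ[L] M) (n : ℕ) :
    Ovr ((FFPrime.tw τ)^[n] w) v e := by
  induction n generalizing w with
  | zero => exact h
  | succ n ih => rw [Function.iterate_succ_apply]; exact ih (h.tw τ)

lemma blw_eix_eq [FiniteDimensional L M] {w : FFPrime M} {v : FFPrime L} {e : ℕ} (h : Ovr w v e) :
    blw L w = v ∧ eix L w = e := (ovr_blw L w).unique h

/-- Lower bound of the residue degree in the non-split case. -/
lemma inert_nrm {p : ℕ} [Fact p.Prime] [Algebra (ZMod p) L] [Algebra (ZMod p) M] (hL : IsFF p L)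
    (hM : IsFF p M) {q : ℕ} (hq : q.Prime) (hqM : (q : M) ≠ 0) (w : FFPrime M) (v : FFPrime L)
    (e : ℕ) (h : Ovr w v e) (σ : M ≃ₐ[L] M) (hw : w.tw σ = w) (ζ : L) (hζ : IsPrimitiveRoot ζ q)
    (β : M) (hβ : w.o β = 0) (hβ0 : β ≠ 0) (hσ : σ β = algebraMap L M ζ * β) :
    v.nrm ^ q ≤ w.nrm := by
  have hqp := hq.pos
  have hζ0 : ζ ≠ 0 := hζ.ne_zero hq.ne_zero
  have hinv : ∀ (n k : ℕ) (y : M), y ∈ w.V n → σ^[k] y ∈ w.V n := by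
    intro n k
    induction k with
    | zero => intro y hy; exact hy
    | succ k ih =>
      intro y hy
      rw [Function.iterate_succ_apply]
      refine ih _ ?_
      rw [← FFPrime.mem_V_tw, hw]; exact hy
  have hqo : w.o (q : M) = 0 := by
    have : (q : M) = algebraMap (ZMod p) M (q : ZMod p) := by simp
    rw [this]
    exact IsFF.o_alg w (isAlgebraic_algebraMap _)
  -- key independence
  have key : ∀ c : Fin q → L, ∑ i, algebraMap L M (c i) * β ^ (i : ℕ) ∈ w.V 1 → 
      ∀ j, c j ∈ v.V 1 := by
    intro c hc j
    have hk : ∀ k : ℕ, σ^[k] (∑ i, algebraMap L M (c i) * β ^ (i : ℕ)) =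
        ∑ i, algebraMap L M (c i) * (algebraMap L M ζ ^ (i : ℕ)) ^ k * β ^ (i : ℕ) := by
      intro k
      induction k with
      | zero => simp
      | succ k ih =>
        rw [Function.iterate_succ_apply', ih, map_sum]
        refine Finset.sum_congr rfl fun i _ => ?_
        rw [map_mul, map_mul, map_pow, map_pow, map_pow, hσ, AlgEquiv.commutes, AlgEquiv.commutes]
        ring
    have hsum : ∑ k ∈ Finset.range q, algebraMap L M ((ζ ^ (j : ℕ))⁻¹ ^ k) * 
        σ^[k] (∑ i, algebraMap L M (c i) * β ^ (i : ℕ)) =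
        (q : M) * (algebraMap L M (c j) * β ^ (j : ℕ)) := by
      simp only [hk, Finset.mul_sum]
      rw [Finset.sum_comm, Finset.sum_eq_single j]
      · have : ∀ k ∈ Finset.range q, algebraMap L M ((ζ ^ (j : ℕ))⁻¹ ^ k) * 
            (algebraMap L M (c j) * (algebraMap L M ζ ^ (j : ℕ)) ^ k * β ^ (j : ℕ)) =
            algebraMap L M (c j) * β ^ (j : ℕ) := by
          intro k _
          rw [← map_pow, ← map_pow]
          have : algebraMap L M ((ζ ^ (j : ℕ))⁻¹ ^ k) * algebraMap L M ((ζ ^ (j : ℕ)) ^ k) = 1 := by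
            rw [← map_mul, ← mul_pow, inv_mul_cancel₀ (pow_ne_zero _ hζ0), one_pow, map_one]
          linear_combination (algebraMap L M (c j) * β ^ (j : ℕ)) * this
        rw [Finset.sum_congr rfl this]; simp
      · intro i _ hij
        have h1 : ∀ k ∈ Finset.range q, algebraMap L M ((ζ ^ (j : ℕ))⁻¹ ^ k) * 
            (algebraMap L M (c i) * (algebraMap L M ζ ^ (i : ℕ)) ^ k * β ^ (i : ℕ)) =
            algebraMap L M (((ζ ^ (j : ℕ))⁻¹ * ζ ^ (i : ℕ)) ^ k) * 
              (algebraMap L M (c i) * β ^ (i : ℕ)) := by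
          intro k _
          rw [mul_pow, map_mul, ← map_pow, ← map_pow]
          ring
        rw [Finset.sum_congr rfl h1, ← Finset.sum_mul, ← map_sum]
        have h2 : ∑ k ∈ Finset.range q, ((ζ ^ (j : ℕ))⁻¹ * ζ ^ (i : ℕ)) ^ k = 0 := by
          obtain ⟨r, hr⟩ : ∃ r, r = (ζ ^ (j : ℕ))⁻¹ * ζ ^ (i : ℕ) := ⟨_, rfl⟩
          have hr1 : r ≠ 1 := by
            rw [hr]
            intro h
            have : ζ ^ (i : ℕ) = ζ ^ (j : ℕ) := by
              rw [inv_mul_eq_one₀ (pow_ne_zero _ hζ0)] at h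
              exact h.symm
            exact hij (Fin.ext (hζ.pow_inj i.2 j.2 this))
          have hrq : r ^ q = 1 := by
            rw [hr, mul_pow, inv_pow, ← pow_mul, ← pow_mul, mul_comm _ q, mul_comm _ q, pow_mul,
              pow_mul, hζ.pow_eq_one]; simp
          rw [← hr]
          have := mul_geom_sum r q
          rw [hrq, sub_self] at this
          exact (mul_eq_zero.1 this).resolve_left (sub_ne_zero.2 hr1)
        rw [h2]; simp
      · simp
    have hmem : (q : M) * (algebraMap L M (c j) * β ^ (j : ℕ)) ∈ w.V 1 := by
      rw [← hsum]
      refine sum_mem fun k _ => ?_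
      have a1 : algebraMap L M ((ζ ^ (j : ℕ))⁻¹ ^ k) ∈ w.V 0 := by
        rw [FFPrime.mem_V]; right
        rw [h.2, FFPrime.o_pow, FFPrime.o_inv, FFPrime.o_pow,
          v.o_eq_zero_of_pow_eq_one hq.ne_zero hζ.pow_eq_one]; simp
      simpa using FFPrime.mul_mem_V a1 (hinv 1 k _ (by simpa using hc))
    by_cases hcj : c j = 0
    · rw [hcj]; exact zero_mem _
    have hcj' : algebraMap L M (c j) ≠ 0 := by simpa
    rw [FFPrime.mem_V_of_ne (mul_ne_zero hqM (mul_ne_zero hcj' (pow_ne_zero _ hβ0))),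
      FFPrime.o_mul _ hqM (mul_ne_zero hcj' (pow_ne_zero _ hβ0)), 
      FFPrime.o_mul _ hcj' (pow_ne_zero _ hβ0), hqo, FFPrime.o_pow, hβ, h.2] at hmem
    rw [FFPrime.mem_V_of_ne hcj]
    by_contra h2
    have := h.1
    nlinarith [show v.o (c j) ≤ 0 by omega]
  have hp := (Fact.out : p.Prime).pos
  have hcw : Nat.card (w.V 0 ⧸ (w.V 1).addSubgroupOf (w.V 0)) = w.nrm := rfl
  have hcv : Nat.card (v.V 0 ⧸ (v.V 1).addSubgroupOf (v.V 0)) = v.nrm := rfl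
  haveI : Finite (w.V 0 ⧸ (w.V 1).addSubgroupOf (w.V 0)) := by
    apply Nat.finite_of_card_ne_zero
    rw [hcw, hM.nrm_eq w]; positivity
  have hV0 : ∀ c : Fin q → v.V 0, ∑ i, algebraMap L M (c i : L) * β ^ (i : ℕ) ∈ w.V 0 := by
    intro c
    refine sum_mem fun i _ => ?_
    have a1 : algebraMap L M (c i : L) ∈ w.V 0 := by
      rcases (c i).2 with h1 | h1
      · rw [h1]; simp
      · right; rw [h.2]; positivity
    have a2 : β ^ (i : ℕ) ∈ w.V 0 := by right; rw [FFPrime.o_pow, hβ]; simp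
    simpa using FFPrime.mul_mem_V a1 a2
  rw [← hcw, ← hcv]
  have hfun : Nat.card (Fin q → (v.V 0 ⧸ (v.V 1).addSubgroupOf (v.V 0))) =
      Nat.card (v.V 0 ⧸ (v.V 1).addSubgroupOf (v.V 0)) ^ q := by
    rw [Nat.card_fun]; simp
  rw [← hfun]
  refine Nat.card_le_card_of_injective 
    (fun c => (QuotientAddGroup.mk ⟨_, hV0 fun i => (c i).out⟩ :
      w.V 0 ⧸ (w.V 1).addSubgroupOf (w.V 0))) ?_
  intro c c' hcc
  have h1 := QuotientAddGroup.eq.1 hcc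
  rw [AddSubgroup.mem_addSubgroupOf] at h1
  have h2 := key (fun i => -((c i).out : L) + ((c' i).out : L)) (by
    convert h1 using 1
    simp only [AddSubgroup.coe_add, AddSubgroup.coe_neg, map_add, map_neg, add_mul, neg_mul,
      Finset.sum_add_distrib, Finset.sum_neg_distrib])
  funext j
  rw [← Quotient.out_eq' (c j), ← Quotient.out_eq' (c' j)]
  exact QuotientAddGroup.eq.2 (by rw [AddSubgroup.mem_addSubgroupOf]; exact h2 j)

end Twist


section Local

variable {L M : Type} [Field L] [Field M] [Algebra L M]

open FFPrime in
theorem local_dich {p : ℕ} [Fact p.Prime] [Algebra (ZMod p) L] [Algebra (ZMod p) M]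
    [IsScalarTower (ZMod p) L M] [FiniteDimensional L M] (hL : IsFF p L) (hM : IsFF p M)
    {q : ℕ} (hq : q.Prime) (hqM : (q : M) ≠ 0) (hrank : Module.finrank L M = q)
    (σ : M ≃ₐ[L] M) (hσq : ∀ x, σ^[q] x = x) (ζ : L) (hζ : IsPrimitiveRoot ζ q)
    (a : L) (ha : a ≠ 0) (hdiv : ∀ v : FFPrime L, v.OrdDvd q a) (α : M)
    (hα : α ^ q = algebraMap L M a) (hσ : σ α = algebraMap L M ζ * α) (v : FFPrime L) :
    ∃ (w : FFPrime M) (F : Finset (FFPrime M)), (∀ w', w' ∈ F ↔ blw L w' = v) ∧ w ∈ F ∧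
      (∀ w' ∈ F, eix L w' = 1) ∧
      ((Set.InjOn (fun i => (tw σ)^[i] w) (Finset.range q) ∧
        (∀ w', w' ∈ F ↔ ∃ i ∈ Finset.range q, (tw σ)^[i] w = w') ∧
        F.card = q ∧ ∀ w' ∈ F, w'.dg p = v.dg p) ∨
       (F = {w} ∧ tw σ w = w ∧ w.dg p = q * v.dg p)) := by
  classical
  obtain ⟨F, hF, hsum⟩ := fund_eq hL hM v
  rw [hrank] at hsum
  have hvpos := hL.dg_pos v
  have hqpos := hq.pos
  have hne : F.Nonempty := by
    by_contra h
    rw [Finset.not_nonempty_iff_eq_empty] at h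
    rw [h, Finset.sum_empty] at hsum
    have : 0 < q * v.dg p := by positivity
    omega
  obtain ⟨w, hw⟩ := hne
  have hov : ∀ w' ∈ F, Ovr w' v (eix L w') := fun w' hw' => by
    have := ovr_blw L w'
    rwa [(hF w').1 hw'] at this
  have hle : ∀ w' ∈ F, v.dg p ≤ eix L w' * w'.dg p := fun w' hw' => by
    have h1 := (hov w' hw').dg_le hM
    have h2 := (hov w' hw').1
    nlinarith
  refine ⟨w, F, hF, hw, ?_⟩
  by_cases hc : tw σ w = w
  · -- inert
    obtain ⟨n, hn⟩ := hdiv v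
    have hn' : v.o a = q * n := by
      have := v.coe_o ha
      rw [hn] at this
      exact_mod_cast this.symm
    obtain ⟨π, hπ, hπn⟩ := v.o_surj n
    have hα0 : α ≠ 0 := by
      rintro rfl
      rw [zero_pow hq.ne_zero] at hα
      exact ha ((map_eq_zero _).1 hα.symm)
    have hπ' : algebraMap L M π ≠ 0 := by simpa
    have hβ0 : α / algebraMap L M π ≠ 0 := div_ne_zero hα0 hπ'
    have hβ : w.o (α / algebraMap L M π) = 0 := by
      have h1 : (α / algebraMap L M π) ^ q = algebraMap L M (a / π ^ q) := by
        rw [div_pow, hα, map_div₀, map_pow]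
      have h2 := w.o_pow (α / algebraMap L M π) q
      rw [h1, (hov w hw).2, v.o_div ha (pow_ne_zero _ hπ), v.o_pow, hπn, hn', sub_self,
        mul_zero] at h2
      have : (q : ℤ) ≠ 0 := by exact_mod_cast hq.ne_zero
      exact (mul_eq_zero.1 h2.symm).resolve_left this
    have h3 := inert_nrm hL hM hq hqM w v _ (hov w hw) σ hc ζ hζ _ hβ hβ0 (by
      rw [map_div₀, hσ, AlgEquiv.commutes, mul_div_assoc])
    rw [hL.nrm_eq v, hM.nrm_eq w, ← pow_mul, 
      Nat.pow_le_pow_iff_right (Fact.out : p.Prime).one_lt] at h3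
    have h4 := Finset.add_sum_erase F (fun w => eix L w * w.dg p) hw
    rw [hsum] at h4
    have he := (hov w hw).1
    have h5 : w.dg p ≤ eix L w * w.dg p := Nat.le_mul_of_pos_left _ he
    have h6 : ∑ x ∈ F.erase w, eix L x * x.dg p = 0 := by
      rw [mul_comm] at h3; omega
    have h7 : w.dg p = q * v.dg p := by rw [mul_comm] at h3; omega
    have hFw : F = {w} := by
      refine Finset.eq_singleton_iff_unique_mem.2 ⟨hw, fun w' hw' => ?_⟩
      by_contra hne
      have := Finset.sum_eq_zero_iff.1 h6 w' (Finset.mem_erase.2 ⟨hne, hw'⟩)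
      have := hle w' hw'
      omega
    have he1 : eix L w = 1 := by
      have h8 : eix L w * w.dg p = 1 * w.dg p := by rw [mul_comm] at h3; omega
      exact Nat.eq_of_mul_eq_mul_right (hM.dg_pos w) h8
    exact ⟨fun w' hw' => by rw [hFw, Finset.mem_singleton] at hw'; rw [hw', he1],
      Or.inr ⟨hFw, hc, h7⟩⟩
  · -- split
    have hper : Function.IsPeriodicPt (tw σ) q w := by
      refine FFPrime.ext_o fun x _ => ?_
      rw [tw_iter_o, hσq]
    have hmin : Function.minimalPeriod (tw σ) w = q := by
      rcases (Nat.dvd_prime hq).1 hper.minimalPeriod_dvd with h | h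
      · exact absurd (Function.minimalPeriod_eq_one_iff_isFixedPt.1 h) hc
      · exact h
    have hinj : Set.InjOn (fun i => (tw σ)^[i] w) (Finset.range q) := by
      have := Function.iterate_injOn_Iio_minimalPeriod (f := tw σ) (x := w)
      rw [hmin] at this
      simpa using this
    have hcard : ((Finset.range q).image (fun i => (tw σ)^[i] w)).card = q := by
      rw [Finset.card_image_of_injOn hinj, Finset.card_range]
    have hsub : (Finset.range q).image (fun i => (tw σ)^[i] w) ⊆ F := by
      intro w' hw'
      obtain ⟨i, -, rfl⟩ := Finset.mem_image.1 hw'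
      rw [hF]
      exact (blw_eix_eq ((hov w hw).tw_iter σ i)).1
    have h1 : ∑ w' ∈ F, v.dg p ≤ ∑ w' ∈ F, eix L w' * w'.dg p := Finset.sum_le_sum hle
    have hFc : F.card = q := by
      refine le_antisymm ?_ (hcard ▸ Finset.card_le_card hsub)
      rw [Finset.sum_const, hsum, smul_eq_mul] at h1
      exact Nat.le_of_mul_le_mul_right h1 hvpos
    have hFeq := Finset.eq_of_subset_of_card_le hsub (by rw [hcard, hFc])
    have heq : ∑ w' ∈ F, v.dg p = ∑ w' ∈ F, eix L w' * w'.dg p := by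
      rw [Finset.sum_const, hsum, smul_eq_mul, hFc]
    have h2 := (Finset.sum_eq_sum_iff_of_le hle).1 heq
    have h3 : ∀ w' ∈ F, eix L w' = 1 ∧ w'.dg p = v.dg p := by
      intro w' hw'
      have a1 := h2 w' hw'
      have a2 := (hov w' hw').dg_le hM
      have a3 := (hov w' hw').1
      have a4 : w'.dg p ≤ eix L w' * w'.dg p := Nat.le_mul_of_pos_left _ a3
      have a5 : w'.dg p = v.dg p := by omega
      refine ⟨?_, a5⟩
      have h8 : eix L w' * w'.dg p = 1 * w'.dg p := by omega
      exact Nat.eq_of_mul_eq_mul_right (hM.dg_pos w') h8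
    refine ⟨fun w' hw' => (h3 w' hw').1, Or.inl ⟨hinj, ?_, hFc, fun w' hw' => (h3 w' hw').2⟩⟩
    intro w'
    rw [← hFeq, Finset.mem_image]

end Local


section Cyc

lemma end_sum_apply {A ι : Type*} [AddCommGroup A] (s : Finset ι) (g : ι → AddMonoid.End A)
    (a : A) : (∑ i ∈ s, g i) a = ∑ i ∈ s, g i a := by
  classical
  induction s using Finset.induction_on with
  | empty => rfl
  | insert i s hi ih =>
    rw [Finset.sum_insert hi, Finset.sum_insert hi, ← ih]
    rfl

theorem herbrand_cyc {A D : Type*} [AddCommGroup A] [AddCommGroup D] (f : A →+ D) (q : ℕ)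
    (sA : AddMonoid.End A) (sD : AddMonoid.End D) (hsA : sA ^ q = 1) (hsD : sD ^ q = 1)
    (hfs : ∀ a, f (sA a) = sD (f a)) (hK : Finite f.ker) (hC : f.range.index ≠ 0)
    (hA : ∀ a, (∑ i ∈ Finset.range q, sA ^ i) a = 0 → ∃ b, sA b - b = a)
    (hD0 : ∀ d, sD d = d → ∃ a e, sA a = a ∧ d = f a + (∑ i ∈ Finset.range q, sD ^ i) e)
    (x : A) (hx : sA x = x) (e : D) (hxe : f x = (∑ i ∈ Finset.range q, sD ^ i) e) :
    ∃ y, (∑ i ∈ Finset.range q, sA ^ i) y = x := by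
  have hdA : ∀ a, (sA - 1) a = sA a - a := fun a => rfl
  have hdD : ∀ a, (sD - 1) a = sD a - a := fun a => rfl
  have e1 : (sA - 1) * (∑ i ∈ Finset.range q, sA ^ i) = 0 := by rw [mul_geom_sum, hsA, sub_self]
  have e2 : (∑ i ∈ Finset.range q, sA ^ i) * (sA - 1) = 0 := by rw [geom_sum_mul, hsA, sub_self]
  have e3 : (sD - 1) * (∑ i ∈ Finset.range q, sD ^ i) = 0 := by rw [mul_geom_sum, hsD, sub_self]
  have e4 : (∑ i ∈ Finset.range q, sD ^ i) * (sD - 1) = 0 := by rw [geom_sum_mul, hsD, sub_self]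
  have hfi : ∀ (i : ℕ) a, f ((sA ^ i) a) = (sD ^ i) (f a) := by
    intro i
    induction i with
    | zero => intro a; rfl
    | succ i ih =>
      intro a
      rw [pow_succ, pow_succ]
      show f ((sA ^ i) (sA a)) = (sD ^ i) (sD (f a))
      rw [ih, hfs]
  have g1 : ∀ a, f ((sA - 1) a) = (sD - 1) (f a) := fun a => by
    rw [hdA, hdD, map_sub, hfs]
  have g2 : ∀ a, f ((∑ i ∈ Finset.range q, sA ^ i) a) = (∑ i ∈ Finset.range q, sD ^ i) (f a) := by
    intro a
    rw [end_sum_apply, end_sum_apply, map_sum]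
    exact Finset.sum_congr rfl fun i _ => hfi i a
  have g3 : ∀ d, (sD - 1) d = 0 → ∃ a e, (sA - 1) a = 0 ∧
      d = f a + (∑ i ∈ Finset.range q, sD ^ i) e := by
    intro d hd
    rw [hdD, sub_eq_zero] at hd
    obtain ⟨a, e, ha, h⟩ := hD0 d hd
    exact ⟨a, e, by rw [hdA, ha, sub_self], h⟩
  have g4 : (sA - 1) x = 0 := by rw [hdA, hx, sub_self]
  exact herbrand_main f (sA - 1 : AddMonoid.End A)
    (∑ i ∈ Finset.range q, sA ^ i : AddMonoid.End A) (sD - 1 : AddMonoid.End D)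
    (∑ i ∈ Finset.range q, sD ^ i : AddMonoid.End D) g1 g2 (fun a => DFunLike.congr_fun e1 a)
    (fun a => DFunLike.congr_fun e2 a) (fun a => DFunLike.congr_fun e3 a)
    (fun a => DFunLike.congr_fun e4 a) hK hC hA g3 x g4 e hxe

/-- Dimension argument. -/
lemma exists_surj_lin {k Q : Type*} [Field k] [AddCommGroup Q] [Module k Q]
    (a b : Q) (ha : a ≠ 0) (hb : ∀ n : k, b ≠ n • a) :
    ∃ g : Q →ₗ[k] k × k, Function.Surjective g := by
  let l : (k × k) →ₗ[k] Q :=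
    (LinearMap.toSpanSingleton k Q a).coprod (LinearMap.toSpanSingleton k Q b)
  have hl : ∀ s t, l (s, t) = s • a + t • b := by
    intro s t; simp [l]
  have hker : LinearMap.ker l = ⊥ := by
    rw [LinearMap.ker_eq_bot']
    rintro ⟨s, t⟩ hst
    rw [hl] at hst
    have ht : t = 0 := by
      by_contra ht
      have h1 : b = (-(t⁻¹ * s)) • a := by
        have h2 : t⁻¹ • (s • a + t • b) = 0 := by rw [hst, smul_zero]
        rw [smul_add, smul_smul, smul_smul, inv_mul_cancel₀ ht, one_smul] at h2
        rw [neg_smul]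
        exact eq_neg_of_add_eq_zero_right h2
      exact hb _ h1
    subst ht
    rw [zero_smul, add_zero] at hst
    rcases smul_eq_zero.1 hst with h | h
    · rw [h]; rfl
    · exact absurd h ha
  obtain ⟨g, hg⟩ := LinearMap.exists_leftInverse_of_injective l hker
  exact ⟨g, fun x => ⟨l x, LinearMap.congr_fun hg x⟩⟩

lemma exists_surj_hom_aux {Q : Type*} [AddCommGroup Q] (q : ℕ) [Fact q.Prime]
    (hQ : ∀ x : Q, q • x = 0) (a b : Q) (ha : a ≠ 0) (hb : ∀ n : ℤ, b ≠ n • a) :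
    ∃ g : Q →+ ZMod q × ZMod q, Function.Surjective g := by
  letI : Module (ZMod q) Q := AddCommGroup.zmodModule hQ
  obtain ⟨g, hg⟩ := exists_surj_lin (k := ZMod q) a b ha (by
    intro c h1
    obtain ⟨n, hn⟩ := ZMod.intCast_surjective c
    rw [← hn] at h1
    apply hb n
    rw [h1, Int.cast_smul_eq_zsmul])
  exact ⟨g.toAddMonoidHom, hg⟩

lemma exists_surj_hom {D : Type*} [AddCommGroup D] (q : ℕ) [Fact q.Prime] (H : AddSubgroup D)
    (hH : ∀ d : D, q • d ∈ H) (a b : D) (ha : a ∉ H) (hb : ∀ n : ℤ, b - n • a ∉ H) :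
    ∃ φ : D →+ ZMod q × ZMod q, Function.Surjective φ ∧ ∀ d ∈ H, φ d = 0 := by
  obtain ⟨g, hg⟩ := exists_surj_hom_aux (Q := D ⧸ H) q (by
    intro x
    obtain ⟨d, rfl⟩ := QuotientAddGroup.mk_surjective x
    exact (QuotientAddGroup.eq_zero_iff (q • d)).2 (hH d)) a b
    (fun h => ha ((QuotientAddGroup.eq_zero_iff a).1 h)) (fun n h => hb n (by
      rw [← QuotientAddGroup.eq_zero_iff, QuotientAddGroup.mk_sub, h,
        QuotientAddGroup.mk_zsmul, sub_self]))
  refine ⟨g.comp (QuotientAddGroup.mk' H), hg.comp (QuotientAddGroup.mk'_surjective H), ?_⟩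
  intro d hd
  show g (d : D ⧸ H) = 0
  rw [(QuotientAddGroup.eq_zero_iff d).2 hd, map_zero]

end Cyc

section Conorm

variable {L M : Type} [Field L] [Field M] [Algebra L M]

open Classical in
/-- Conorm of divisors. -/
def cnm (b : FFPrime M → FFPrime L) (F : FFPrime L → Finset (FFPrime M))
    (hF : ∀ v w, w ∈ F v ↔ b w = v) : Dvs L →+ Dvs M where
  toFun A := Finsupp.onFinset (A.support.biUnion F) (fun w => A (b w)) (fun w hw => by
    rw [Finset.mem_biUnion]
    exact ⟨b w, Finsupp.mem_support_iff.2 hw, (hF _ _).2 rfl⟩)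
  map_zero' := by ext w; simp
  map_add' A B := by ext w; simp

@[simp] lemma cnm_apply (b : FFPrime M → FFPrime L) (F : FFPrime L → Finset (FFPrime M))
    (hF : ∀ v w, w ∈ F v ↔ b w = v) (A : Dvs L) (w : FFPrime M) : cnm b F hF A w = A (b w) := rfl

lemma cnm_single (b : FFPrime M → FFPrime L) (F : FFPrime L → Finset (FFPrime M))
    (hF : ∀ v w, w ∈ F v ↔ b w = v) (v : FFPrime L) (n : ℤ) :
    cnm b F hF (Finsupp.single v n) = ∑ w ∈ F v, Finsupp.single w n := by
  classical
  ext w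
  rw [cnm_apply, Finsupp.finsetSum_apply, Finsupp.single_apply]
  simp only [Finsupp.single_apply]
  rw [Finset.sum_ite_eq']
  simp only [hF, eq_comm]

/-- Action on divisors. -/
def sDv (σ : M ≃ₐ[L] M) : AddMonoid.End (Dvs M) where
  toFun D := Finsupp.equivMapDomain
    (Equiv.mk (FFPrime.tw σ.symm) (FFPrime.tw σ) (fun w => FFPrime.ext_o fun x _ => by simp)
      (fun w => FFPrime.ext_o fun x _ => by simp)) D
  map_zero' := by ext w; simp
  map_add' A B := by ext w; simp

@[simp] lemma sDv_apply (σ : M ≃ₐ[L] M) (D : Dvs M) (w : FFPrime M) :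
    sDv σ D w = D (FFPrime.tw σ w) := rfl

lemma sDv_pow_apply (σ : M ≃ₐ[L] M) (n : ℕ) (D : Dvs M) (w : FFPrime M) :
    (sDv σ ^ n) D w = D ((FFPrime.tw σ)^[n] w) := by
  induction n generalizing w D with
  | zero => rfl
  | succ n ih =>
    rw [pow_succ]
    show (sDv σ ^ n) (sDv σ D) w = _
    rw [ih, Function.iterate_succ_apply', sDv_apply]

lemma nDv_apply (σ : M ≃ₐ[L] M) (q : ℕ) (D : Dvs M) (w : FFPrime M) :
    (∑ i ∈ Finset.range q, sDv σ ^ i) D w =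
      ∑ i ∈ Finset.range q, D ((FFPrime.tw σ)^[i] w) := by
  rw [end_sum_apply, Finsupp.finsetSum_apply]
  exact Finset.sum_congr rfl fun i _ => sDv_pow_apply σ i D w

end Conorm


section Global

open FFPrime

variable {p : ℕ} [Fact p.Prime]

/-- Divisor map on units. -/
def IsFF.dvU {K : Type} [Field K] [Algebra (ZMod p) K] (h : IsFF p K) : Additive Kˣ →+ Dvs K where
  toFun u := Dvs.dv ((u.toMul : Kˣ) : K)
  map_zero' := h.dv_one
  map_add' u v := h.dv_mul (Units.ne_zero _) (Units.ne_zero _)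

/-- Divisor map on units together with a fixed divisor. -/
def IsFF.dvB {K : Type} [Field K] [Algebra (ZMod p) K] (h : IsFF p K) (B : Dvs K) :
    Additive Kˣ × ℤ →+ Dvs K := h.dvU.coprod (zmultiplesHom _ B)

lemma IsFF.dvB_apply {K : Type} [Field K] [Algebra (ZMod p) K] (h : IsFF p K) (B : Dvs K)
    (u : Additive Kˣ) (n : ℤ) : h.dvB B (u, n) = Dvs.dv ((u.toMul : Kˣ) : K) + n • B := rfl

lemma IsFF.dvB_ker {K : Type} [Field K] [Algebra (ZMod p) K] (h : IsFF p K) (B : Dvs K)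
    (hB : Dvs.deg p B ≠ 0) : Finite (h.dvB B).ker := by
  have hfin := h.finite_RR_zero
  have key : ∀ x : (h.dvB B).ker, x.1.2 = 0 ∧ ((x.1.1.toMul : Kˣ) : K) ∈ Dvs.RR (0 : Dvs K) := by
    rintro ⟨⟨u, n⟩, hx⟩
    have hx' : Dvs.dv ((u.toMul : Kˣ) : K) + n • B = 0 := hx
    have h1 := congrArg (Dvs.deg p) hx'
    rw [map_add, h.deg_dv, zero_add, map_zsmul, map_zero, smul_eq_mul] at h1
    have hn : n = 0 := (mul_eq_zero.1 h1).resolve_right hB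
    refine ⟨hn, ?_⟩
    rw [hn, zero_smul, add_zero] at hx'
    show ((u.toMul : Kˣ) : K) ∈ _
    rw [h.mem_RR_iff (Units.ne_zero _), hx', add_zero]
  refine Finite.of_injective (fun x : (h.dvB B).ker =>
    (⟨_, (key x).2⟩ : Dvs.RR (0 : Dvs K))) ?_
  intro x y hxy
  have h1 := congrArg Subtype.val hxy
  apply Subtype.ext
  refine Prod.ext ?_ ((key x).1.trans (key y).1.symm)
  exact Additive.toMul.injective (Units.ext h1)

lemma IsFF.dvB_range {K : Type} [Field K] [Algebra (ZMod p) K] (h : IsFF p K) (B : Dvs K)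
    (hB : Dvs.deg p B ≠ 0) : (h.dvB B).range.index ≠ 0 := by
  obtain ⟨g, N, hR⟩ := h.riemann
  let c : ℤ := max (N : ℤ) (g + 1)
  let T : Set (Eff K) := {E : Eff K | Dvs.edeg p E ≤ (c + |Dvs.deg p B|).toNat}
  have hT : Finite T := h.finite_edeg_le _
  have hsur : Function.Surjective
      (fun E : T => (QuotientAddGroup.mk (Dvs.ofEff E.1) : Dvs K ⧸ (h.dvB B).range)) := by
    intro x
    obtain ⟨D, rfl⟩ := QuotientAddGroup.mk_surjective x
    set b := Dvs.deg p B with hb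
    let n : ℤ := -((Dvs.deg p D - c) / b)
    have hdeg : Dvs.deg p (D + n • B) = c + (Dvs.deg p D - c) % b := by
      rw [map_add, map_zsmul, smul_eq_mul, ← hb]
      have := Int.mul_ediv_add_emod (Dvs.deg p D - c) b
      simp only [n]
      linarith
    have h0 := Int.emod_nonneg (Dvs.deg p D - c) hB
    have h1 := Int.emod_lt_abs (Dvs.deg p D - c) hB
    have hN : (N : ℤ) ≤ c := le_max_left _ _
    have hg : g + 1 ≤ c := le_max_right _ _
    have hl := hR (D + n • B) (by omega)
    obtain ⟨y, hy, hy2⟩ := h.exists_of_ell_pos (D := D + n • B) (by omega)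
    obtain ⟨E, hE⟩ := Dvs.exists_ofEff hy2
    have hEd : (Dvs.edeg p E : ℤ) = c + (Dvs.deg p D - c) % b := by
      rw [← Dvs.deg_ofEff, hE, map_add, h.deg_dv, zero_add, hdeg]
    refine ⟨⟨E, ?_⟩, ?_⟩
    · show Dvs.edeg p E ≤ (c + |b|).toNat
      omega
    · show (QuotientAddGroup.mk (Dvs.ofEff E) : Dvs K ⧸ (h.dvB B).range) = QuotientAddGroup.mk D
      rw [QuotientAddGroup.eq]
      refine ⟨(-(Additive.ofMul (Units.mk0 y hy)), -n), ?_⟩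
      rw [h.dvB_apply, hE]
      have : Dvs.dv (((-(Additive.ofMul (Units.mk0 y hy))).toMul : Kˣ) : K) = - Dvs.dv y := by
        rw [← h.dv_inv]; rfl
      rw [this, neg_smul]
      abel
  have hfin : Finite (Dvs K ⧸ (h.dvB B).range) := Finite.of_surjective _ hsur
  exact AddSubgroup.index_ne_zero_of_finite

variable {L M : Type} [Field L] [Field M] [Algebra L M]

/-- Galois action on units times integers. -/
def sUn (σ : M ≃ₐ[L] M) : AddMonoid.End (Additive Mˣ × ℤ) :=
  AddMonoidHom.prodMap (MonoidHom.toAdditive (Units.map (σ : M →* M))) (AddMonoidHom.id ℤ)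

lemma sUn_fst (σ : M ≃ₐ[L] M) (x : Additive Mˣ × ℤ) :
    (((sUn σ x).1.toMul : Mˣ) : M) = σ ((x.1.toMul : Mˣ) : M) := rfl

lemma sUn_snd (σ : M ≃ₐ[L] M) (x : Additive Mˣ × ℤ) : (sUn σ x).2 = x.2 := rfl

lemma sUn_pow_fst (σ : M ≃ₐ[L] M) (n : ℕ) (x : Additive Mˣ × ℤ) :
    ((((sUn σ ^ n) x).1.toMul : Mˣ) : M) = σ^[n] ((x.1.toMul : Mˣ) : M) := by
  induction n generalizing x with
  | zero => rfl
  | succ n ih =>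
    rw [pow_succ]
    show ((((sUn σ ^ n) (sUn σ x)).1.toMul : Mˣ) : M) = _
    rw [ih, sUn_fst, Function.iterate_succ_apply]

lemma sUn_pow_snd (σ : M ≃ₐ[L] M) (n : ℕ) (x : Additive Mˣ × ℤ) :
    ((sUn σ ^ n) x).2 = x.2 := by
  induction n generalizing x with
  | zero => rfl
  | succ n ih =>
    rw [pow_succ]
    show ((sUn σ ^ n) (sUn σ x)).2 = _
    rw [ih, sUn_snd]

lemma unz_ext {x y : Additive Mˣ × ℤ} (h1 : ((x.1.toMul : Mˣ) : M) = ((y.1.toMul : Mˣ) : M))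
    (h2 : x.2 = y.2) : x = y :=
  Prod.ext (Additive.toMul.injective (Units.ext h1)) h2

lemma nUn_fst (σ : M ≃ₐ[L] M) (q : ℕ) (x : Additive Mˣ × ℤ) :
    ((((∑ i ∈ Finset.range q, sUn σ ^ i) x).1.toMul : Mˣ) : M) =
      ∏ i ∈ Finset.range q, σ^[i] ((x.1.toMul : Mˣ) : M) := by
  rw [end_sum_apply, Prod.fst_sum, toMul_sum, Units.coe_prod]
  exact Finset.prod_congr rfl fun i _ => sUn_pow_fst σ i x

lemma nUn_snd (σ : M ≃ₐ[L] M) (q : ℕ) (x : Additive Mˣ × ℤ) :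
    ((∑ i ∈ Finset.range q, sUn σ ^ i) x).2 = q * x.2 := by
  rw [end_sum_apply, Prod.snd_sum, Finset.sum_congr rfl fun i _ => sUn_pow_snd σ i x]
  simp

lemma sDv_pow_eq_one (σ : M ≃ₐ[L] M) {q : ℕ} (hσq : ∀ x, σ^[q] x = x) : sDv σ ^ q = 1 := by
  refine DFunLike.ext _ _ fun D => ?_
  ext w
  rw [sDv_pow_apply]
  show D _ = D w
  congr 1
  exact ext_o fun x _ => by rw [tw_iter_o, hσq]

lemma sUn_pow_eq_one (σ : M ≃ₐ[L] M) {q : ℕ} (hσq : ∀ x, σ^[q] x = x) : sUn σ ^ q = 1 := by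
  refine DFunLike.ext _ _ fun x => ?_
  refine unz_ext ?_ (sUn_pow_snd σ q x)
  rw [sUn_pow_fst, hσq]; rfl

lemma nDv_tw (σ : M ≃ₐ[L] M) {q : ℕ} (hσq : ∀ x, σ^[q] x = x) (e : Dvs M) (w : FFPrime M)
    (k : ℕ) : (∑ i ∈ Finset.range q, sDv σ ^ i) e ((tw σ)^[k] w) =
      (∑ i ∈ Finset.range q, sDv σ ^ i) e w := by
  induction k with
  | zero => rfl
  | succ k ih =>
    rw [← ih, Function.iterate_succ_apply']
    have h1 : sDv σ * (∑ i ∈ Finset.range q, sDv σ ^ i) = ∑ i ∈ Finset.range q, sDv σ ^ i := by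
      have := mul_geom_sum (sDv σ) q
      rw [sDv_pow_eq_one σ hσq, sub_self, sub_mul, one_mul, sub_eq_zero] at this
      exact this
    have h2 := DFunLike.congr_fun (DFunLike.congr_fun h1 e) ((tw σ)^[k] w)
    exact h2

lemma blw_tw_iter [FiniteDimensional L M]
    (σ : M ≃ₐ[L] M) (w : FFPrime M) (i : ℕ) : blw L ((tw σ)^[i] w) = blw L w :=
  (blw_eix_eq ((ovr_blw L w).tw_iter σ i)).1

end Global


section Global2

open FFPrime

variable {p : ℕ} [Fact p.Prime] {L M : Type} [Field L] [Field M] [Algebra L M]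

theorem global_norm [Algebra (ZMod p) L] [Algebra (ZMod p) M]
    [IsScalarTower (ZMod p) L M] [FiniteDimensional L M] (hL : IsFF p L) (hM : IsFF p M)
    {q : ℕ} (hq : q.Prime) (σ : M ≃ₐ[L] M) (hσq : ∀ x, σ^[q] x = x)
    (hdich : ∀ v : FFPrime L, ∃ (w : FFPrime M) (F : Finset (FFPrime M)),
      (∀ w', w' ∈ F ↔ blw L w' = v) ∧ w ∈ F ∧ (∀ w' ∈ F, eix L w' = 1) ∧
      ((Set.InjOn (fun i => (tw σ)^[i] w) (Finset.range q) ∧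
        (∀ w', w' ∈ F ↔ ∃ i ∈ Finset.range q, (tw σ)^[i] w = w') ∧
        F.card = q ∧ ∀ w' ∈ F, w'.dg p = v.dg p) ∨
       (F = {w} ∧ tw σ w = w ∧ w.dg p = q * v.dg p)))
    (hilb : ∀ y : M, y ≠ 0 → ∏ i ∈ Finset.range q, σ^[i] y = 1 → ∃ u : M, u ≠ 0 ∧ y = σ u / u)
    (z : L) (hz : z ≠ 0)
    (hzloc : ∀ v : FFPrime L, (∀ w : FFPrime M, blw L w = v → tw σ w ≠ w) ∨ (q : ℤ) ∣ v.o z) :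
    ∃ y : M, ∏ i ∈ Finset.range q, σ^[i] y = algebraMap L M z := by
  classical
  haveI : Fact q.Prime := ⟨hq⟩
  choose wv F hF hwF heix hcase using hdich
  have hqpos := hq.pos
  have hwv : ∀ v, blw L (wv v) = v := fun v => (hF v _).1 (hwF v)
  have hinj : Function.Injective (algebraMap L M) := (algebraMap L M).injective
  set nD : AddMonoid.End (Dvs M) := ∑ i ∈ Finset.range q, sDv σ ^ i with hnD
  let j : Dvs L →+ Dvs M := cnm (blw L) F hF
  have hj : ∀ A w, j A w = A (blw L w) := fun A w => rfl
  have he1 : ∀ w, eix L w = 1 := fun w => heix (blw L w) w ((hF _ _).2 rfl)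
  have hjdv : ∀ y : L, j (Dvs.dv y) = Dvs.dv (algebraMap L M y) := by
    intro y
    ext w
    rw [hj, hL.dv_apply, hM.dv_apply, (ovr_blw L w).2, he1]
    simp
  -- the norm of a prime
  have hoff : ∀ v w, blw L w ≠ v → nD (Finsupp.single (wv v) 1) w = 0 := by
    intro v w hw
    rw [hnD, nDv_apply]
    refine Finset.sum_eq_zero fun i _ => ?_
    rw [Finsupp.single_apply, if_neg]
    intro h
    apply hw
    rw [← blw_tw_iter σ w i, ← h, hwv]
  have hjs : ∀ v w, j (Finsupp.single v 1) w = if blw L w = v then 1 else 0 := by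
    intro v w
    rw [hj, Finsupp.single_apply]
    simp only [eq_comm]
  have hsplit : ∀ v, tw σ (wv v) ≠ wv v →
      nD (Finsupp.single (wv v) 1) = j (Finsupp.single v 1) := by
    intro v hv
    rcases hcase v with ⟨h1, h2, -, -⟩ | ⟨-, h, -⟩
    swap
    · exact absurd h hv
    ext w
    rw [hjs]
    split_ifs with hw
    · obtain ⟨k, -, rfl⟩ := (h2 w).1 ((hF v w).2 hw)
      rw [hnD, nDv_tw σ hσq, nDv_apply, Finset.sum_eq_single 0]
      · simp
      · intro i hi hi0
        rw [Finsupp.single_apply, if_neg]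
        intro h
        apply hi0
        exact h1 hi (by simpa using hqpos) h.symm
      · intro h
        exact absurd (Finset.mem_range.2 hqpos) h
    · exact hoff v w hw
  have hinert : ∀ v, tw σ (wv v) = wv v →
      nD (Finsupp.single (wv v) 1) = q • j (Finsupp.single v 1) := by
    intro v hv
    have hit : ∀ i, (tw σ)^[i] (wv v) = wv v := fun i => Function.iterate_fixed hv i
    have hFv : ∀ w, blw L w = v → w = wv v := by
      intro w hw
      rcases hcase v with ⟨-, h2, -, -⟩ | ⟨h, -, -⟩
      · obtain ⟨k, -, rfl⟩ := (h2 w).1 ((hF v w).2 hw)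
        exact hit k
      · have := (hF v w).2 hw
        rw [h] at this
        exact Finset.mem_singleton.1 this
    ext w
    rw [Finsupp.smul_apply, hjs]
    split_ifs with hw
    · rw [hFv w hw, hnD, nDv_apply]
      simp [hit]
    · rw [hoff v w hw, smul_zero]
  let H0 : AddSubgroup (Dvs L) :=
    { carrier := {D | ∃ e, nD e = j D}
      zero_mem' := ⟨0, by rw [map_zero, map_zero]⟩
      add_mem' := by
        rintro a b ⟨e, he⟩ ⟨e', he'⟩
        exact ⟨e + e', by rw [map_add, map_add, he, he']⟩
      neg_mem' := by
        rintro a ⟨e, he⟩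
        exact ⟨-e, by rw [map_neg, map_neg, he]⟩ }
  have hH0 : ∀ D, D ∈ H0 ↔ ∃ e, nD e = j D := fun D => Iff.rfl
  have hs0 : ∀ v, tw σ (wv v) ≠ wv v → (Finsupp.single v 1 : Dvs L) ∈ H0 :=
    fun v hv => ⟨_, hsplit v hv⟩
  have hq0 : ∀ v, q • (Finsupp.single v 1 : Dvs L) ∈ H0 := by
    intro v
    by_cases hv : tw σ (wv v) = wv v
    · exact ⟨_, (hinert v hv).trans (map_nsmul j q _).symm⟩
    · exact nsmul_mem (hs0 v hv) q
  have hsing : ∀ (v : FFPrime L) (n : ℤ), (Finsupp.single v n : Dvs L) = n • Finsupp.single v 1 := by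
    intro v n; simp
  have hqall : ∀ D : Dvs L, q • D ∈ H0 := by
    intro D
    induction D using Finsupp.induction_linear with
    | zero => rw [smul_zero]; exact zero_mem _
    | add f g hf hg => rw [smul_add]; exact add_mem hf hg
    | single v n =>
      rw [hsing, smul_comm]
      exact zsmul_mem (hq0 v) n
  let Hs : AddSubgroup (Dvs L) :=
    { carrier := {D | ∃ y : L, y ≠ 0 ∧ D - Dvs.dv y ∈ H0}
      zero_mem' := ⟨1, one_ne_zero, by rw [hL.dv_one, sub_zero]; exact zero_mem _⟩
      add_mem' := by
        rintro a b ⟨y, hy, he⟩ ⟨y', hy', he'⟩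
        refine ⟨y * y', mul_ne_zero hy hy', ?_⟩
        rw [hL.dv_mul hy hy', add_sub_add_comm]
        exact add_mem he he'
      neg_mem' := by
        rintro a ⟨y, hy, he⟩
        refine ⟨y⁻¹, inv_ne_zero hy, ?_⟩
        rw [hL.dv_inv, ← neg_sub_neg, neg_neg, neg_neg, ← neg_sub]
        exact neg_mem he }
  have hHle : H0 ≤ Hs := fun D hD => ⟨1, one_ne_zero, by rwa [hL.dv_one, sub_zero]⟩
  have hdvs : ∀ y : L, y ≠ 0 → Dvs.dv y ∈ Hs := fun y hy =>
    ⟨y, hy, by rw [sub_self]; exact zero_mem _⟩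
  obtain ⟨v0⟩ := hL.exists_pl
  have hv0 := hL.dg_pos v0
  have hA0 : ∃ A0 : Dvs L, Dvs.deg p A0 ≠ 0 ∧ ∀ D, ∃ n : ℤ, D - n • A0 ∈ Hs := by
    by_cases hall : ∀ D, D ∈ Hs
    · refine ⟨Finsupp.single v0 1, ?_, fun D => ⟨0, hall _⟩⟩
      rw [Dvs.deg_single]
      positivity
    · push Not at hall
      obtain ⟨A, hA⟩ := hall
      have hgen : ∀ D, ∃ n : ℤ, D - n • A ∈ Hs := by
        intro D
        by_contra hcon
        push Not at hcon
        obtain ⟨φ, hφ, hφ0⟩ := exists_surj_hom q Hs (fun d => hHle (hqall d)) A D hA hcon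
        refine hL.second_ineq hM F (fun w => ⟨blw L w, (hF _ _).2 rfl⟩) ?_ φ hφ
          (fun y hy => hφ0 _ (hdvs y hy)) ?_
        · intro v v' hvv
          rw [Finset.disjoint_left]
          intro w hw hw'
          exact hvv (((hF v w).1 hw).symm.trans ((hF v' w).1 hw'))
        · intro v
          by_cases hv : tw σ (wv v) = wv v
          · rcases hcase v with ⟨h1, -, -, -⟩ | ⟨h, -, h'⟩
            · exfalso
              have : (1 : ℕ) = 0 := h1 (by simpa using hq.one_lt) (by simpa using hqpos) hv
              omega
            · exact Or.inr ⟨_, h, h'⟩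
          · rcases hcase v with ⟨-, -, h3, h4⟩ | ⟨-, h, -⟩
            · exact Or.inl ⟨hφ0 _ (hHle (hs0 v hv)), h3, h4⟩
            · exact absurd h hv
      by_cases hdA : Dvs.deg p A = 0
      · refine ⟨A + q • Finsupp.single v0 1, ?_, fun D => ?_⟩
        · rw [map_add, hdA, zero_add, map_nsmul, Dvs.deg_single]
          simp only [one_mul, nsmul_eq_mul]
          positivity
        · obtain ⟨n, hn⟩ := hgen D
          refine ⟨n, ?_⟩
          rw [smul_add, ← sub_sub]
          exact sub_mem hn (zsmul_mem (hHle (hqall _)) n)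
      · exact ⟨A, hdA, hgen⟩
  obtain ⟨A0, hdA0, hgen⟩ := hA0
  have hdegj : ∀ A : Dvs L, Dvs.deg p (j A) = q * Dvs.deg p A := by
    intro A
    induction A using Finsupp.induction_linear with
    | zero => simp
    | add f g hf hg => rw [map_add, map_add, map_add, hf, hg, mul_add]
    | single v n =>
      have : j (Finsupp.single v n) = ∑ w ∈ F v, Finsupp.single w n := cnm_single _ _ _ _ _
      rw [this, map_sum, Dvs.deg_single]
      rcases hcase v with ⟨-, -, h3, h4⟩ | ⟨h, -, h'⟩
      · rw [Finset.sum_congr rfl fun w hw => by rw [Dvs.deg_single, h4 w hw], Finset.sum_const, h3,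
          nsmul_eq_mul]
      · rw [h, Finset.sum_singleton, Dvs.deg_single, h']
        push_cast
        ring
  have hdegB : Dvs.deg p (j A0) ≠ 0 := by
    rw [hdegj]
    exact mul_ne_zero (by exact_mod_cast hqpos.ne') hdA0
  have hjinv : ∀ A, sDv σ (j A) = j A := by
    intro A
    ext w
    rw [sDv_apply, hj, hj]
    exact congrArg A (blw_tw_iter σ w 1)
  -- z
  have hzH : Dvs.dv z ∈ H0 := by
    rw [← Finsupp.sum_single (Dvs.dv z)]
    refine sum_mem fun v _ => ?_
    rw [hL.dv_apply, hsing]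
    rcases hzloc v with h | ⟨c, h⟩
    · exact zsmul_mem (hs0 v (h _ (hwv v))) _
    · rw [h, mul_comm, mul_smul, natCast_zsmul]
      exact zsmul_mem (hq0 v) c
  obtain ⟨e, he⟩ := hzH
  have hzM : algebraMap L M z ≠ 0 := (_root_.map_ne_zero _).2 hz
  have hdvσ : ∀ y : M, sDv σ (Dvs.dv y) = Dvs.dv (σ y) := by
    intro y
    ext w
    rw [sDv_apply, hM.dv_apply, hM.dv_apply, tw_o]
  suffices hmain : ∃ y, (∑ i ∈ Finset.range q, sUn σ ^ i) y =
      ((Additive.ofMul (Units.mk0 _ hzM), 0) : Additive Mˣ × ℤ) by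
    obtain ⟨y, hy⟩ := hmain
    refine ⟨((y.1.toMul : Mˣ) : M), ?_⟩
    rw [← nUn_fst, hy]; rfl
  refine herbrand_cyc (hM.dvB (j A0)) q (sUn σ) (sDv σ) (sUn_pow_eq_one σ hσq)
    (sDv_pow_eq_one σ hσq) ?_ (hM.dvB_ker _ hdegB) (hM.dvB_range _ hdegB) ?_ ?_
    (Additive.ofMul (Units.mk0 _ hzM), 0) ?_ e ?_
  · rintro ⟨u, n⟩
    show hM.dvB (j A0) ((sUn σ (u, n)).1, n) = _
    rw [hM.dvB_apply, hM.dvB_apply, sUn_fst, map_add, map_zsmul, hjinv, hdvσ]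
  · rintro ⟨u, n⟩ h
    have h1 := nUn_fst σ q (u, n)
    have h2 := nUn_snd σ q (u, n)
    rw [h] at h1 h2
    have hn : n = 0 := by
      have h3 : (0 : ℤ) = q * n := h2
      rcases mul_eq_zero.1 h3.symm with h4 | h4
      · exact absurd h4 (by exact_mod_cast hqpos.ne')
      · exact h4
    obtain ⟨t, ht, hut⟩ := hilb ((u.toMul : Mˣ) : M) (Units.ne_zero _) h1.symm
    refine ⟨(Additive.ofMul (Units.mk0 t ht), 0), ?_⟩
    refine unz_ext ?_ ?_
    · show _ = ((u.toMul : Mˣ) : M)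
      rw [hut]
      show ((((sUn σ (Additive.ofMul (Units.mk0 t ht), 0)).1.toMul : Mˣ) / (Units.mk0 t ht) : Mˣ) : M) = _
      rw [Units.val_div_eq_div_val, sUn_fst]; rfl
    · rw [hn]
      show (sUn σ (Additive.ofMul (Units.mk0 t ht), 0)).2 - 0 = 0
      rw [sUn_snd, sub_zero]
  · intro d hd
    have hd1 : ∀ w, d (tw σ w) = d w := fun w => DFunLike.congr_fun hd w
    have hdi : ∀ i w, d ((tw σ)^[i] w) = d w := by
      intro i
      induction i with
      | zero => intro w; rfl
      | succ i ih => intro w; rw [Function.iterate_succ_apply, ih, hd1]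
    have hwinj : Function.Injective wv := fun v v' h => by rw [← hwv v, h, hwv]
    let A : Dvs L := Finsupp.comapDomain wv d hwinj.injOn
    have hA : ∀ v, A v = d (wv v) := fun v => rfl
    have hdA : d = j A := by
      ext w
      rw [hj, hA]
      have hw := (hF (blw L w) w).2 rfl
      rcases hcase (blw L w) with ⟨-, h2, -, -⟩ | ⟨h, -, -⟩
      · obtain ⟨i, -, hi⟩ := (h2 w).1 hw
        conv_lhs => rw [← hi]
        exact hdi i _
      · rw [h] at hw
        exact congrArg d (Finset.mem_singleton.1 hw)
    obtain ⟨n, y, hy, e', he'⟩ := hgen A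
    have hyM : algebraMap L M y ≠ 0 := (_root_.map_ne_zero _).2 hy
    refine ⟨(Additive.ofMul (Units.mk0 _ hyM), n), e', ?_, ?_⟩
    · refine unz_ext ?_ (sUn_snd _ _)
      rw [sUn_fst]
      exact σ.commutes y
    · rw [hM.dvB_apply]
      show d = Dvs.dv (algebraMap L M y) + n • j A0 + nD e'
      rw [he', map_sub, map_sub, map_zsmul, ← hdA, hjdv]
      abel
  · refine unz_ext ?_ (sUn_snd _ _)
    rw [sUn_fst]
    exact σ.commutes z
  · rw [hM.dvB_apply, zero_smul, add_zero]
    exact (hjdv z).symm.trans he.symm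

end Global2


section Final

open FFPrime

lemma FFPrime.mem_V_one_iff {K : Type} [Field K] {v : FFPrime K} {x : K} :
    x ∈ v.V 1 ↔ 0 < v.ord x := by
  by_cases hx : x = 0
  · simp [mem_V, hx, v.ord_zero]
  · rw [mem_V_of_ne hx, v.coe_o hx, ← WithTop.coe_zero, WithTop.coe_lt_coe]
    omega

lemma FFPrime.mem_V_zero_iff {K : Type} [Field K] {v : FFPrime K} {x : K} :
    x ∈ v.V 0 ↔ 0 ≤ v.ord x := by
  by_cases hx : x = 0
  · simp [mem_V, hx, v.ord_zero]
  · rw [mem_V_of_ne hx, v.coe_o hx, ← WithTop.coe_zero, WithTop.coe_le_coe]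

lemma FFPrime.HasResidueCard.nrm_eq {K : Type} [Field K] {v : FFPrime K} {n : ℕ}
    (h : v.HasResidueCard n) : v.nrm = n := by
  obtain ⟨s, hs, h0, h1, h2⟩ := h
  rw [← hs]
  let g : s → (v.V 0) ⧸ ((v.V 1).addSubgroupOf (v.V 0)) := fun x =>
    QuotientAddGroup.mk ⟨x.1, mem_V_zero_iff.2 (h0 x.1 x.2)⟩
  have hg : Function.Bijective g := by
    constructor
    · intro x y hxy
      by_contra hne
      have h3 := QuotientAddGroup.eq.1 hxy.symm
      rw [AddSubgroup.mem_addSubgroupOf] at h3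
      have h4 : -y.1 + x.1 ∈ v.V 1 := h3
      rw [neg_add_eq_sub, mem_V_one_iff] at h4
      exact h1 x.1 x.2 y.1 y.2 (fun h => hne (Subtype.ext h)) h4
    · intro c
      obtain ⟨⟨t, ht⟩, rfl⟩ := QuotientAddGroup.mk_surjective c
      obtain ⟨x, hx, hxt⟩ := h2 t (mem_V_zero_iff.1 ht)
      refine ⟨⟨x, hx⟩, ?_⟩
      refine QuotientAddGroup.eq.2 ?_
      rw [AddSubgroup.mem_addSubgroupOf]
      show -x + t ∈ v.V 1
      rw [neg_add_eq_sub, mem_V_one_iff]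
      exact hxt
  have := Nat.card_congr (Equiv.ofBijective g hg)
  rw [Nat.card_eq_fintype_card, Fintype.card_coe] at this
  rw [this]
  rfl

lemma FFPrime.nrm_eq_of_resDeg {K L : Type} [Field K] [Field L] {v : FFPrime K} {w : FFPrime L}
    (h : w.resDeg v = 1) : w.nrm = v.nrm := by
  unfold FFPrime.resDeg at h
  split_ifs at h with hh
  obtain ⟨-, m, n, -, hm, hn, hmn⟩ := hh.choose_spec
  rw [h, pow_one] at hmn
  rw [hm.nrm_eq, hn.nrm_eq, hmn]

lemma Ovr.liesOver {L M : Type} [Field L] [Field M] [Algebra L M] {w : FFPrime M} {v : FFPrime L}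
    {e : ℕ} (h : Ovr w v e) : w.LiesOver v (algebraMap L M) := by
  refine ⟨e, h.1, fun x => ?_⟩
  by_cases hx : x = 0
  · rw [hx, map_zero, w.ord_zero, v.ord_zero, WithTop.mul_top]
    have := h.1
    exact_mod_cast this.ne'
  · rw [w.coe_o ((_root_.map_ne_zero _).2 hx), v.coe_o hx, h.2, ← WithTop.coe_mul]

theorem norm_of_gal {p q : ℕ} [Fact p.Prime] (hq : q.Prime)
    {L : Type} [Field L] (ζ : L) (hζ : IsPrimitiveRoot ζ q)
    (a : L) (ha : a ≠ 0) (hdiv : ∀ v : FFPrime L, v.OrdDvd q a)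
    (z : L) (hz : z ≠ 0) (M : Type) [Field M] [Algebra L M] (α : M)
    [Algebra (ZMod p) L] [Algebra (ZMod p) M] [IsScalarTower (ZMod p) L M]
    [FiniteDimensional L M] (hL : IsFF p L) (hM : IsFF p M) (hqM : (q : M) ≠ 0)
    (hα : α ^ q = algebraMap L M a) (hgen : IntermediateField.adjoin L {α} = ⊤)
    (H : Irreducible (X ^ q - C a))
    (hloc : ∀ v : FFPrime L, v.SplitsCompletely (algebraMap L M) ∨ v.OrdDvd q z) :
    ∃ y : M, Algebra.norm L y = z := by
  classical
  haveI : NeZero q := ⟨hq.ne_zero⟩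
  have hne : (primitiveRoots q L).Nonempty := ⟨ζ, (mem_primitiveRoots hq.pos).2 hζ⟩
  have hrank : Module.finrank L M = q := by
    have hintg : IsIntegral L α := Algebra.IsIntegral.isIntegral α
    rw [← IntermediateField.finrank_top' (F := L) (E := M), ← hgen,
      IntermediateField.adjoin.finrank hintg]
    have : X ^ q - C a = minpoly L α :=
      minpoly.eq_of_irreducible_of_monic H (by simp [hα]) (monic_X_pow_sub_C a hq.ne_zero)
    rw [← this, natDegree_X_pow_sub_C]
  haveI : IsSplittingField L M (X ^ q - C a) := by
    have := isSplittingField_X_pow_sub_C_of_root_adjoin_eq_top (K := L) (L := M) (a := a) (α := α)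
      (by rw [hrank]; exact hne) (by rw [hrank]; exact hα) hgen
    rwa [hrank] at this
  haveI : IsGalois L M := isGalois_of_isSplittingField_X_pow_sub_C hne H M
  let E := autEquivZmod H M hζ
  let σ : M ≃ₐ[L] M := E.symm (Multiplicative.ofAdd ((1 : ℕ) : ZMod q))
  have hσ : σ α = algebraMap L M ζ * α := by
    have := autEquivZmod_symm_apply_natCast H M hα hζ 1
    rw [pow_one, Algebra.smul_def] at this
    exact this
  have hgenσ : ∀ x : M ≃ₐ[L] M, x ∈ Subgroup.zpowers σ := by
    intro x
    obtain ⟨n, hn⟩ := ZMod.intCast_surjective (Multiplicative.toAdd (E x))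
    refine ⟨n, ?_⟩
    show σ ^ n = x
    rw [← E.symm_apply_apply x, ← map_zpow]
    congr 1
    rw [← ofAdd_zsmul, ← ofAdd_toAdd (E x), ← hn]
    simp
  haveI : IsCyclic (M ≃ₐ[L] M) := ⟨σ, hgenσ⟩
  have hord : orderOf σ = q := by
    rw [orderOf_eq_card_of_forall_mem_zpowers hgenσ, IsGalois.card_aut_eq_finrank, hrank]
  have hpow : ∀ (i : ℕ) (x : M), (σ ^ i) x = σ^[i] x := by
    intro i x
    induction i generalizing x with
    | zero => rfl
    | succ i ih => rw [pow_succ, Function.iterate_succ_apply, ← ih]; rfl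
  have hσq : ∀ x, σ^[q] x = x := by
    intro x
    rw [← hpow]
    have := pow_orderOf_eq_one σ
    rw [hord] at this
    rw [this]; rfl
  have hnorm : ∀ y : M, algebraMap L M (Algebra.norm L y) = ∏ i ∈ Finset.range q, σ^[i] y := by
    intro y
    rw [Algebra.norm_eq_prod_automorphisms, ← IsCyclic.image_range_orderOf hgenσ, hord,
      Finset.prod_image]
    · exact Finset.prod_congr rfl fun i _ => hpow i y
    · intro i hi j hj hij
      refine pow_injOn_Iio_orderOf ?_ ?_ hij
      · rw [hord]; simpa using hi
      · rw [hord]; simpa using hj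
  have hdich := local_dich hL hM hq hqM hrank σ hσq ζ hζ a ha hdiv α hα hσ
  have hinj : Function.Injective (algebraMap L M) := (algebraMap L M).injective
  obtain ⟨y, hy⟩ := global_norm hL hM hq σ hσq hdich (by
    intro y hy0 hy
    have h1 : Algebra.norm L y⁻¹ = 1 := by
      apply hinj
      rw [Algebra.norm_inv, map_inv₀, hnorm, hy, map_one, inv_one]
    obtain ⟨u, hu⟩ := groupCohomology.exists_div_of_norm_eq_one hgenσ h1
    refine ⟨u, u.ne_zero, ?_⟩
    rw [← inv_inv y, ← hu, inv_div]) z hz (by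
    intro v
    rcases hloc v with h | ⟨n, hn⟩
    · left
      intro w hw hfix
      obtain ⟨w', F, hF, hw'F, -, hcase⟩ := hdich v
      have hres := (h w (by have := (ovr_blw L w).liesOver; rwa [hw] at this)).2
      have hnr := FFPrime.nrm_eq_of_resDeg hres
      have hdg : w.dg p = v.dg p := by unfold FFPrime.dg; rw [hnr]
      rcases hcase with ⟨h1, h2, -, -⟩ | ⟨h1, -, h3⟩
      · obtain ⟨i, -, hi⟩ := (h2 w).1 ((hF w).2 hw)
        have hw1 : tw σ w' = w' := by
          have e1 : (tw σ)^[q] w' = w' := ext_o fun x _ => by rw [tw_iter_o, hσq]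
          have hit : ∀ n, (tw σ)^[n] w = w := fun n => Function.iterate_fixed hfix n
          have hper : (tw σ)^[i * q] w' = w' := by
            rw [mul_comm, Function.iterate_mul]; exact Function.iterate_fixed e1 i
          have e2 : w = w' := by
            obtain ⟨q', rfl⟩ : ∃ q', q = q' + 1 := ⟨q - 1, by have := hq.pos; omega⟩
            have : i * (q' + 1) = i * q' + i := by ring
            rw [this, Function.iterate_add_apply, hi, hit] at hper
            exact hper
          rw [← e2, hfix]
        have : (1 : ℕ) = 0 := h1 (by simpa using hq.one_lt) (by simpa using hq.pos) hw1
        omega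
      · have e1 : w = w' := by
          have := (hF w).2 hw
          rw [h1] at this
          exact Finset.mem_singleton.1 this
        rw [← e1, hdg] at h3
        have := hL.dg_pos v
        have := hq.two_le
        nlinarith
    · right
      refine ⟨n, ?_⟩
      rw [v.coe_o hz] at hn
      exact WithTop.coe_injective hn)
  refine ⟨y, hinj ?_⟩
  rw [hnorm, hy]

theorem norm_final (p q : ℕ) [Fact p.Prime] (hq : q.Prime) (hqp : q ≠ p)
    (L : Type) [Field L] [Algebra (RatFunc (ZMod p)) L]
    [FiniteDimensional (RatFunc (ZMod p)) L]
    (ζ : L) (hζ : IsPrimitiveRoot ζ q)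
    (a : L) (ha : a ≠ 0)
    (hdiv : ∀ v : FFPrime L, v.OrdDvd q a)
    (z : L) (hz : z ≠ 0)
    (M : Type) [Field M] [Algebra L M] (α : M)
    (hα : α ^ q = algebraMap L M a)
    (hgen : IntermediateField.adjoin L {α} = ⊤)
    (hloc : ∀ v : FFPrime L, v.SplitsCompletely (algebraMap L M) ∨ v.OrdDvd q z) :
    ∃ y : M, Algebra.norm L y = z := by
  by_cases hb : ∃ b : L, b ^ q = a
  · obtain ⟨b, hb⟩ := hb
    have hb0 : b ≠ 0 := by
      rintro rfl
      rw [zero_pow hq.ne_zero] at hb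
      exact ha hb.symm
    have hbM : algebraMap L M b ≠ 0 := (_root_.map_ne_zero _).2 hb0
    have hζM : IsPrimitiveRoot (algebraMap L M ζ) q := hζ.map_of_injective (algebraMap L M).injective
    haveI : NeZero q := ⟨hq.ne_zero⟩
    have h1 : (α / algebraMap L M b) ^ q = 1 := by
      rw [div_pow, hα, ← hb, map_pow, div_self (pow_ne_zero _ hbM)]
    obtain ⟨i, -, hi⟩ := hζM.eq_pow_of_pow_eq_one h1
    have h2 : α ∈ (⊥ : IntermediateField L M) := by
      rw [IntermediateField.mem_bot]
      refine ⟨ζ ^ i * b, ?_⟩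
      rw [map_mul, map_pow, hi, div_mul_cancel₀ _ hbM]
    have h3 : (⊥ : IntermediateField L M) = ⊤ := by
      rw [← hgen, eq_comm, IntermediateField.adjoin_simple_eq_bot_iff]
      exact h2
    have h4 : Module.finrank L M = 1 := by
      rw [← IntermediateField.finrank_top' (F := L) (E := M), ← h3, IntermediateField.finrank_bot]
    refine ⟨algebraMap L M z, ?_⟩
    rw [Algebra.norm_algebraMap, h4, pow_one]
  · push Not at hb
    have H : Irreducible (X ^ q - C a) := X_pow_sub_C_irreducible_of_prime hq hb
    have hintg : IsIntegral L α := by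
      refine IsIntegral.of_pow hq.pos ?_
      rw [hα]; exact isIntegral_algebraMap
    haveI : FiniteDimensional L M := by
      have h1 := IntermediateField.adjoin.finiteDimensional hintg
      rw [hgen] at h1
      exact LinearEquiv.finiteDimensional (IntermediateField.topEquiv (F := L) (E := M)).toLinearEquiv
    letI : Algebra (ZMod p) L :=
      ((algebraMap (RatFunc (ZMod p)) L).comp (algebraMap (ZMod p) (RatFunc (ZMod p)))).toAlgebra
    letI : Algebra (ZMod p) M := ((algebraMap L M).comp (algebraMap (ZMod p) L)).toAlgebra
    haveI : IsScalarTower (ZMod p) (RatFunc (ZMod p)) L := IsScalarTower.of_algebraMap_eq fun _ => rfl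
    haveI : IsScalarTower (ZMod p) L M := IsScalarTower.of_algebraMap_eq fun _ => rfl
    obtain ⟨hL, hM⟩ := isFF_tower (p := p) L M
    have hqM : (q : M) ≠ 0 := by
      have h1 : ((q : ZMod p)) ≠ 0 := by
        rw [Ne, ZMod.natCast_eq_zero_iff]
        intro h
        exact hqp ((Nat.prime_dvd_prime_iff_eq Fact.out hq).1 h).symm
      rw [← map_natCast (algebraMap (ZMod p) M)]
      exact (_root_.map_ne_zero _).2 h1
    exact norm_of_gal hq ζ hζ a ha hdiv z hz M α hL hM hqM hα hgen H hloc

end Final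

end HelperMaterial

/-- (Hasse Norm Principle application.)  If the divisor of `a` over
the global function field `L` (containing a primitive `q`-th root of unity) is a
`q`-th power of a divisor, and `z ∈ L^×` is such that every prime of `L` either splits
completely in `L(a^{1/q})/L` or satisfies `ord z ≡ 0 mod q`, then `z` is an
`L(a^{1/q})`-norm. -/
theorem statement12 (p q : ℕ) [Fact p.Prime] (hq : q.Prime) (hqp : q ≠ p)
    (L : Type) [Field L] [Algebra (RatFunc (ZMod p)) L]
    [FiniteDimensional (RatFunc (ZMod p)) L]
    (ζ : L) (hζ : IsPrimitiveRoot ζ q)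
    (a : L) (ha : a ≠ 0)
    (hdiv : ∀ v : FFPrime L, v.OrdDvd q a)
    (z : L) (hz : z ≠ 0)
    (M : Type) [Field M] [Algebra L M] (α : M)
    (hα : α ^ q = algebraMap L M a)
    (hgen : IntermediateField.adjoin L {α} = ⊤)
    (hloc : ∀ v : FFPrime L, v.SplitsCompletely (algebraMap L M) ∨ v.OrdDvd q z) :
    ∃ y : M, Algebra.norm L y = z := by
  exact norm_final p q hq hqp L ζ hζ a ha hdiv z hz M α hα hgen hloc
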